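/- arXiv:1801.00709 — 3 statements merged into one kernel-verified Lean document; each statement's English description precedes it below -/
import Mathlib

section
/- Let n ≥ 2 and suppose the cluster pattern with initial seed (B, (u_1,…,u_n)) is of type C_n. Let y be a cluster variable of the pattern with y ∉ {u_1,…,u_n}, and write y = f(u_1,…,u_n)/(u_1^{d_1}⋯u_n^{d_n}) with f ∈ ℤ[u_1,…,u_n] not divisible by any u_i. Then f satisfies the positive condition: for every 1 ≤ i ≤ n, f(ε_i) > 0, where ε_i = (1,…,1,0,1,…,1) is the vector with 0 in the i-th position and 1 in every other position. -/
open MvPolynomial Matrix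

noncomputable section

/-- The ambient field `ℚ(u_1, …, u_n)`. -/
abbrev CAField (n : ℕ) : Type := FractionRing (MvPolynomial (Fin n) ℚ)

/-- The initial cluster variables `u_i`. -/
def uVar (n : ℕ) (i : Fin n) : CAField n :=
  algebraMap (MvPolynomial (Fin n) ℚ) (CAField n) (X i)

/-- Fomin–Zelevinsky matrix mutation in direction `k`. -/
def mutMat {n : ℕ} (k : Fin n) (B : Matrix (Fin n) (Fin n) ℤ) :
    Matrix (Fin n) (Fin n) ℤ := fun i j =>
  if i = k ∨ j = k then -B i j
  else B i j + (B i k).sign * max (B i k * B k j) 0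

/-- Seed mutation in direction `k`: the matrix mutates by `mutMat` and the
`k`-th cluster variable `x_k` is replaced by
`(∏ x_i^{[B_ik]_+} + ∏ x_i^{[-B_ik]_+}) / x_k`. -/
def mutSeed {n : ℕ} (k : Fin n)
    (s : Matrix (Fin n) (Fin n) ℤ × (Fin n → CAField n)) :
    Matrix (Fin n) (Fin n) ℤ × (Fin n → CAField n) :=
  (mutMat k s.1,
    Function.update s.2 k
      ((∏ i, s.2 i ^ (s.1 i k).toNat + ∏ i, s.2 i ^ (-(s.1 i k)).toNat) / s.2 k))

/-- The seeds of the cluster pattern with initial exchange matrix `B₀` and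
initial cluster `(u_1, …, u_n)`: all seeds reachable from the initial seed
by finite sequences of mutations. -/
def IsSeed {n : ℕ} (B₀ : Matrix (Fin n) (Fin n) ℤ)
    (s : Matrix (Fin n) (Fin n) ℤ × (Fin n → CAField n)) : Prop :=
  Relation.ReflTransGen (fun a b => ∃ k, b = mutSeed k a) (B₀, uVar n) s

/-- `B` is skew-symmetrizable: `D * B` is skew-symmetric for some diagonal `D`
with positive integer diagonal entries. -/
def SkewSymmetrizable {n : ℕ} (B : Matrix (Fin n) (Fin n) ℤ) : Prop :=
  ∃ d : Fin n → ℤ, (∀ i, 0 < d i) ∧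
    (Matrix.diagonal d * B)ᵀ = -(Matrix.diagonal d * B)

/-- The Cartan counterpart `A(B)` of `B`. -/
def cartanCounterpart {n : ℕ} (B : Matrix (Fin n) (Fin n) ℤ) :
    Matrix (Fin n) (Fin n) ℤ := fun i j => if i = j then 2 else -|B i j|

/-- The Cartan matrix of type `C_n` (with rows and columns indexed by
`0, …, n-1`): `2` on the diagonal, `-2` in position `(n-2, n-1)`, and `-1`
in the remaining positions `(i, i±1)`. -/
def cartanC (n : ℕ) : Matrix (Fin n) (Fin n) ℤ := fun i j =>
  if i = j then 2
  else if i.val + 2 = n ∧ j.val + 1 = n then -2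
  else if i.val + 1 = j.val ∨ j.val + 1 = i.val then -1 else 0

/-- The cluster pattern with initial matrix `B₀` is of the finite type with
Cartan matrix `Cmat`: some seed of the pattern has exchange matrix whose
Cartan counterpart equals `Cmat` up to simultaneous permutation of rows and
columns. -/
def PatternOfType {n : ℕ} (Cmat B₀ : Matrix (Fin n) (Fin n) ℤ) : Prop :=
  ∃ s, IsSeed B₀ s ∧ ∃ σ : Equiv.Perm (Fin n),
    ∀ i j, cartanCounterpart s.1 (σ i) (σ j) = Cmat i j

/-- `d` is the denominator vector of `y` with respect to the cluster `z`:
`y = f(z_1, …, z_n) / ∏ z_i^{d_i}` with `f` an integer polynomial not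
divisible by any variable. -/
def IsDenomVec {n : ℕ} (z : Fin n → CAField n) (y : CAField n)
    (d : Fin n → ℤ) : Prop :=
  ∃ f : MvPolynomial (Fin n) ℤ, (∀ i, ¬ X i ∣ f) ∧
    y = MvPolynomial.aeval z f / ∏ i, z i ^ d i

/-- `y` is a cluster variable of the pattern with initial matrix `B₀`. -/
def IsClusterVar {n : ℕ} (B₀ : Matrix (Fin n) (Fin n) ℤ) (y : CAField n) : Prop :=
  ∃ s, IsSeed B₀ s ∧ ∃ j, s.2 j = y

/-- The point with `0` in position `i` and `1` elsewhere. -/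
def epsPt {n : ℕ} (i : Fin n) : Fin n → ℤ := fun j => if j = i then (0 : ℤ) else 1

theorem aeval_uVar_injective (n : ℕ) :
    Function.Injective (MvPolynomial.aeval (R := ℤ) (uVar n)) := by
  have h : ∀ p : MvPolynomial (Fin n) ℤ, MvPolynomial.aeval (uVar n) p =
      algebraMap (MvPolynomial (Fin n) ℚ) (CAField n) (MvPolynomial.map (Int.castRingHom ℚ) p) := by
    intro p
    induction p using MvPolynomial.induction_on with
    | C a => simp
    | add p q hp hq => simp [hp, hq]
    | mul_X p j hp => simp [hp, uVar]
  intro p q hpq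
  rw [h, h] at hpq
  exact MvPolynomial.map_injective _ Int.cast_injective
    (IsFractionRing.injective (MvPolynomial (Fin n) ℚ) (CAField n) hpq)

theorem uVar_ne_zero {n : ℕ} (i : Fin n) : uVar n i ≠ 0 := by
  intro h
  have : (X i : MvPolynomial (Fin n) ℤ) = 0 := aeval_uVar_injective n (by simpa using h)
  exact X_ne_zero i this

theorem aeval_ne_zero_of_pos {n : ℕ} {i : Fin n} {P : MvPolynomial (Fin n) ℤ}
    (h : 0 < eval (epsPt i) P) : MvPolynomial.aeval (uVar n) P ≠ 0 := by
  intro h0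
  have : P = 0 := aeval_uVar_injective n (by simpa using h0)
  simp [this] at h

/-- `y = u_i^a P / Q` where `P` and `Q` are positive at `ε_i`. -/
def GoodAt {n : ℕ} (i : Fin n) (y : CAField n) : Prop :=
  ∃ (a : ℤ) (P Q : MvPolynomial (Fin n) ℤ), 0 < eval (epsPt i) P ∧ 0 < eval (epsPt i) Q ∧
    y = uVar n i ^ a * MvPolynomial.aeval (uVar n) P / MvPolynomial.aeval (uVar n) Q

theorem GoodAt.one {n : ℕ} (i : Fin n) : GoodAt i (1 : CAField n) :=
  ⟨0, 1, 1, by simp, by simp, by simp⟩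

theorem GoodAt.var {n : ℕ} (i j : Fin n) : GoodAt i (uVar n j) := by
  by_cases h : j = i
  · subst h
    exact ⟨1, 1, 1, by simp, by simp, by simp⟩
  · exact ⟨0, X j, 1, by simp [epsPt, h], by simp, by simp⟩

theorem GoodAt.mul {n : ℕ} {i : Fin n} {x y : CAField n} (hx : GoodAt i x) (hy : GoodAt i y) :
    GoodAt i (x * y) := by
  obtain ⟨a, P, Q, hP, hQ, rfl⟩ := hx
  obtain ⟨b, R, S, hR, hS, rfl⟩ := hy
  refine ⟨a + b, P * R, Q * S, by simpa using mul_pos hP hR, by simpa using mul_pos hQ hS, ?_⟩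
  rw [zpow_add₀ (uVar_ne_zero i), map_mul, map_mul]
  ring

theorem GoodAt.inv {n : ℕ} {i : Fin n} {x : CAField n} (hx : GoodAt i x) : GoodAt i x⁻¹ := by
  obtain ⟨a, P, Q, hP, hQ, rfl⟩ := hx
  refine ⟨-a, Q, P, hQ, hP, ?_⟩
  rw [_root_.zpow_neg, inv_div, div_eq_mul_inv, mul_inv]
  ring

theorem GoodAt.add {n : ℕ} {i : Fin n} {x y : CAField n} (hx : GoodAt i x) (hy : GoodAt i y) :
    GoodAt i (x + y) := by
  obtain ⟨a, P, Q, hP, hQ, rfl⟩ := hx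
  obtain ⟨b, R, S, hR, hS, rfl⟩ := hy
  wlog hab : a ≤ b generalizing a b P Q R S
  · rw [add_comm]
    exact this b R S hR hS a P Q hP hQ (by omega)
  obtain ⟨k, rfl⟩ := Int.le.dest hab
  refine ⟨a, P * S + X i ^ k * R * Q, Q * S, ?_, by simpa using mul_pos hQ hS, ?_⟩
  · have h1 := mul_pos hP hS
    have h2 : 0 ≤ (epsPt i i) ^ k := by simp [epsPt]
    have h3 := mul_nonneg (mul_nonneg h2 hR.le) hQ.le
    simp only [map_add, map_mul, map_pow, eval_X]
    linarith
  · have h1 := aeval_ne_zero_of_pos hQ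
    have h2 := aeval_ne_zero_of_pos hS
    rw [zpow_add₀ (uVar_ne_zero i)]
    simp only [map_add, map_mul, map_pow, aeval_X, zpow_natCast]
    field_simp

theorem GoodAt.pow {n : ℕ} {i : Fin n} {x : CAField n} (hx : GoodAt i x) (k : ℕ) :
    GoodAt i (x ^ k) := by
  induction k with
  | zero => simpa using GoodAt.one i
  | succ k ih => rw [pow_succ]; exact ih.mul hx

theorem GoodAt.zpow {n : ℕ} {i : Fin n} {x : CAField n} (hx : GoodAt i x) (k : ℤ) :
    GoodAt i (x ^ k) := by
  cases k with
  | ofNat k => simpa using hx.pow k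
  | negSucc k => rw [zpow_negSucc]; exact (hx.pow _).inv

theorem GoodAt.prod {n : ℕ} {i : Fin n} (g : Fin n → CAField n) (hg : ∀ j, GoodAt i (g j)) :
    GoodAt i (∏ j, g j) :=
  Finset.prod_induction g (GoodAt i) (fun _ _ h1 h2 => h1.mul h2) (GoodAt.one i) (fun j _ => hg j)

theorem IsSeed.goodAt {n : ℕ} {B : Matrix (Fin n) (Fin n) ℤ}
    {s : Matrix (Fin n) (Fin n) ℤ × (Fin n → CAField n)} (hs : IsSeed B s) (i : Fin n) :
    ∀ j, GoodAt i (s.2 j) := by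
  induction hs with
  | refl => exact fun j => GoodAt.var i j
  | tail _ hstep ih =>
    obtain ⟨k, rfl⟩ := hstep
    intro j
    by_cases h : j = k
    · subst h
      simp only [mutSeed, Function.update_self]
      rw [div_eq_mul_inv]
      exact ((GoodAt.prod _ fun l => (ih l).pow _).add (GoodAt.prod _ fun l => (ih l).pow _)).mul
        (ih j).inv
    · simpa only [mutSeed, Function.update_of_ne h] using ih j

theorem not_X_dvd_of_pos {n : ℕ} {i : Fin n} {P : MvPolynomial (Fin n) ℤ}
    (h : 0 < eval (epsPt i) P) : ¬ X i ∣ P := by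
  rintro ⟨R, rfl⟩
  simp [epsPt] at h

theorem eval_pos_of_goodAt {n : ℕ} {i : Fin n} {f : MvPolynomial (Fin n) ℤ} (hf : ¬ X i ∣ f)
    (h : GoodAt i (MvPolynomial.aeval (uVar n) f)) : 0 < eval (epsPt i) f := by
  obtain ⟨a, P, Q, hP, hQ, h⟩ := h
  have hQ0 := aeval_ne_zero_of_pos hQ
  have hu := uVar_ne_zero (n := n) i
  rw [eq_div_iff hQ0] at h
  obtain ⟨k, rfl | rfl⟩ := a.eq_nat_or_neg
  · have e : f * Q = X i ^ k * P := aeval_uVar_injective n (by simpa using h)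
    rcases Nat.eq_zero_or_pos k with rfl | hk
    · have e2 := congrArg (eval (epsPt i)) e
      simp only [pow_zero, one_mul, map_mul] at e2
      exact pos_of_mul_pos_left (e2 ▸ hP) hQ.le
    · have hd : X i ∣ f * Q := e ▸ (dvd_pow_self _ hk.ne').mul_right _
      rcases (MvPolynomial.X_prime (R := ℤ) (i := i)).dvd_or_dvd hd with h1 | h1
      · exact absurd h1 hf
      · exact absurd h1 (not_X_dvd_of_pos hQ)
  · have e : X i ^ k * (f * Q) = P := by
      apply aeval_uVar_injective n
      simp only [map_mul, map_pow, aeval_X]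
      rw [h, _root_.zpow_neg, zpow_natCast, ← mul_assoc, mul_inv_cancel₀ (pow_ne_zero k hu), one_mul]
    rcases Nat.eq_zero_or_pos k with rfl | hk
    · have e2 := congrArg (eval (epsPt i)) e
      simp only [pow_zero, one_mul, map_mul] at e2
      exact pos_of_mul_pos_left (e2 ▸ hP) hQ.le
    · exact absurd (e ▸ (dvd_pow_self _ hk.ne').mul_right _) (not_X_dvd_of_pos hP)

/-- In a cluster pattern of type `C_n` (`n ≥ 2`), write a non-initial cluster
variable as `y = f(u_1, …, u_n) / ∏ u_i^{d_i}` with `f` not divisible by any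
`u_i`.  Then `f` satisfies the positive condition: `f(ε_i) > 0` for each
vector `ε_i` having `0` in the `i`-th position and `1` elsewhere. -/
theorem numerator_positive_condition_type_C {n : ℕ} (hn : 2 ≤ n)
    (B : Matrix (Fin n) (Fin n) ℤ) (hB : SkewSymmetrizable B)
    (htype : PatternOfType (cartanC n) B) (y : CAField n)
    (hy : IsClusterVar B y) (hy0 : ∀ i, y ≠ uVar n i)
    (f : MvPolynomial (Fin n) ℤ) (hf : ∀ i, ¬ X i ∣ f) (d : Fin n → ℤ)
    (hyf : y = MvPolynomial.aeval (uVar n) f / ∏ i, uVar n i ^ d i) :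
    ∀ i : Fin n,
      0 < MvPolynomial.eval (fun j => if j = i then (0 : ℤ) else 1) f := by
  intro i
  obtain ⟨s, hs, j, rfl⟩ := hy
  apply eval_pos_of_goodAt (hf i)
  have hne : ∏ l, uVar n l ^ d l ≠ 0 :=
    Finset.prod_ne_zero_iff.2 fun l _ => zpow_ne_zero _ (uVar_ne_zero l)
  rw [← (eq_div_iff hne).1 hyf]
  exact (hs.goodAt i j).mul (GoodAt.prod _ fun l => (GoodAt.var i l).zpow _)
end
end

section
/- Let n ≥ 2 and let B be a skew-symmetrizable n×n integer matrix of type C_n. Then every c-vector of the cluster algebra with principal coefficients and initial exchange matrix B is sign-coherent, i.e. its entries are either all nonnegative or all nonpositive. -/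
open MvPolynomial Matrix

noncomputable section

/-- The matrix `B` is of type `C_n`: some matrix obtained from `B` by a finite
sequence of mutations has Cartan counterpart equal, up to simultaneous
permutation of rows and columns, to the Cartan matrix of type `C_n`. -/
def MatrixOfTypeC {n : ℕ} (B : Matrix (Fin n) (Fin n) ℤ) : Prop :=
  ∃ B', Relation.ReflTransGen (fun a c => ∃ k, c = mutMat k a) B B' ∧
    ∃ σ : Equiv.Perm (Fin n),
      ∀ i j, cartanCounterpart B' (σ i) (σ j) = cartanC n i j

/-- Mutation in direction `k` of a `2n × n` integer matrix (rows indexed by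
`Fin n ⊕ Fin n`, the first block being the principal part). -/
def mutMatExt {n : ℕ} (k : Fin n) (b : Matrix (Fin n ⊕ Fin n) (Fin n) ℤ) :
    Matrix (Fin n ⊕ Fin n) (Fin n) ℤ := fun i j =>
  if i = Sum.inl k ∨ j = k then -b i j
  else b i j + (b i k).sign * max (b i k * b (Sum.inl k) j) 0

/-- The `2n × n` matrix `B̃` with top part `B` and bottom part the identity. -/
def extMat {n : ℕ} (B : Matrix (Fin n) (Fin n) ℤ) :
    Matrix (Fin n ⊕ Fin n) (Fin n) ℤ := fun i j =>
  Sum.elim (fun i' => B i' j) (fun i' => if i' = j then 1 else 0) i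

/-- The `2n × n` exchange matrices of the principal-coefficients pattern with
initial matrix `B`: all matrices obtained from `B̃` by finite sequences of
mutations. -/
def IsExtMat {n : ℕ} (B : Matrix (Fin n) (Fin n) ℤ)
    (b : Matrix (Fin n ⊕ Fin n) (Fin n) ℤ) : Prop :=
  Relation.ReflTransGen (fun a c => ∃ k, c = mutMatExt k a) (extMat B) b

/-- `c` is a `c`-vector of the cluster algebra with principal coefficients and
initial exchange matrix `B`: a column of the bottom part of some exchange
matrix of the pattern. -/
def IsCVec {n : ℕ} (B : Matrix (Fin n) (Fin n) ℤ) (c : Fin n → ℤ) : Prop :=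
  ∃ b, IsExtMat B b ∧ ∃ j, c = fun i => b (Sum.inr i) j


namespace CSC
def sg (m x : ℤ) : ℤ := if x < m then x + m else x - m
def cyc (a b c : ℤ) : Prop := (a < b ∧ b < c) ∨ (b < c ∧ c < a) ∨ (c < a ∧ a < b)
/-- split -/
def ins (p q v : ℤ) : Prop := (p ≤ v ∧ v < q) ∨ (q ≤ v ∧ v < p)
open Classical in
noncomputable def sep (p q u v : ℤ) : ℤ := if (ins p q u ↔ ins p q v) then 0 else 1
def crosses (a b c d : ℤ) : Prop :=
  (cyc a c b ∧ cyc b d a) ∨ (cyc a d b ∧ cyc b c a)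

theorem cyc_rot {a b c : ℤ} (h : cyc a b c) : cyc b c a := by unfold cyc at *; omega
theorem cyc_flip {a b c d : ℤ} (h : cyc a c d) (h' : cyc c a b) : cyc b d a := by
  unfold cyc at *; omega
theorem cyc_ne {a b c d : ℤ} (h : cyc a c d) (h' : cyc c a b) : b ≠ d := by
  unfold cyc at *; omega
theorem cyc_ne1 {a b c : ℤ} (h : cyc a b c) : a ≠ b := by
  unfold cyc at *; omega
theorem crosses_symm {a b c d : ℤ} (h : crosses a b c d) : crosses c d a b := by
  unfold crosses cyc at *; omega
theorem crosses_quad {a b c d : ℤ} (h : cyc a c d) (h' : cyc c a b) : crosses b d a c := by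
  unfold crosses cyc at *; omega
theorem lemX {a b c d p q : ℤ} (h : cyc a c d) (h' : cyc c a b)
   (h1 : ¬ crosses p q a b) (h2 : ¬ crosses p q b c) (h3 : ¬ crosses p q c d) (h4 : ¬ crosses p q d a)
   (hx : crosses p q b d) : (p = a ∧ q = c) ∨ (p = c ∧ q = a) := by
  unfold crosses cyc at *; grind
theorem ptol {a b c d p q : ℤ} (h : cyc a c d) (h' : cyc c a b) :
    sep p q a c + sep p q b d = max (sep p q c d + sep p q a b) (sep p q d a + sep p q b c) := by
  unfold sep
  by_cases ha : ins p q a <;> by_cases hb : ins p q b <;> by_cases hc : ins p q c <;> by_cases hd : ins p q d <;> simp [ha,hb,hc,hd] <;> 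
  (unfold ins cyc at *; omega)

/-- (minus) shear of the split `p q` across the quadrilateral. -/
noncomputable def shr (p q a b c d : ℤ) : ℤ :=
  sep p q c d - sep p q d a + sep p q a b - sep p q b c
theorem sep_symm (p q u v : ℤ) : sep p q u v = sep p q v u := by
  unfold sep
  by_cases h : (ins p q u ↔ ins p q v)
  · rw [if_pos h, if_pos h.symm]
  · rw [if_neg h, if_neg (fun h' => h h'.symm)]
theorem compat {a b c d p q p' q' : ℤ}
    (hx : ¬ crosses p q p' q') :
    (0 ≤ shr p q a b c d ∧ 0 ≤ shr p' q' a b c d) ∨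
    (shr p q a b c d ≤ 0 ∧ shr p' q' a b c d ≤ 0) := by
  have key : ∀ x y z w : ℤ, ¬ ((ins p q x ↔ ins p q y) ∧ (ins p q z ↔ ins p q w) ∧ ¬ (ins p q x ↔ ins p q z) ∧ (ins p' q' x ↔ ins p' q' w) ∧ (ins p' q' y ↔ ins p' q' z) ∧ ¬ (ins p' q' x ↔ ins p' q' y)) := by
    have : (∀ v, ¬ (ins p q v ∧ ins p' q' v)) ∨ (∀ v, ¬ (ins p q v ∧ ¬ ins p' q' v)) ∨ (∀ v, ¬ (¬ ins p q v ∧ ins p' q' v)) ∨ (∀ v, ¬ (¬ ins p q v ∧ ¬ ins p' q' v)) := by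
      by_contra hc
      push Not at hc
      obtain ⟨⟨x, hx1, hx2⟩, ⟨y, hy1, hy2⟩, ⟨z, hz1, hz2⟩, w, hw1, hw2⟩ := hc
      unfold ins crosses cyc at *
      grind
    rintro x y z w ⟨e1, e2, e3, e4, e5, e6⟩
    rcases this with h | h | h | h <;>
      (have h1 := h x; have h2 := h y; have h3 := h z; have h4 := h w; clear h
       by_cases i1 : ins p q x <;> by_cases i2 : ins p' q' x <;>
         simp only [i1, i2, true_iff, iff_true, false_iff, iff_false, not_not] at e1 e2 e3 e4 e5 e6 <;>
         simp_all)
  have k1 := key a b c d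
  have k2 := key b c d a
  have k3 := key c d a b
  have k4 := key d a b c
  clear key hx
  unfold shr sep
  by_cases ha : ins p q a <;> by_cases hb : ins p q b <;> by_cases hc : ins p q c <;>
    by_cases hd : ins p q d <;> by_cases ha' : ins p' q' a <;> by_cases hb' : ins p' q' b <;>
    by_cases hc' : ins p' q' c <;> by_cases hd' : ins p' q' d <;>
    simp [ha, hb, hc, hd, ha', hb', hc', hd'] at k1 k2 k3 k4 ⊢
theorem shr_self {a b c d : ℤ} (h : cyc a c d) (h' : cyc c a b) :
    shr a c a b c d = -2 := by
  unfold shr sep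
  by_cases ha : ins a c a <;> by_cases hb : ins a c b <;> by_cases hc : ins a c c <;>
    by_cases hd : ins a c d <;> simp [ha, hb, hc, hd] <;> (unfold ins cyc at *; omega)
theorem shr_nonpos {a b c d p q : ℤ} (h : cyc a c d) (h' : cyc c a b)
    (h0 : ¬ crosses p q a c)
    (h1 : ¬ crosses p q a b) (h2 : ¬ crosses p q b c) (h3 : ¬ crosses p q c d)
    (h4 : ¬ crosses p q d a) : shr p q a b c d ≤ 0 := by
  unfold shr sep
  by_cases ha : ins p q a <;> by_cases hb : ins p q b <;> by_cases hc : ins p q c <;>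
    by_cases hd : ins p q d <;> simp [ha, hb, hc, hd] <;> (unfold ins crosses cyc at *; grind)
theorem shr_zero {a b c d p q : ℤ} (h : cyc a c d) (h' : cyc c a b)
    (h0 : ¬ crosses p q a c)
    (h1 : ¬ crosses p q a b) (h2 : ¬ crosses p q b c) (h3 : ¬ crosses p q c d)
    (h4 : ¬ crosses p q d a) (hn : ¬ (p = a ∧ q = c)) (hn' : ¬ (p = c ∧ q = a)) :
    shr p q a b c d = 0 := by
  unfold shr sep
  by_cases ha : ins p q a <;> by_cases hb : ins p q b <;> by_cases hc : ins p q c <;>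
    by_cases hd : ins p q d <;> simp [ha, hb, hc, hd] <;> (unfold ins crosses cyc at *; grind)
def rng (m x : ℤ) : Prop := 0 ≤ x ∧ x < 2 * m
theorem sg_sg {m x : ℤ} (h : rng m x) : sg m (sg m x) = x := by
  unfold sg rng at *; split_ifs <;> omega
theorem sg_ne {m x : ℤ} (h : rng m x) : sg m x ≠ x := by
  unfold sg rng at *; split_ifs <;> omega
theorem sep_sg {m p q u v : ℤ} (hp : rng m p) (hq : rng m q) (hu : rng m u) (hv : rng m v) :
    sep (sg m p) (sg m q) (sg m u) (sg m v) = sep p q u v := by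
  have h1 : (ins (sg m p) (sg m q) (sg m u) ↔ ins (sg m p) (sg m q) (sg m v)) ↔
      (ins p q u ↔ ins p q v) := by
    unfold rng at *
    unfold sg ins
    split_ifs <;> omega
  unfold sep
  by_cases h : (ins p q u ↔ ins p q v)
  · rw [if_pos h, if_pos (h1.2 h)]
  · rw [if_neg h, if_neg (fun h' => h (h1.1 h'))]
end CSC

namespace CSC
/-- Fixed combinatorial data: half-edges with symmetry, gluing and labels. -/
structure Comb (n : ℕ) (H : Type) where
  σ : H → H
  ι : H → H
  lab : H → Option (Fin n)
  σσ : ∀ h, σ (σ h) = h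
  ιι : ∀ h, ι (ι h) = h
  σι : ∀ h, σ (ι h) = ι (σ h)
  labσ : ∀ h, lab (σ h) = lab h
  labι : ∀ h, lab (ι h) = lab h
  orb : ∀ h h' j, lab h = some j → lab h' = some j →
    h' = h ∨ h' = ι h ∨ h' = σ h ∨ h' = σ (ι h)
  surj : ∀ j, ∃ h, lab h = some j

/-- A centrally symmetric triangulation. -/
structure St {n : ℕ} {H : Type} (K : Comb n H) (m : ℤ) (φ : H → H) (o : H → ℤ) : Prop where
  φ3 : ∀ h, φ (φ (φ h)) = h
  φσ : ∀ h, φ (K.σ h) = K.σ (φ h)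
  rg : ∀ h, rng m (o h)
  oσ : ∀ h, o (K.σ h) = sg m (o h)
  tri : ∀ h, cyc (o h) (o (φ h)) (o (φ (φ h)))
  oι : ∀ h j, K.lab h = some j → o (K.ι h) = o (φ h)
  ncr : ∀ h h', ¬ crosses (o h) (o (φ h)) (o h') (o (φ h'))
  uniq : ∀ h e j, K.lab h = some j → o e = o h → o (φ e) = o (φ h) → K.lab e = some j

variable {n : ℕ} {H : Type} {K : Comb n H} {m : ℤ} {φ : H → H} {o : H → ℤ}

def flφ (K : Comb n H) (φ : H → H) (k : Fin n) (h : H) : H :=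
  if K.lab h = some k then φ (φ h)
  else if K.lab (φ h) = some k then φ (K.ι (φ h))
  else if K.lab (φ (φ h)) = some k then K.ι (φ (φ h))
  else φ h

def flo (K : Comb n H) (φ : H → H) (o : H → ℤ) (k : Fin n) (h : H) : ℤ :=
  if K.lab h = some k then o (φ (φ (K.ι h))) else o h

theorem St.tι (S : St K m φ o) {h : H} {j : Fin n} (hj : K.lab h = some j) :
    o (φ (K.ι h)) = o h := by
  have := S.oι (K.ι h) j (by rw [K.labι, hj])
  rw [K.ιι] at this
  exact this.symm

theorem St.adj (S : St K m φ o) {u v : H} {j : Fin n} (hu : K.lab u = some j)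
    (hv : K.lab v = some j) (h1 : o (φ u) = o v) (h2 : o u ≠ o (φ v)) : False := by
  have hne : ∀ h, o h ≠ o (φ h) := fun h => cyc_ne1 (S.tri h)
  rcases K.orb u v j hu hv with rfl | rfl | rfl | rfl
  · exact hne _ h1.symm
  · exact h2 (S.tι hu).symm
  · rw [S.φσ, S.oσ, h1, S.oσ] at h2
    exact h2 (sg_sg (S.rg _)).symm
  · rw [S.oσ, S.oι _ _ hu] at h1
    exact sg_ne (S.rg _) h1.symm

theorem St.lab1 (S : St K m φ o) {g : H} {k : Fin n} (hg : K.lab g = some k) :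
    K.lab (φ g) ≠ some k := fun h =>
  S.adj hg h rfl (cyc_ne1 (cyc_rot (cyc_rot (S.tri g)))).symm

theorem St.lab2 (S : St K m φ o) {g : H} {k : Fin n} (hg : K.lab g = some k) :
    K.lab (φ (φ g)) ≠ some k := fun h => by
  apply S.lab1 h
  rw [S.φ3, hg]

theorem St.quad (S : St K m φ o) {g : H} {k : Fin n} (hg : K.lab g = some k) :
    cyc (o (φ g)) (o g) (o (φ (φ (K.ι g)))) := by
  have := S.tri (K.ι g)
  rwa [S.oι _ _ hg, S.tι hg] at this

theorem fl_g {g : H} {k : Fin n} (hg : K.lab g = some k) : flφ K φ k g = φ (φ g) := by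
  simp [flφ, hg]

theorem St.fl_x (S : St K m φ o) {g : H} {k : Fin n} (hg : K.lab g = some k) :
    flφ K φ k (φ g) = K.ι g := by
  simp [flφ, hg, S.lab1 hg, S.lab2 hg, S.φ3]

theorem St.fl_y (S : St K m φ o) {g : H} {k : Fin n} (hg : K.lab g = some k) :
    flφ K φ k (φ (φ g)) = φ (K.ι g) := by
  simp [flφ, hg, S.lab2 hg, S.φ3]

theorem fl_n {h : H} {k : Fin n} (h0 : K.lab h ≠ some k) (h1 : K.lab (φ h) ≠ some k)
    (h2 : K.lab (φ (φ h)) ≠ some k) : flφ K φ k h = φ h := by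
  simp [flφ, h0, h1, h2]

theorem St.cases (S : St K m φ o) (k : Fin n) (h : H) :
    (∃ g, K.lab g = some k ∧ (h = g ∨ h = φ g ∨ h = φ (φ g))) ∨
    (K.lab h ≠ some k ∧ K.lab (φ h) ≠ some k ∧ K.lab (φ (φ h)) ≠ some k) := by
  by_cases h0 : K.lab h = some k
  · exact Or.inl ⟨h, h0, Or.inl rfl⟩
  by_cases h1 : K.lab (φ h) = some k
  · exact Or.inl ⟨_, h1, Or.inr (Or.inr (S.φ3 h).symm)⟩
  by_cases h2 : K.lab (φ (φ h)) = some k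
  · exact Or.inl ⟨_, h2, Or.inr (Or.inl (S.φ3 h).symm)⟩
  exact Or.inr ⟨h0, h1, h2⟩

theorem flo_g {g : H} {k : Fin n} (hg : K.lab g = some k) :
    flo K φ o k g = o (φ (φ (K.ι g))) := by simp [flo, hg]
theorem flo_n {g : H} {k : Fin n} (hg : K.lab g ≠ some k) :
    flo K φ o k g = o g := by simp [flo, hg]

/-- target of non-flipped half-edges is unchanged -/
theorem St.flo_t (S : St K m φ o) {h : H} {k : Fin n} (hh : K.lab h ≠ some k) :
    flo K φ o k (flφ K φ k h) = o (φ h) := by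
  rcases S.cases k h with ⟨g, hg, rfl | rfl | rfl⟩ | ⟨h0, h1, h2⟩
  · exact absurd hg hh
  · rw [S.fl_x hg, flo_g (by rw [K.labι, hg]), K.ιι]
  · rw [S.fl_y hg, flo_n (S.lab1 (by rw [K.labι, hg])), S.tι hg, S.φ3]
  · rw [fl_n h0 h1 h2, flo_n h1]

theorem St.flo_tg (S : St K m φ o) {h : H} {k : Fin n} (hh : K.lab h = some k) :
    flo K φ o k (flφ K φ k h) = o (φ (φ h)) := by
  rw [fl_g hh, flo_n (S.lab2 hh)]

theorem St.lemX (S : St K m φ o) {g : H} {k : Fin n} (hg : K.lab g = some k) {p q : ℤ}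
    (hx : ∀ e, K.lab e ≠ some k → ¬ crosses p q (o e) (o (φ e)))
    (hc : crosses p q (o (φ (φ (K.ι g)))) (o (φ (φ g)))) :
    (p = o g ∧ q = o (φ g)) ∨ (p = o (φ g) ∧ q = o g) := by
  have hg' : K.lab (K.ι g) = some k := by rw [K.labι, hg]
  have h1 := hx (φ (K.ι g)) (S.lab1 hg')
  have h2 := hx (φ (φ (K.ι g))) (S.lab2 hg')
  have h3 := hx (φ g) (S.lab1 hg)
  have h4 := hx (φ (φ g)) (S.lab2 hg)
  rw [S.tι hg] at h1
  rw [S.φ3, S.oι _ _ hg] at h2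
  rw [S.φ3] at h4
  exact CSC.lemX (S.tri g) (S.quad hg) h1 h2 h3 h4 hc

theorem St.ncr1 (S : St K m φ o) {g e : H} {k : Fin n} (hg : K.lab g = some k)
    (he : K.lab e ≠ some k) :
    ¬ crosses (o e) (o (φ e)) (o (φ (φ (K.ι g)))) (o (φ (φ g))) := by
  intro hc
  rcases S.lemX hg (fun e' _ => S.ncr e e') hc with ⟨h1, h2⟩ | ⟨h1, h2⟩
  · exact he (S.uniq g e k hg h1 h2)
  · refine he (S.uniq (K.ι g) e k (by rw [K.labι, hg]) ?_ ?_)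
    · rw [h1, S.oι _ _ hg]
    · rw [h2, S.tι hg]

theorem St.flip (S : St K m φ o) (k : Fin n) : St K m (flφ K φ k) (flo K φ o k) where
  φ3 h := by
    rcases S.cases k h with ⟨g, hg, rfl | rfl | rfl⟩ | ⟨h0, h1, h2⟩
    · rw [fl_g hg, S.fl_y hg, S.fl_x (by rw [K.labι, hg]), K.ιι]
    · have hg' : K.lab (K.ι g) = some k := by rw [K.labι, hg]
      rw [S.fl_x hg, fl_g hg', S.fl_y hg', K.ιι]
    · have hg' : K.lab (K.ι g) = some k := by rw [K.labι, hg]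
      rw [S.fl_y hg, S.fl_x hg', K.ιι, fl_g hg]
    · rw [fl_n h0 h1 h2, fl_n h1 h2 (by rw [S.φ3]; exact h0),
        fl_n h2 (by rw [S.φ3]; exact h0) (by rw [S.φ3]; exact h1), S.φ3]
  φσ h := by
    simp only [flφ, S.φσ, K.labσ, ← K.σι]
    split_ifs <;> rfl
  rg h := by
    unfold flo
    split_ifs <;> exact S.rg _
  oσ h := by
    simp only [flo, K.labσ, ← K.σι, S.φσ, S.oσ]
    split_ifs <;> rfl
  tri h := by
    rcases S.cases k h with ⟨g, hg, rfl | rfl | rfl⟩ | ⟨h0, h1, h2⟩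
    · rw [flo_g hg, S.flo_tg hg, fl_g hg, S.flo_t (S.lab2 hg), S.φ3]
      exact cyc_flip (S.tri h) (S.quad hg)
    · have hg' : K.lab (K.ι g) = some k := by rw [K.labι, hg]
      rw [S.flo_t (S.lab1 hg), flo_n (S.lab1 hg), S.fl_x hg, S.flo_tg hg']
      have := cyc_flip (S.tri _) (S.quad hg')
      rw [K.ιι, S.oι _ _ hg] at this
      exact cyc_rot (cyc_rot this)
    · have hg' : K.lab (K.ι g) = some k := by rw [K.labι, hg]
      rw [S.flo_t (S.lab2 hg), flo_n (S.lab2 hg), S.fl_y hg, S.flo_t (S.lab1 hg'), S.φ3]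
      exact cyc_rot (cyc_flip (S.tri _) (S.quad hg))
    · rw [flo_n h0, S.flo_t h0, fl_n h0 h1 h2, S.flo_t h1]
      exact S.tri h
  oι h j hj := by
    by_cases hk : K.lab h = some k
    · have hg' : K.lab (K.ι h) = some k := by rw [K.labι, hk]
      rw [flo_g hg', S.flo_tg hk, K.ιι]
    · rw [flo_n (by rw [K.labι]; exact hk), S.flo_t hk, S.oι _ _ hj]
  ncr h h' := by
    by_cases hk : K.lab h = some k <;> by_cases hk' : K.lab h' = some k
    · rw [flo_g hk, S.flo_tg hk, flo_g hk', S.flo_tg hk']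
      intro hc
      have hq := crosses_quad (S.tri h) (S.quad hk)
      rcases S.lemX hk' (fun e he hx => S.ncr1 hk he (crosses_symm hx)) hc with ⟨h1, h2⟩ | ⟨h1, h2⟩
      · rw [h1, h2] at hq
        exact S.ncr _ _ hq
      · rw [h1, h2] at hq
        rw [← S.oι _ _ hk', ← S.tι hk'] at hq
        exact S.ncr _ _ hq
    · rw [flo_g hk, S.flo_tg hk, flo_n hk', S.flo_t hk']
      exact fun hc => S.ncr1 hk hk' (crosses_symm hc)
    · rw [flo_n hk, S.flo_t hk, flo_g hk', S.flo_tg hk']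
      exact S.ncr1 hk' hk
    · rw [flo_n hk, S.flo_t hk, flo_n hk', S.flo_t hk']
      exact S.ncr _ _
  uniq h e j hj := by
    by_cases hk : K.lab h = some k <;> by_cases hk' : K.lab e = some k
    · intros
      rw [hk', ← hk, hj]
    · rw [flo_g hk, S.flo_tg hk, flo_n hk', S.flo_t hk']
      intro h1 h2
      have hq := crosses_quad (S.tri h) (S.quad hk)
      rw [← h1, ← h2] at hq
      exact absurd hq (S.ncr _ _)
    · rw [flo_n hk, S.flo_t hk, flo_g hk', S.flo_tg hk']
      intro h1 h2
      have hq := crosses_quad (S.tri e) (S.quad hk')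
      rw [h1, h2] at hq
      exact absurd hq (S.ncr _ _)
    · rw [flo_n hk, S.flo_t hk, flo_n hk', S.flo_t hk']
      exact S.uniq h e j hj
end CSC

namespace CSC
variable {n : ℕ} {H : Type} {K : Comb n H} {m : ℤ} {φ : H → H} {o : H → ℤ}

def X (K : Comb n H) (φ : H → H) (f : H → ℤ) (h : H) : ℤ :=
  f (φ h) - f (φ (φ h)) + f (φ (K.ι h)) - f (φ (φ (K.ι h)))

def ind (K : Comb n H) (i : Fin n) (h : H) : ℤ := if K.lab h = some i then 1 else 0

def RepB (K : Comb n H) (φ : H → H) (B : Matrix (Fin n) (Fin n) ℤ) : Prop :=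
  ∀ h j, K.lab h = some j → ∀ i, B i j = X K φ (ind K i) h

def rowmut (k : Fin n) (bk c : Fin n → ℤ) (j : Fin n) : ℤ :=
  if j = k then - c j else c j + (c k).sign * max (c k * bk j) 0

theorem ind_eq {i : Fin n} {h : H} (hh : K.lab h = some i) : ind K i h = 1 := by simp [ind, hh]
theorem ind_ne {i : Fin n} {h : H} (hh : K.lab h ≠ some i) : ind K i h = 0 := by simp [ind, hh]
theorem ind_nn (i : Fin n) (h : H) : 0 ≤ ind K i h := by unfold ind; split_ifs <;> simp

/-- Non-cancellation. -/
theorem St.noncancel (S : St K m φ o) {h : H} {j : Fin n} (hj : K.lab h = some j) (k : Fin n) :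
    ind K k (φ h) + ind K k (φ (K.ι h)) = 0 ∨
    ind K k (φ (φ h)) + ind K k (φ (φ (K.ι h))) = 0 := by
  have hbd := cyc_ne (S.tri h) (S.quad hj)
  have a1 : ¬ (K.lab (φ h) = some k ∧ K.lab (φ (φ h)) = some k) := fun ⟨x, y⟩ => S.lab1 x y
  have a2 : ¬ (K.lab (φ (K.ι h)) = some k ∧ K.lab (φ (φ (K.ι h))) = some k) :=
    fun ⟨x, y⟩ => S.lab1 x y
  have a3 : ¬ (K.lab (φ h) = some k ∧ K.lab (φ (φ (K.ι h))) = some k) := fun ⟨x, y⟩ => by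
    refine S.adj y x ?_ hbd
    rw [S.φ3, S.oι _ _ hj]
  have a4 : ¬ (K.lab (φ (K.ι h)) = some k ∧ K.lab (φ (φ h)) = some k) := fun ⟨x, y⟩ => by
    refine S.adj y x ?_ hbd.symm
    rw [S.φ3, S.tι hj]
  unfold ind
  split_ifs <;> simp_all

theorem X_g (S : St K m φ o) {k : Fin n} {f f' : H → ℤ}
    (hf : ∀ h, K.lab h ≠ some k → f' h = f h) {g : H} (hg : K.lab g = some k) :
    X K (flφ K φ k) f' g = - X K φ f g := by
  have hg' : K.lab (K.ι g) = some k := by rw [K.labι, hg]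
  unfold X
  rw [fl_g hg, fl_g hg', S.fl_y hg, S.fl_y hg', K.ιι, hf _ (S.lab1 hg), hf _ (S.lab2 hg),
    hf _ (S.lab1 hg'), hf _ (S.lab2 hg')]
  ring

theorem X_half (S : St K m φ o) {k : Fin n} {f f' : H → ℤ}
    (hf : ∀ h, K.lab h ≠ some k → f' h = f h)
    (fι : ∀ h, K.lab h = some k → f (K.ι h) = f h)
    (fι' : ∀ h, K.lab h = some k → f' (K.ι h) = f' h)
    (fσ : ∀ h, f (K.σ h) = f h) (fσ' : ∀ h, f' (K.σ h) = f' h)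
    {g : H} (hg : K.lab g = some k) {h : H} (hh : K.lab h ≠ some k) :
    f' (flφ K φ k h) - f' (flφ K φ k (flφ K φ k h)) =
      f (φ h) - f (φ (φ h)) +
      ind K k (φ h) * ((f (φ g) + f (φ (K.ι g))) - (f g + f' g)) +
      ind K k (φ (φ h)) * ((f g + f' g) - (f (φ (φ g)) + f (φ (φ (K.ι g))))) := by
  have key : ∀ g', K.lab g' = some k →
      f (φ g') + f (φ (K.ι g')) = f (φ g) + f (φ (K.ι g)) ∧
      f (φ (φ g')) + f (φ (φ (K.ι g'))) = f (φ (φ g)) + f (φ (φ (K.ι g))) ∧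
      f g' = f g ∧ f' g' = f' g := by
    intro g' hg'
    have hgι : K.lab (K.ι g) = some k := by rw [K.labι, hg]
    rcases K.orb g g' k hg hg' with rfl | rfl | rfl | rfl
    · simp
    · rw [K.ιι, fι _ hg, fι' _ hg]
      refine ⟨by ring, by ring, rfl, rfl⟩
    · simp only [← K.σι, S.φσ, fσ, fσ', and_self]
    · simp only [← K.σι, S.φσ, fσ, fσ', K.ιι, fι _ hg, fι' _ hg, and_self, and_true]
      refine ⟨by ring, by ring⟩
  rcases S.cases k h with ⟨g', hg', rfl | rfl | rfl⟩ | ⟨h0, h1, h2⟩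
  · exact absurd hg' hh
  · -- h = φ g'
    have hgι : K.lab (K.ι g') = some k := by rw [K.labι, hg']
    obtain ⟨k1, k2, k3, k4⟩ := key g' hg'
    rw [S.fl_x hg', fl_g hgι, S.φ3, ind_ne (S.lab2 hg'), ind_eq hg', fι' _ hg',
      hf _ (S.lab2 hgι)]
    linarith
  · have hgι : K.lab (K.ι g') = some k := by rw [K.labι, hg']
    obtain ⟨k1, k2, k3, k4⟩ := key g' hg'
    rw [S.fl_y hg', S.fl_x hgι, K.ιι, S.φ3, ind_ne (S.lab1 hg'), ind_eq hg',
      hf _ (S.lab1 hgι)]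
    linarith
  · rw [fl_n h0 h1 h2, fl_n h1 h2 (by rw [S.φ3]; exact h0), ind_ne h1, ind_ne h2, hf _ h1, hf _ h2]
    ring

theorem arith {r c p q P N S : ℤ} (hr : 0 < r) (hp : 0 ≤ p) (hq : 0 ≤ q) (hpq : p = 0 ∨ q = 0)
    (hc : r * c = N - P) (hS : S = max P N) :
    r * (c.sign * max (c * (p - q)) 0) = p * (S - P) + q * (N - S) := by
  rcases lt_trichotomy c 0 with h | h | h
  · have : r * c < 0 := mul_neg_of_pos_of_neg hr h
    rw [max_eq_left (by linarith)] at hS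
    rw [Int.sign_eq_neg_one_of_neg h, hS]
    rcases hpq with rfl | rfl
    · rw [max_eq_left (by nlinarith)]; linear_combination q * hc
    · rw [max_eq_right (by nlinarith)]; ring
  · subst h
    have : N = P := by linarith
    subst this
    simp [hS]
  · have : 0 < r * c := mul_pos hr h
    rw [max_eq_right (by linarith)] at hS
    rw [Int.sign_eq_one_of_pos h, hS]
    rcases hpq with rfl | rfl
    · rw [max_eq_right (by nlinarith)]; ring
    · rw [max_eq_left (by nlinarith)]; linear_combination p * hc

theorem row_mut (S : St K m φ o) {B : Matrix (Fin n) (Fin n) ℤ} (hB : RepB K φ B)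
    {k : Fin n} {f f' : H → ℤ}
    (hf : ∀ h, K.lab h ≠ some k → f' h = f h)
    (fι : ∀ h, K.lab h = some k → f (K.ι h) = f h)
    (fι' : ∀ h, K.lab h = some k → f' (K.ι h) = f' h)
    (fσ : ∀ h, f (K.σ h) = f h) (fσ' : ∀ h, f' (K.σ h) = f' h)
    (pt : ∀ g, K.lab g = some k → f g + f' g =
      max (f (φ g) + f (φ (K.ι g))) (f (φ (φ g)) + f (φ (φ (K.ι g)))))
    {r : ℤ} (hr : 0 < r) {c : Fin n → ℤ}
    (hc : ∀ h j, K.lab h = some j → r * c j = - X K φ f h) :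
    ∀ h j, K.lab h = some j → r * rowmut k (B k) c j = - X K (flφ K φ k) f' h := by
  intro h j hj
  unfold rowmut
  split_ifs with hjk
  · subst hjk
    rw [X_g S hf hj, ← hc h j hj]; ring
  · obtain ⟨g, hg⟩ := K.surj k
    have hh : K.lab h ≠ some k := by rw [hj]; simpa using hjk
    have hh' : K.lab (K.ι h) ≠ some k := by rw [K.labι]; exact hh
    have e1 := X_half S hf fι fι' fσ fσ' hg hh
    have e2 := X_half S hf fι fι' fσ fσ' hg hh'
    have e3 := hB h j hj k
    have e4 := hc h j hj
    have e5 := hc g k hg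
    have := arith hr (p := ind K k (φ h) + ind K k (φ (K.ι h)))
      (q := ind K k (φ (φ h)) + ind K k (φ (φ (K.ι h)))) 
      (add_nonneg (ind_nn _ _) (ind_nn _ _)) (add_nonneg (ind_nn _ _) (ind_nn _ _))
      (S.noncancel hj k) (c := c k) (by rw [e5]; unfold X; ring) (pt g hg)
    have e6 : B k j = ind K k (φ h) + ind K k (φ (K.ι h)) -
      (ind K k (φ (φ h)) + ind K k (φ (φ (K.ι h)))) := by rw [e3]; unfold X; ring
    rw [e6, mul_add, this, e4]
    unfold X
    linear_combination e1 + e2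

theorem repB_flip (S : St K m φ o) {B : Matrix (Fin n) (Fin n) ℤ} (hB : RepB K φ B)
    (k : Fin n) : RepB K (flφ K φ k) (mutMat k B) := by
  intro h j hj i
  by_cases hi : i = k
  · subst hi
    simp only [mutMat, true_or, if_true]
    rw [hB h j hj i]
    by_cases hjk : K.lab h = some i
    · have := X_g S (f := ind K i) (f' := ind K i) (fun _ _ => rfl) hjk
      linarith
    · have hji : K.lab (K.ι h) ≠ some i := by rw [K.labι]; exact hjk
      have key : ∀ u, K.lab u ≠ some i → ind K i (flφ K φ i u) = ind K i (φ (φ u)) ∧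
          ind K i (flφ K φ i (flφ K φ i u)) = ind K i (φ u) := by
        intro u hu
        rcases S.cases i u with ⟨g', hg', rfl | rfl | rfl⟩ | ⟨h0, h1, h2⟩
        · exact absurd hg' hu
        · have hgι : K.lab (K.ι g') = some i := by rw [K.labι, hg']
          rw [S.fl_x hg', fl_g hgι, S.φ3, ind_eq hgι, ind_eq hg', ind_ne (S.lab2 hgι),
            ind_ne (S.lab2 hg')]
          simp
        · have hgι : K.lab (K.ι g') = some i := by rw [K.labι, hg']
          rw [S.fl_y hg', S.fl_x hgι, S.φ3, S.φ3, K.ιι, ind_eq hg', ind_ne (S.lab1 hgι),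
            ind_ne (S.lab1 hg')]
          simp
        · rw [fl_n h0 h1 h2, fl_n h1 h2 (by rw [S.φ3]; exact h0), ind_ne h1, ind_ne h2]
          simp
      unfold X
      rw [(key _ hjk).1, (key _ hjk).2, (key _ hji).1, (key _ hji).2]
      ring
  · have hrow : mutMat k B i j = rowmut k (B k) (B i) j := by
      simp only [mutMat, rowmut, hi, false_or]
    have hX : ∀ ψ : H → H, ∀ h, - X K ψ (fun h => - ind K i h) h = X K ψ (ind K i) h := by
      intro ψ h; unfold X; ring
    rw [hrow, ← hX, ← one_mul (rowmut _ _ _ _)]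
    have indι : ∀ h, ind K i (K.ι h) = ind K i h := fun h => by simp [ind, K.labι]
    have indσ : ∀ h, ind K i (K.σ h) = ind K i h := fun h => by simp [ind, K.labσ]
    refine row_mut S hB (fun _ _ => rfl) (fun h _ => by rw [indι]) (fun h _ => by rw [indι])
      (fun h => by rw [indσ]) (fun h => by rw [indσ]) ?_ one_pos ?_ h j hj
    · intro g hg
      have h0 : ind K i g = 0 := ind_ne (by rw [hg]; simpa using Ne.symm hi)
      have := S.noncancel hg i
      have n1 := ind_nn (K := K) i (φ g)
      have n2 := ind_nn (K := K) i (φ (φ g))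
      have n3 := ind_nn (K := K) i (φ (K.ι g))
      have n4 := ind_nn (K := K) i (φ (φ (K.ι g)))
      rw [h0]
      omega
    · intro h j hj
      rw [hX, one_mul, hB h j hj i]
end CSC

namespace CSC
variable {n : ℕ} {H : Type} {K : Comb n H} {m : ℤ} {φ : H → H} {o : H → ℤ}

noncomputable def ff (m p q : ℤ) (φ : H → H) (o : H → ℤ) (h : H) : ℤ :=
  sep p q (o h) (o (φ h)) + sep (sg m p) (sg m q) (o h) (o (φ h))

theorem St.ffι (S : St K m φ o) (p q : ℤ) {h : H} {j : Fin n} (hj : K.lab h = some j) :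
    ff m p q φ o (K.ι h) = ff m p q φ o h := by
  unfold ff
  rw [S.oι _ _ hj, S.tι hj, sep_symm p, sep_symm (sg m p)]

theorem rng_sg {m x : ℤ} (h : rng m x) : rng m (sg m x) := by
  unfold sg rng at *; split_ifs <;> omega

theorem St.ffσ (S : St K m φ o) {p q : ℤ} (hp : rng m p) (hq : rng m q) (h : H) :
    ff m p q φ o (K.σ h) = ff m p q φ o h := by
  unfold ff
  rw [S.φσ, S.oσ, S.oσ, sep_sg hp hq (S.rg _) (S.rg _)]
  have := sep_sg (rng_sg hp) (rng_sg hq) (S.rg h) (S.rg (φ h))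
  rw [sg_sg hp, sg_sg hq] at this
  rw [this]; ring

theorem St.X_ff (S : St K m φ o) (p q : ℤ) {h : H} {j : Fin n} (hj : K.lab h = some j) :
    X K φ (ff m p q φ o) h =
      shr p q (o h) (o (φ (φ (K.ι h)))) (o (φ h)) (o (φ (φ h))) +
      shr (sg m p) (sg m q) (o h) (o (φ (φ (K.ι h)))) (o (φ h)) (o (φ (φ h))) := by
  unfold X ff shr
  rw [S.φ3, S.φ3, S.tι hj, S.oι _ _ hj]
  ring

/-- the family of splits is pairwise compatible -/
def Compat (m : ℤ) (p q : Fin n → ℤ) : Prop :=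
  ∀ i i', ¬ crosses (p i) (q i) (p i') (q i') ∧
    ¬ crosses (p i) (q i) (sg m (p i')) (sg m (q i')) ∧
    ¬ crosses (sg m (p i)) (sg m (q i)) (sg m (p i')) (sg m (q i'))

def Inv (K : Comb n H) (m : ℤ) (p q : Fin n → ℤ) (b : Matrix (Fin n ⊕ Fin n) (Fin n) ℤ) : Prop :=
  ∃ φ o, St K m φ o ∧ RepB K φ (fun i j => b (Sum.inl i) j) ∧
    ∀ i, ∃ r : ℤ, 0 < r ∧ ∀ h j, K.lab h = some j →
      r * b (Sum.inr i) j = - X K φ (ff m (p i) (q i) φ o) h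

theorem Inv.step {p q : Fin n → ℤ} (hp : ∀ i, rng m (p i)) (hq : ∀ i, rng m (q i))
    (hcm : Compat m p q) {b : Matrix (Fin n ⊕ Fin n) (Fin n) ℤ} (hb : Inv K m p q b) (k : Fin n) :
    Inv K m p q (mutMatExt k b) := by
  obtain ⟨φ, o, S, hB, hC⟩ := hb
  refine ⟨flφ K φ k, flo K φ o k, S.flip k, ?_, fun i => ?_⟩
  · have := repB_flip S hB k
    have e : (fun i j => mutMatExt k b (Sum.inl i) j) = mutMat k (fun i j => b (Sum.inl i) j) := by
      funext i j
      simp [mutMatExt, mutMat]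
    rw [e]
    exact this
  · obtain ⟨r, hr, hc⟩ := hC i
    refine ⟨r, hr, ?_⟩
    have hrow : (fun j => mutMatExt k b (Sum.inr i) j) =
        rowmut k ((fun i j => b (Sum.inl i) j) k) (fun j => b (Sum.inr i) j) := by
      funext j
      simp [mutMatExt, rowmut]
    have := row_mut S hB (k := k) (f := ff m (p i) (q i) φ o)
      (f' := ff m (p i) (q i) (flφ K φ k) (flo K φ o k))
      (fun h hh => by unfold ff; rw [flo_n hh, S.flo_t hh])
      (fun h hh => S.ffι _ _ hh) (fun h hh => (S.flip k).ffι _ _ hh)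
      (fun h => S.ffσ (hp i) (hq i) h) (fun h => (S.flip k).ffσ (hp i) (hq i) h)
      (fun g hg => by
        unfold ff
        rw [flo_g hg, S.flo_tg hg, S.φ3, S.φ3, S.tι hg, S.oι _ _ hg]
        have e1 := ptol (p := p i) (q := q i) (S.tri g) (S.quad hg)
        have e2 := ptol (p := sg m (p i)) (q := sg m (q i)) (S.tri g) (S.quad hg)
        have e3 := compat (a := o g) (b := o (φ (φ (K.ι g)))) (c := o (φ g)) (d := o (φ (φ g)))
          (hcm i i).2.1
        unfold shr at e3
        omega) hr (c := fun j => b (Sum.inr i) j) hc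
    rw [← hrow] at this
    exact this

theorem Inv.coh {p q : Fin n → ℤ}
    (hcm : Compat m p q) {b : Matrix (Fin n ⊕ Fin n) (Fin n) ℤ} (hb : Inv K m p q b) (j : Fin n) :
    (∀ i, 0 ≤ b (Sum.inr i) j) ∨ (∀ i, b (Sum.inr i) j ≤ 0) := by
  obtain ⟨φ, o, S, hB, hC⟩ := hb
  obtain ⟨h, hj⟩ := K.surj j
  by_contra hcon
  push Not at hcon
  obtain ⟨⟨i, hi⟩, i', hi'⟩ := hcon
  obtain ⟨r, hr, hc⟩ := hC i
  obtain ⟨r', hr', hc'⟩ := hC i'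
  have e1 := hc h j hj
  have e2 := hc' h j hj
  rw [S.X_ff _ _ hj] at e1 e2
  have f1 : r * b (Sum.inr i) j < 0 := mul_neg_of_pos_of_neg hr hi
  have f2 : 0 < r' * b (Sum.inr i') j := mul_pos hr' hi'
  have c1 := compat (a := o h) (b := o (φ (φ (K.ι h)))) (c := o (φ h)) (d := o (φ (φ h)))
    (hcm i i').1
  have c2 := compat (a := o h) (b := o (φ (φ (K.ι h)))) (c := o (φ h)) (d := o (φ (φ h)))
    (hcm i i').2.1
  have c3 := compat (a := o h) (b := o (φ (φ (K.ι h)))) (c := o (φ h)) (d := o (φ (φ h)))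
    (hcm i i').2.2
  have c4 := compat (a := o h) (b := o (φ (φ (K.ι h)))) (c := o (φ h)) (d := o (φ (φ h)))
    (hcm i' i).2.1
  omega

theorem St.ncrq (S : St K m φ o) (e : H) {h : H} {j : Fin n} (hj : K.lab h = some j) :
    ¬ crosses (o e) (o (φ e)) (o h) (o (φ h)) ∧
    ¬ crosses (o e) (o (φ e)) (o h) (o (φ (φ (K.ι h)))) ∧
    ¬ crosses (o e) (o (φ e)) (o (φ (φ (K.ι h)))) (o (φ h)) ∧
    ¬ crosses (o e) (o (φ e)) (o (φ h)) (o (φ (φ h))) ∧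
    ¬ crosses (o e) (o (φ e)) (o (φ (φ h))) (o h) := by
  have h1 := S.ncr e (φ (K.ι h))
  have h2 := S.ncr e (φ (φ (K.ι h)))
  have h3 := S.ncr e (φ h)
  have h4 := S.ncr e (φ (φ h))
  rw [S.tι hj] at h1
  rw [S.φ3, S.oι _ _ hj] at h2
  rw [S.φ3] at h4
  exact ⟨S.ncr e h, h1, h2, h3, h4⟩

theorem St.shr0 (S : St K m φ o) {e h : H} {j : Fin n} (hj : K.lab h = some j)
    (he : K.lab e ≠ some j) :
    shr (o e) (o (φ e)) (o h) (o (φ (φ (K.ι h)))) (o (φ h)) (o (φ (φ h))) = 0 := by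
  obtain ⟨h0, h1, h2, h3, h4⟩ := S.ncrq e hj
  refine shr_zero (S.tri h) (S.quad hj) h0 h1 h2 h3 h4 ?_ ?_
  · rintro ⟨x, y⟩
    exact he (S.uniq h e j hj x y)
  · rintro ⟨x, y⟩
    refine he (S.uniq (K.ι h) e j (by rw [K.labι, hj]) ?_ ?_)
    · rw [x, S.oι _ _ hj]
    · rw [y, S.tι hj]

theorem coherent_of_rep (S : St K m φ o) {B : Matrix (Fin n) (Fin n) ℤ} (hB : RepB K φ B)
    (c : Fin n → ℤ) (hc : IsCVec B c) : (∀ i, 0 ≤ c i) ∨ (∀ i, c i ≤ 0) := by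
  choose e he using K.surj
  have hsig : ∀ i, sg m (o (e i)) = o (K.σ (e i)) ∧
      sg m (o (φ (e i))) = o (φ (K.σ (e i))) := fun i => by
    rw [S.φσ, S.oσ, S.oσ]; exact ⟨rfl, rfl⟩
  have hcm : Compat m (fun i => o (e i)) (fun i => o (φ (e i))) := by
    intro i i'
    simp only [(hsig _).1, (hsig _).2]
    exact ⟨S.ncr _ _, S.ncr _ _, S.ncr _ _⟩
  have hinit : Inv K m (fun i => o (e i)) (fun i => o (φ (e i))) (extMat B) := by
    refine ⟨φ, o, S, hB, fun i => ⟨- X K φ (ff m (o (e i)) (o (φ (e i))) φ o) (e i), ?_, ?_⟩⟩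
    · rw [S.X_ff _ _ (he i), shr_self (S.tri _) (S.quad (he i)), (hsig i).1, (hsig i).2]
      obtain ⟨h0, h1, h2, h3, h4⟩ := S.ncrq (K.σ (e i)) (he i)
      have := shr_nonpos (S.tri _) (S.quad (he i)) h0 h1 h2 h3 h4
      omega
    · intro h j hj
      simp only [extMat, Sum.elim_inr]
      split_ifs with hij
      · subst hij
        have fσ := S.ffσ (S.rg (e i)) (S.rg (φ (e i)))
        rw [mul_one]
        congr 1
        rcases K.orb _ _ i (he i) hj with rfl | rfl | rfl | rfl
        · rfl
        · unfold X; rw [K.ιι]; ring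
        · unfold X; simp only [← K.σι, S.φσ, fσ]
        · unfold X; simp only [← K.σι, S.φσ, fσ, K.ιι]; ring
      · rw [mul_zero, S.X_ff _ _ hj, (hsig i).1, (hsig i).2, S.shr0 hj, S.shr0 hj]
        · rfl
        · rw [K.labσ, he]; simpa using hij
        · rw [he]; simpa using hij
  obtain ⟨b, hb, j, rfl⟩ := hc
  have : Inv K m (fun i => o (e i)) (fun i => o (φ (e i))) b := by
    induction hb with
    | refl => exact hinit
    | tail _ h ih =>
      obtain ⟨k, rfl⟩ := h
      exact ih.step (fun i => S.rg _) (fun i => S.rg _) hcm k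
  exact this.coh hcm j

theorem mut_mut {k : Fin n} (B : Matrix (Fin n) (Fin n) ℤ) : mutMat k (mutMat k B) = B := by
  funext i j
  by_cases hi : i = k <;> by_cases hj : j = k <;> simp [mutMat, hi, hj]

def SkewBy (d : Fin n → ℤ) (B : Matrix (Fin n) (Fin n) ℤ) : Prop :=
  ∀ i j, d i * B i j = - (d j * B j i)

theorem sgnmax (x y : ℤ) : 2 * (x.sign * max (x * y) 0) = |x| * y + x * |y| := by
  rcases lt_trichotomy x 0 with h | h | h
  · rw [Int.sign_eq_neg_one_of_neg h, abs_of_neg h]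
    rcases le_total 0 y with hy | hy
    · rw [max_eq_right (by nlinarith), abs_of_nonneg hy]; ring
    · rw [max_eq_left (by nlinarith), abs_of_nonpos hy]; ring
  · subst h; simp
  · rw [Int.sign_eq_one_of_pos h, abs_of_pos h]
    rcases le_total 0 y with hy | hy
    · rw [max_eq_left (by nlinarith), abs_of_nonneg hy]; ring
    · rw [max_eq_right (by nlinarith), abs_of_nonpos hy]; ring

theorem skew_mut {d : Fin n → ℤ} (hd : ∀ i, 0 < d i) {B : Matrix (Fin n) (Fin n) ℤ}
    (h : SkewBy d B) (k : Fin n) : SkewBy d (mutMat k B) := by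
  have ha : ∀ i j, d i * |B i j| = d j * |B j i| := fun i j => by
    have := congrArg abs (h i j)
    rwa [abs_neg, abs_mul, abs_mul, abs_of_pos (hd i), abs_of_pos (hd j)] at this
  intro i j
  by_cases hi : i = k
  · simp only [mutMat, hi, true_or, or_true, if_true]
    linarith [h k j]
  by_cases hj : j = k
  · simp only [mutMat, hj, true_or, or_true, if_true]
    linarith [h i k]
  simp only [mutMat, hi, hj, or_self, if_false]
  have e1 := sgnmax (B i k) (B k j)
  have e2 := sgnmax (B j k) (B k i)
  have : 2 * (d i * ((B i k).sign * max (B i k * B k j) 0)) =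
    - (2 * (d j * ((B j k).sign * max (B j k * B k i) 0))) := by
    linear_combination d i * e1 + d j * e2 + B k j * ha i k + |B k j| * h i k
      + |B k i| * h k j - B k i * ha k j
  linarith [h i j]
end CSC

namespace CSC
inductive T3
  | z | x | y

variable {n : ℕ}

abbrev HE (n : ℕ) := Fin n × T3 × Bool

def iσ (h : HE n) : HE n := (h.1, h.2.1, !h.2.2)

def iφ : HE n → HE n
  | (j, T3.z, b) => (j, T3.x, b)
  | (j, T3.x, b) => (j, T3.y, b)
  | (j, T3.y, b) => (j, T3.z, b)

def prd (j : Fin n) : Fin n := ⟨j.val - 1, by omega⟩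

def iι (r : ℕ → Bool) : HE n → HE n
  | (j, T3.z, b) => if h : j.val + 1 < n then
      (⟨j.val + 1, h⟩, if r j.val then T3.x else T3.y, b) else (j, T3.z, !b)
  | (j, T3.x, b) => if 0 < j.val ∧ r (j.val - 1) = true then (prd j, T3.z, b) else (j, T3.x, b)
  | (j, T3.y, b) => if 0 < j.val ∧ r (j.val - 1) = false then (prd j, T3.z, b) else (j, T3.y, b)

def ilab (r : ℕ → Bool) (π : Equiv.Perm (Fin n)) : HE n → Option (Fin n)
  | (j, T3.z, _) => some (π j)
  | (j, T3.x, _) => if 0 < j.val ∧ r (j.val - 1) = true then some (π (prd j)) else none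
  | (j, T3.y, _) => if 0 < j.val ∧ r (j.val - 1) = false then some (π (prd j)) else none

theorem iσι (r : ℕ → Bool) (h : HE n) : iσ (iι r h) = iι r (iσ h) := by
  obtain ⟨j, t, b⟩ := h
  cases t <;> simp only [iσ, iι] <;> split_ifs <;> rfl

theorem iιι (r : ℕ → Bool) (h : HE n) : iι r (iι r h) = h := by
  obtain ⟨j, t, b⟩ := h
  have hj := j.2
  cases t
  · simp only [iι]
    split_ifs with h1 h2
    · simp [iι, h2, prd]
    · simp [iι, h2, prd]
    · simp [iι, h1]
  · simp only [iι]
    split_ifs with h1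
    · have : j.val - 1 + 1 = j.val := by omega
      simp [iι, prd, this, h1.2]
    · simp only [iι, h1, if_false]
  · simp only [iι]
    split_ifs with h1
    · have : j.val - 1 + 1 = j.val := by omega
      simp [iι, prd, this, h1.2]
    · simp only [iι, h1, if_false]

theorem ilabι (r : ℕ → Bool) (π : Equiv.Perm (Fin n)) (h : HE n) :
    ilab r π (iι r h) = ilab r π h := by
  obtain ⟨j, t, b⟩ := h
  cases t
  · simp only [iι]
    split_ifs with h1 h2 <;> simp_all [ilab, prd]
  · simp only [iι]
    split_ifs with h1 <;> simp only [ilab, h1, and_self, if_true]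
  · simp only [iι]
    split_ifs with h1 <;> simp only [ilab, h1, and_self, if_true]

theorem ilab_form (r : ℕ → Bool) (π : Equiv.Perm (Fin n)) (h : HE n) (i : Fin n)
    (hi : ilab r π h = some i) :
    ∃ j b, i = π j ∧ (h = (j, T3.z, b) ∨ h = iι r (j, T3.z, b)) := by
  obtain ⟨j, t, b⟩ := h
  have hj := j.2
  cases t
  · exact ⟨j, b, by simpa [ilab] using hi.symm, Or.inl rfl⟩
  · simp only [ilab] at hi
    split_ifs at hi with h1
    refine ⟨prd j, b, by simpa using hi.symm, Or.inr ?_⟩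
    have : j.val - 1 + 1 = j.val := by omega
    simp [iι, prd, this, h1.2]
  · simp only [ilab] at hi
    split_ifs at hi with h1
    refine ⟨prd j, b, by simpa using hi.symm, Or.inr ?_⟩
    have : j.val - 1 + 1 = j.val := by omega
    simp [iι, prd, this, h1.2]

def iK (r : ℕ → Bool) (π : Equiv.Perm (Fin n)) : Comb n (HE n) where
  σ := iσ
  ι := iι r
  lab := ilab r π
  σσ h := by simp [iσ]
  ιι := iιι r
  σι := iσι r
  labσ h := by obtain ⟨j, t, b⟩ := h; cases t <;> simp [iσ, ilab]
  labι := ilabι r π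
  orb h h' i hi hi' := by
    obtain ⟨j, b, rfl, hh⟩ := ilab_form r π h i hi
    obtain ⟨j', b', hp, hh'⟩ := ilab_form r π h' _ hi'
    obtain rfl := π.injective hp
    have hb : ((j, T3.z, b') : HE n) = (j, T3.z, b) ∨
        ((j, T3.z, b') : HE n) = iσ (j, T3.z, b) := by
      cases b <;> cases b' <;> simp [iσ]
    rcases hh with rfl | rfl <;> rcases hh' with rfl | rfl <;> rcases hb with hb | hb <;>
      rw [hb] <;> simp [iσι, iιι]
  surj i := ⟨(π.symm i, T3.z, false), by simp [ilab]⟩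

def ll (n : ℕ) (r : ℕ → Bool) (j : ℕ) : ℤ := ∑ i ∈ Finset.Ico j (n - 1), if r i then 0 else 1

theorem ll_succ (r : ℕ → Bool) {j : ℕ} (hj : j + 1 < n) :
    ll n r j = ll n r (j + 1) + if r j then 0 else 1 := by
  unfold ll
  rw [Finset.sum_eq_sum_Ico_succ_bot (by omega)]
  ring

theorem ll_top (r : ℕ → Bool) : ll n r (n - 1) = 0 := by simp [ll]

theorem ll_mono (r : ℕ → Bool) {i j : ℕ} (hij : i ≤ j) (hj : j < n) :
    ll n r j ≤ ll n r i ∧ ll n r i + i ≤ ll n r j + j := by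
  induction j, hij using Nat.le_induction with
  | base => simp
  | succ k hk ih =>
    have h1 := ih (by omega)
    have h2 := ll_succ (n := n) r (j := k) hj
    push_cast
    split_ifs at h2 <;> omega

theorem ll_bd (r : ℕ → Bool) {j : ℕ} (hj : j < n) :
    0 ≤ ll n r j ∧ ll n r j + j + 1 ≤ n := by
  have h := ll_mono (n := n) r (i := j) (j := n - 1) (by omega) (by omega)
  rw [ll_top] at h
  omega

def wr (m x : ℤ) : ℤ := if x = 2 * m then 0 else x

def bs (r : ℕ → Bool) : HE n → ℤ
  | (j, T3.z, _) => ll n r j.val + j.val + 2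
  | (j, T3.x, _) => ll n r j.val
  | (j, T3.y, _) => if 0 < j.val ∧ r (j.val - 1) = true then ll n r j.val + j.val + 1
      else ll n r j.val + 1

def io (r : ℕ → Bool) (h : HE n) : ℤ := wr (n + 1) (bs r h + if h.2.2 then (n : ℤ) + 1 else 0)

theorem bs_bd (r : ℕ → Bool) (h : HE n) : 0 ≤ bs r h ∧ bs r h ≤ n + 1 := by
  obtain ⟨j, t, b⟩ := h
  have := ll_bd (n := n) r j.2
  cases t <;> simp only [bs] <;> (try split_ifs) <;> omega

/-- shape of a half-edge -/
theorem i_form (r : ℕ → Bool) (π : Equiv.Perm (Fin n)) (h : HE n) :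
    ∃ L U s : ℤ, 0 ≤ L ∧ L < U ∧ U ≤ n + 1 ∧ (s = 0 ∨ s = n + 1) ∧
      ((io r h = wr (n + 1) (L + s) ∧ io r (iφ h) = wr (n + 1) (U + s)) ∨
       (io r h = wr (n + 1) (U + s) ∧ io r (iφ h) = wr (n + 1) (L + s))) ∧
      ((∃ j : Fin n, ilab r π h = some (π j) ∧ L = ll n r j.val ∧ U = ll n r j.val + j.val + 2) ∨
       (ilab r π h = none ∧ U = L + 1)) := by
  obtain ⟨j, t, b⟩ := h
  have hj := j.2
  have hb := ll_bd (n := n) r j.2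
  have hs : (if b = true then (n : ℤ) + 1 else 0) = 0 ∨
    (if b = true then (n : ℤ) + 1 else 0) = n + 1 := by split_ifs <;> simp
  have hprd : 0 < j.val → ll n r (j.val - 1) = ll n r j.val + if r (j.val - 1) then 0 else 1 := by
    intro h0
    have := ll_succ (n := n) r (j := j.val - 1) (by omega)
    rwa [show j.val - 1 + 1 = j.val by omega] at this
  cases t
  · refine ⟨ll n r j.val, ll n r j.val + j.val + 2, _, by omega, by omega, by omega, hs,
      Or.inr ⟨rfl, rfl⟩, Or.inl ⟨j, rfl, rfl, rfl⟩⟩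
  · by_cases h1 : 0 < j.val ∧ r (j.val - 1) = true
    · refine ⟨ll n r j.val, ll n r j.val + j.val + 1, _, by omega, by omega, by omega, hs,
        Or.inl ⟨rfl, ?_⟩, Or.inl ⟨prd j, ?_, ?_, ?_⟩⟩
      · simp [io, iφ, bs, h1]; rfl
      · simp [ilab, h1]
      · simp [prd, hprd h1.1, h1.2]
      · simp only [prd, hprd h1.1, h1.2]; simp; omega
    · refine ⟨ll n r j.val, ll n r j.val + 1, _, by omega, by omega, by omega, hs,
        Or.inl ⟨rfl, ?_⟩, Or.inr ⟨?_, rfl⟩⟩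
      · simp only [io, iφ, bs, h1, if_false]; rfl
      · simp only [ilab, h1, if_false]
  · by_cases h1 : 0 < j.val ∧ r (j.val - 1) = false
    · refine ⟨ll n r j.val + 1, ll n r j.val + j.val + 2, _, by omega, by omega, by omega, hs,
        Or.inl ⟨?_, rfl⟩, Or.inl ⟨prd j, ?_, ?_, ?_⟩⟩
      · simp [io, bs, h1]
      · simp [ilab, h1]
      · simp [prd, hprd h1.1, h1.2]
      · simp only [prd, hprd h1.1, h1.2]; simp; omega
    · refine ⟨ll n r j.val + j.val + 1, ll n r j.val + j.val + 2, _, by omega, by omega, by omega, hs,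
        Or.inl ⟨?_, rfl⟩, Or.inr ⟨?_, by ring⟩⟩
      · by_cases h0 : 0 < j.val
        · have : r (j.val - 1) = true := by simpa [h0] using h1
          simp [io, bs, h0, this]
        · have : j.val = 0 := by omega
          simp [io, bs, this]
      · simp only [ilab, h1, if_false]

theorem nest_ncr {m L U s L' U' s' : ℤ} (h1 : 0 ≤ L) (h2 : L < U) (h3 : U ≤ m)
    (hs : s = 0 ∨ s = m) (h1' : 0 ≤ L') (h2' : L' < U') (h3' : U' ≤ m)
    (hs' : s' = 0 ∨ s' = m)
    (hn : U = L + 1 ∨ U' = L' + 1 ∨ (L ≤ L' ∧ U' ≤ U) ∨ (L' ≤ L ∧ U ≤ U')) :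
    ¬ crosses (wr m (L + s)) (wr m (U + s)) (wr m (L' + s')) (wr m (U' + s')) := by
  have hw : ∀ x, (x = 2 * m ∧ wr m x = 0) ∨ (x ≠ 2 * m ∧ wr m x = x) := fun x => by
    unfold wr; split_ifs <;> simp_all
  have w1 := hw (L + s)
  have w2 := hw (U + s)
  have w3 := hw (L' + s')
  have w4 := hw (U' + s')
  clear hw
  generalize wr m (L + s) = a at *
  generalize wr m (U + s) = b at *
  generalize wr m (L' + s') = c at *
  generalize wr m (U' + s') = d at *
  rcases hs with rfl | rfl <;> rcases hs' with rfl | rfl <;> unfold crosses cyc <;> grind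

theorem wr_len {m L U s L' U' s' : ℤ} (h1 : 0 ≤ L) (h2 : L < U) (h3 : U ≤ m)
    (hs : s = 0 ∨ s = m) (h1' : 0 ≤ L') (h2' : L' < U') (h3' : U' ≤ m)
    (hs' : s' = 0 ∨ s' = m)
    (h : (wr m (L + s) = wr m (L' + s') ∧ wr m (U + s) = wr m (U' + s')) ∨
      (wr m (L + s) = wr m (U' + s') ∧ wr m (U + s) = wr m (L' + s'))) : U - L = U' - L' := by
  unfold wr at h
  rcases hs with rfl | rfl <;> rcases hs' with rfl | rfl <;> split_ifs at h <;> omega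

theorem crosses_swap {a b c d : ℤ} (h : crosses a b c d) : crosses b a c d := by
  unfold crosses at *; tauto

theorem iSt (r : ℕ → Bool) (π : Equiv.Perm (Fin n)) : St (iK r π) (n + 1) iφ (io r) where
  φ3 h := by obtain ⟨j, t, b⟩ := h; cases t <;> rfl
  φσ h := by obtain ⟨j, t, b⟩ := h; cases t <;> rfl
  rg h := by
    have := bs_bd r h
    unfold rng io wr
    split_ifs <;> omega
  oσ h := by
    have h1 := bs_bd r h
    have h2 : bs r (iσ h) = bs r h := by obtain ⟨j, t, b⟩ := h; cases t <;> rfl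
    obtain ⟨j, t, b⟩ := h
    change io r (iσ (j, t, b)) = _
    unfold io
    rw [h2]
    cases b <;> simp only [iσ, sg, wr] <;> simp <;> split_ifs <;> omega
  tri h := by
    have key : ∀ j b, cyc (io r (j, T3.z, b)) (io r ((j, T3.x, b) : HE n)) (io r (j, T3.y, b)) := by
      intro j b
      have hb := ll_bd (n := n) r j.2
      simp only [io, bs]
      unfold cyc wr
      split_ifs <;> omega
    obtain ⟨j, t, b⟩ := h
    cases t
    · exact key j b
    · exact cyc_rot (key j b)
    · exact cyc_rot (cyc_rot (key j b))
  oι h i hi := by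
    obtain ⟨j, b, rfl, hh⟩ := ilab_form r π h i hi
    have hj := j.2
    have k1 : io r (iι r (j, T3.z, b)) = io r (iφ (j, T3.z, b)) := by
      by_cases hn : j.val + 1 < n
      · have := ll_succ r hn
        by_cases hr : r j.val = true
        · simp_all [iι, io, iφ, bs]; rfl
        · simp_all [iι, io, iφ, bs]; rfl
      · have : j.val = n - 1 := by omega
        have h2 : ((n - 1 : ℕ) : ℤ) = n - 1 := by omega
        have e : iι r (j, T3.z, b) = (j, T3.z, !b) := by simp [iι, hn]
        rw [e]
        clear e hn
        cases b <;> simp [io, iφ, bs, this, ll_top, h2, wr] <;> grind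
    have k2 : io r (j, T3.z, b) = io r (iφ (iι r (j, T3.z, b))) := by
      by_cases hn : j.val + 1 < n
      · have := ll_succ r hn
        by_cases hr : r j.val = true
        · simp_all [iι, io, iφ, bs]; congr 2; ring
        · simp_all [iι, io, iφ, bs]; congr 2; ring
      · have : j.val = n - 1 := by omega
        have h2 : ((n - 1 : ℕ) : ℤ) = n - 1 := by omega
        have e : iι r (j, T3.z, b) = (j, T3.z, !b) := by simp [iι, hn]
        rw [e]
        clear e hn
        cases b <;> simp [io, iφ, bs, this, ll_top, h2, wr] <;> grind
    rcases hh with rfl | rfl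
    · exact k1
    · change io r (iι r _) = _
      rw [iιι]; exact k2
  ncr h h' := by
    obtain ⟨L, U, s, h1, h2, h3, h4, h5, h6⟩ := i_form r π h
    obtain ⟨L', U', s', h1', h2', h3', h4', h5', h6'⟩ := i_form r π h'
    have hn : U = L + 1 ∨ U' = L' + 1 ∨ (L ≤ L' ∧ U' ≤ U) ∨ (L' ≤ L ∧ U ≤ U') := by
      rcases h6 with ⟨j, _, rfl, rfl⟩ | ⟨_, h6⟩
      · rcases h6' with ⟨j', _, rfl, rfl⟩ | ⟨_, h6'⟩
        · rcases le_total j.val j'.val with hle | hle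
          · have := ll_mono (n := n) r hle j'.2
            omega
          · have := ll_mono (n := n) r hle j.2
            omega
        · exact Or.inr (Or.inl h6')
      · exact Or.inl h6
    have key := nest_ncr h1 h2 h3 h4 h1' h2' h3' h4' hn
    rcases h5 with ⟨e1, e2⟩ | ⟨e1, e2⟩ <;> rcases h5' with ⟨e3, e4⟩ | ⟨e3, e4⟩ <;>
      rw [e1, e2, e3, e4] <;> intro hc
    · exact key hc
    · exact key (crosses_symm (crosses_swap (crosses_symm hc)))
    · exact key (crosses_swap hc)
    · exact key (crosses_swap (crosses_symm (crosses_swap (crosses_symm hc))))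
  uniq h e i hi he1 he2 := by
    obtain ⟨L, U, s, h1, h2, h3, h4, h5, h6⟩ := i_form r π h
    obtain ⟨L', U', s', h1', h2', h3', h4', h5', h6'⟩ := i_form r π e
    have key := wr_len h1 h2 h3 h4 h1' h2' h3' h4' (by
      rw [he1, he2] at h5'
      rcases h5 with ⟨e1, e2⟩ | ⟨e1, e2⟩ <;> rcases h5' with ⟨e3, e4⟩ | ⟨e3, e4⟩ <;>
        rw [← e1, ← e2, ← e3, ← e4] <;> simp)
    change ilab r π h = some i at hi
    change ilab r π e = some i
    rcases h6 with ⟨j, hj, rfl, rfl⟩ | ⟨hj, _⟩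
    · rcases h6' with ⟨j', hj', rfl, rfl⟩ | ⟨hj', h6'⟩
      · have : j = j' := Fin.ext (by omega)
        subst this
        rw [hj', ← hj, hi]
      · omega
    · rw [hj] at hi; simp at hi

theorem iRep (hn : 2 ≤ n) (r : ℕ → Bool) (π : Equiv.Perm (Fin n)) (B : Matrix (Fin n) (Fin n) ℤ)
    (hB0 : ∀ i j : Fin n, i.val + 1 ≠ j.val → j.val + 1 ≠ i.val → B (π i) (π j) = 0)
    (hB1 : ∀ i j : Fin n, i.val + 1 = j.val →
      B (π i) (π j) = (if r i.val then 1 else -1) * (if j.val + 1 = n then 2 else 1))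
    (hB2 : ∀ i j : Fin n, j.val + 1 = i.val → B (π i) (π j) = if r j.val then -1 else 1) :
    RepB (iK r π) iφ B := by
  have key : ∀ (j : Fin n) (b : Bool) (i : Fin n),
      B (π i) (π j) = X (iK r π) iφ (ind (iK r π) (π i)) (j, T3.z, b) := by
    intro j b i
    have hb0 := hB0 i j
    have hb1 := hB1 i j
    have hb2 := hB2 i j
    have hj := j.2
    have hi := i.2
    have hind : ∀ h, ind (iK r π) (π i) h = if ilab r π h = some (π i) then 1 else 0 :=
      fun _ => rfl
    have hι : ∀ h, (iK r π).ι h = iι r h := fun _ => rfl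
    simp only [X, hind, hι]
    clear hind hι hB0 hB1 hB2
    have hji : i.val + 1 = j.val → j.val - 1 = i.val := by omega
    by_cases h1 : j.val + 1 < n
    · by_cases hr : r j.val = true <;> by_cases hr' : r (j.val - 1) = true <;>
        simp [iι, iφ, ilab, h1, hr, hr', prd, Fin.ext_iff] <;> grind
    · by_cases hr' : r (j.val - 1) = true <;>
        simp [iι, iφ, ilab, h1, hr', prd, Fin.ext_iff] <;> grind
  intro h i' hi' i
  obtain ⟨j, b, rfl, hh⟩ := ilab_form r π h i' hi'
  have := key j b (π.symm i)
  rw [π.apply_symm_apply] at this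
  rw [this]
  rcases hh with rfl | rfl
  · rfl
  · have e : (iK r π).ι ((iK r π).ι (j, T3.z, b)) = (j, T3.z, b) := (iK r π).ιι _
    change X _ _ _ _ = X _ _ _ ((iK r π).ι (j, T3.z, b))
    unfold X
    rw [e]
    ring
end CSC

namespace CSC
variable {n : ℕ}

theorem rep_start (hn : 2 ≤ n) (B : Matrix (Fin n) (Fin n) ℤ) (π : Equiv.Perm (Fin n))
    (hc : ∀ i j, cartanCounterpart B (π i) (π j) = cartanC n i j)
    (d : Fin n → ℤ) (hd : ∀ i, 0 < d i) (hs : SkewBy d B) :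
    ∃ r : ℕ → Bool, RepB (iK r π) iφ B := by
  have hab : ∀ i j : Fin n, i ≠ j → |B (π i) (π j)| = - cartanC n i j := by
    intro i j hij
    have := hc i j
    unfold cartanCounterpart at this
    rw [if_neg (fun h => hij (π.injective h))] at this
    omega
  have hsgn : ∀ i j, 0 < B i j → B j i < 0 := by
    intro i j h
    have h1 := mul_pos (hd i) h
    have h2 := hs i j
    by_contra h3
    have := mul_nonneg (hd j).le (not_lt.mp h3)
    omega
  have hsgn' : ∀ i j, B i j < 0 → 0 < B j i := by
    intro i j h
    have h1 := mul_neg_of_pos_of_neg (hd i) h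
    have h2 := hs i j
    by_contra h3
    have := mul_nonpos_of_nonneg_of_nonpos (hd j).le (not_lt.mp h3)
    omega
  have hdiag : ∀ i, B i i = 0 := by
    intro i
    rcases lt_trichotomy (B i i) 0 with h | h | h
    · have := hsgn' i i h; omega
    · exact h
    · have := hsgn i i h; omega
  refine ⟨fun a => if h : a + 1 < n then decide (0 < B (π ⟨a, by omega⟩) (π ⟨a + 1, h⟩)) else true,
    iRep hn _ π B ?_ ?_ ?_⟩
  · intro i j h1 h2
    by_cases hij : i = j
    · subst hij; exact hdiag _
    · have := hab i j hij
      have h3 : ¬ (i.val + 2 = n ∧ j.val + 1 = n) := by omega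
      simpa [cartanC, hij, h1, h2, h3] using this
  · intro i j hij
    have hlt : i.val + 1 < n := by omega
    have hne : i ≠ j := by rintro rfl; omega
    have e : j = ⟨i.val + 1, hlt⟩ := Fin.ext hij.symm
    have ha := hab i j hne
    have h3 : (i.val + 2 = n ∧ j.val + 1 = n) ↔ j.val + 1 = n := by omega
    simp only [cartanC, hne, if_false, h3, hij, true_or, if_true] at ha
    simp only [hlt, dif_pos, Fin.eta, ← e, decide_eq_true_eq]
    rcases abs_cases (B (π i) (π j)) with ⟨h4, h5⟩ | ⟨h4, h5⟩ <;> split_ifs at * <;> omega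
  · intro i j hij
    have hlt : j.val + 1 < n := by omega
    have hne : i ≠ j := by rintro rfl; omega
    have e : i = ⟨j.val + 1, hlt⟩ := Fin.ext hij.symm
    have ha := hab i j hne
    have h3 : ¬ (i.val + 2 = n ∧ j.val + 1 = n) := by omega
    simp only [cartanC, hne, if_false, h3, hij, or_true, if_true] at ha
    simp only [hlt, dif_pos, Fin.eta, ← e, decide_eq_true_eq]
    have g1 := hsgn (π i) (π j)
    have g2 := hsgn' (π i) (π j)
    rcases abs_cases (B (π i) (π j)) with ⟨h4, h5⟩ | ⟨h4, h5⟩ <;> split_ifs at * <;> omega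

theorem skew_path {d : Fin n → ℤ} (hd : ∀ i, 0 < d i) {B B' : Matrix (Fin n) (Fin n) ℤ}
    (hs : SkewBy d B) (hp : Relation.ReflTransGen (fun a c => ∃ k, c = mutMat k a) B B') :
    SkewBy d B' := by
  induction hp with
  | refl => exact hs
  | tail _ h ih =>
    obtain ⟨k, rfl⟩ := h
    exact skew_mut hd ih k

theorem rep_back {H : Type} {K : Comb n H} {m : ℤ} {B B' : Matrix (Fin n) (Fin n) ℤ}
    (hp : Relation.ReflTransGen (fun a c => ∃ k, c = mutMat k a) B B')
    (h : ∃ φ o, St K m φ o ∧ RepB K φ B') : ∃ φ o, St K m φ o ∧ RepB K φ B := by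
  induction hp with
  | refl => exact h
  | @tail a c _ h1 ih =>
    obtain ⟨k, rfl⟩ := h1
    obtain ⟨φ, o, S, hR⟩ := h
    refine ih ⟨_, _, S.flip k, ?_⟩
    have := repB_flip S hR k
    rwa [mut_mut] at this

end CSC

theorem c_vectors_sign_coherent_type_C {n : ℕ} (hn : 2 ≤ n)
    (B : Matrix (Fin n) (Fin n) ℤ) (hB : SkewSymmetrizable B)
    (htype : MatrixOfTypeC B) :
    ∀ c : Fin n → ℤ, IsCVec B c → (∀ i, 0 ≤ c i) ∨ (∀ i, c i ≤ 0) := by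
  intro c hc
  obtain ⟨d, hd, hs⟩ := hB
  have hs' : CSC.SkewBy d B := by
    intro i j
    have := congrFun (congrFun hs j) i
    simpa [Matrix.diagonal_mul] using this
  obtain ⟨B', hp, π, hπ⟩ := htype
  obtain ⟨r, hr⟩ := CSC.rep_start hn B' π hπ d hd (CSC.skew_path hd hs' hp)
  obtain ⟨φ, o, S, hR⟩ := CSC.rep_back hp ⟨_, _, CSC.iSt r π, hr⟩
  exact CSC.coherent_of_rep S hR c hc
end
end

section
/- Let n ≥ 2 and let B be a skew-symmetrizable n×n integer matrix of type C_n. Then the set of c-vectors of the cluster algebra with principal coefficients and initial exchange matrix B has exactly 2n² elements. -/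
open MvPolynomial Matrix

noncomputable section

set_option linter.unusedSimpArgs false
set_option linter.unusedVariables false

/-! ## Labelled plane binary trees -/

/-- Plane binary trees with labelled internal nodes carrying split positions. -/
inductive Tr (n : ℕ) : Type
  | leaf : Tr n
  | node (k : Fin n) (m : ℤ) (l r : Tr n) : Tr n

namespace Tr

variable {n : ℕ}

/-- Label of the top edge. -/
def lab : Tr n → Option (Fin n)
  | leaf => none
  | node k _ _ _ => some k

/-- All labels. -/
def labels : Tr n → List (Fin n)
  | leaf => []
  | node k _ l r => k :: (l.labels ++ r.labels)

/-- The tree sits over the interval from `p` to `q`. -/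
def valid : Tr n → ℤ → ℤ → Prop
  | leaf, p, q => q = p + 1
  | node _ m l r, p, q => p < m ∧ m < q ∧ l.valid p m ∧ r.valid m q

/-- Translate all positions. -/
def sh (N : ℤ) : Tr n → Tr n
  | leaf => leaf
  | node k m l r => node k (m + N) (l.sh N) (r.sh N)

/-- Sum of the triangle contributions. -/
def R (y : Option (Fin n) → ℤ → ℤ → ℤ) : Tr n → ℤ → ℤ → Fin n → ℤ
  | leaf, _, _, _ => 0
  | node k m l r, p, q, j =>
      R y l p m j + R y r m q j
      + (if k = j then y r.lab m q - y l.lab p m else 0)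
      + (if l.lab = some j then y (some k) p q - y r.lab m q else 0)
      + (if r.lab = some j then y l.lab p m - y (some k) p q else 0)

/-- Membership of a labelled triangle. -/
def Mem (k : Fin n) (a b c : ℤ) : Tr n → ℤ → ℤ → Prop
  | leaf, _, _ => False
  | node k' m l r, p, q => (k = k' ∧ a = p ∧ b = m ∧ c = q) ∨ Mem k a b c l p m ∨ Mem k a b c r m q

/-- Right rotation at the edge `k`. -/
inductive Rot (k : Fin n) : Tr n → Tr n → Prop
  | base (j : Fin n) (b c : ℤ) (A B C : Tr n) :
      Rot k (node j c (node k b A B) C) (node j b A (node k c B C))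
  | inl (j : Fin n) (m : ℤ) (l l' r : Tr n) : Rot k l l' → Rot k (node j m l r) (node j m l' r)
  | inr (j : Fin n) (m : ℤ) (l r r' : Tr n) : Rot k r r' → Rot k (node j m l r) (node j m l r')

/-- Row data of the exchange matrix. -/
def yB (i : Fin n) : Option (Fin n) → ℤ → ℤ → ℤ := fun o _ _ => if o = some i then 1 else 0

/-- Row data of the coefficient matrix. -/
def yC (s : ℤ → ℤ) : Option (Fin n) → ℤ → ℤ → ℤ := fun _ a b => -|s a - s b|

theorem lab_mem {T : Tr n} {j : Fin n} (h : T.lab = some j) : j ∈ T.labels := by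
  cases T <;> simp_all [lab, labels]

theorem valid_lt {T : Tr n} : ∀ {p q : ℤ}, T.valid p q → p < q := by
  cases T with
  | leaf => intro p q h; simp only [valid] at h; omega
  | node k m l r => intro p q h; simp only [valid] at h; omega

theorem R_col_zero (y : Option (Fin n) → ℤ → ℤ → ℤ) {j : Fin n} :
    ∀ (T : Tr n) (p q : ℤ), j ∉ T.labels → R y T p q j = 0 := by
  intro T
  induction T with
  | leaf => intros; rfl
  | node k m l r ihl ihr =>
    intro p q h
    simp only [labels, List.mem_cons, List.mem_append, not_or] at h
    have h1 : l.lab ≠ some j := fun e => h.2.1 (lab_mem e)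
    have h2 : r.lab ≠ some j := fun e => h.2.2 (lab_mem e)
    simp [R, ihl _ _ h.2.1, ihr _ _ h.2.2, h1, h2, Ne.symm h.1]

theorem R_row_zero {i : Fin n} :
    ∀ (T : Tr n) (p q : ℤ) (j : Fin n), i ∉ T.labels → R (yB i) T p q j = 0 := by
  intro T
  induction T with
  | leaf => intros; rfl
  | node k m l r ihl ihr =>
    intro p q j h
    simp only [labels, List.mem_cons, List.mem_append, not_or] at h
    have h1 : l.lab ≠ some i := fun e => h.2.1 (lab_mem e)
    have h2 : r.lab ≠ some i := fun e => h.2.2 (lab_mem e)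
    simp [R, yB, ihl _ _ _ h.2.1, ihr _ _ _ h.2.2, h1, h2, Ne.symm h.1]

theorem sh_lab (N : ℤ) (T : Tr n) : (T.sh N).lab = T.lab := by cases T <;> rfl

theorem sh_labels (N : ℤ) (T : Tr n) : (T.sh N).labels = T.labels := by
  induction T with
  | leaf => rfl
  | node k m l r ihl ihr => simp [sh, labels, ihl, ihr]

theorem sh_valid (N : ℤ) (T : Tr n) : ∀ p q, T.valid p q → (T.sh N).valid (p + N) (q + N) := by
  induction T with
  | leaf => intro p q h; simp only [valid, sh] at *; omega
  | node k m l r ihl ihr =>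
    intro p q h; simp only [valid, sh] at *
    exact ⟨by omega, by omega, ihl _ _ h.2.2.1, ihr _ _ h.2.2.2⟩

theorem sh_R (N : ℤ) (y : Option (Fin n) → ℤ → ℤ → ℤ)
    (hy : ∀ o a b, y o (a + N) (b + N) = y o a b) (T : Tr n) :
    ∀ p q j, R y (T.sh N) (p + N) (q + N) j = R y T p q j := by
  induction T with
  | leaf => intros; rfl
  | node k m l r ihl ihr => intro p q j; simp [sh, R, sh_lab, ihl, ihr, hy]

/-- Local contribution of a quadrilateral before the rotation. -/
def loc (y : Option (Fin n) → ℤ → ℤ → ℤ) (k j0 : Fin n) (lA lB lC : Option (Fin n))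
    (a b c d : ℤ) (j : Fin n) : ℤ :=
  (if k = j then y lB b c - y lA a b + y (some j0) a d - y lC c d else 0)
  + (if lA = some j then y (some k) a c - y lB b c else 0)
  + (if lB = some j then y lA a b - y (some k) a c else 0)
  + (if j0 = j then y lC c d - y (some k) a c else 0)
  + (if lC = some j then y (some k) a c - y (some j0) a d else 0)

/-- Local contribution of a quadrilateral after the rotation. -/
def loc' (y : Option (Fin n) → ℤ → ℤ → ℤ) (k j0 : Fin n) (lA lB lC : Option (Fin n))
    (a b c d : ℤ) (j : Fin n) : ℤ :=
  (if k = j then y lC c d - y lB b c + y lA a b - y (some j0) a d else 0)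
  + (if lA = some j then y (some j0) a d - y (some k) b d else 0)
  + (if lB = some j then y (some k) b d - y lC c d else 0)
  + (if j0 = j then y (some k) b d - y lA a b else 0)
  + (if lC = some j then y lB b c - y (some k) b d else 0)

/-- The side labels are distinct. -/
def Dist (k j0 : Fin n) (lA lB lC : Option (Fin n)) : Prop :=
  k ≠ j0 ∧ lA ≠ some k ∧ lB ≠ some k ∧ lC ≠ some k ∧
  lA ≠ some j0 ∧ lB ≠ some j0 ∧ lC ≠ some j0 ∧
  (∀ i, lA = some i → lB ≠ some i) ∧ (∀ i, lA = some i → lC ≠ some i) ∧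
  (∀ i, lB = some i → lC ≠ some i)

theorem Rot.lab_eq {k : Fin n} {T T' : Tr n} (h : Rot k T T') : T'.lab = T.lab := by
  cases h <;> rfl

theorem Rot.mem {k : Fin n} {T T' : Tr n} (h : Rot k T T') : k ∈ T.labels := by
  induction h <;> simp_all [labels]

theorem Rot.valid {k : Fin n} {T T' : Tr n} (h : Rot k T T') :
    ∀ p q, T.valid p q ↔ T'.valid p q := by
  induction h with
  | base j b c A B C =>
    intro p q
    simp only [Tr.valid]
    constructor
    · rintro ⟨h1, h2, ⟨h3, h4, h5, h6⟩, h7⟩; exact ⟨h3, by omega, h5, h4, h2, h6, h7⟩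
    · rintro ⟨h1, h2, h3, h4, h5, h6, h7⟩; exact ⟨by omega, h5, ⟨h1, h4, h3, h6⟩, h7⟩
  | inl j m l l' r _ ih => intro p q; simp only [Tr.valid, ih]
  | inr j m l r r' _ ih => intro p q; simp only [Tr.valid, ih]

theorem Rot.perm {k : Fin n} {T T' : Tr n} (h : Rot k T T') : T'.labels.Perm T.labels := by
  induction h with
  | base j b c A B C =>
    simp only [labels]
    refine List.Perm.cons _ ?_
    simp only [List.cons_append, List.append_assoc]
    exact List.perm_middle
  | inl j m l l' r _ ih => simp only [labels]; exact (ih.append_right _).cons _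
  | inr j m l r r' _ ih => simp only [labels]; exact (ih.append_left _).cons _

theorem Rot.lab_ne {k : Fin n} {T T' : Tr n} (h : Rot k T T') (hn : T.labels.Nodup) :
    T.lab ≠ some k := by
  intro e
  cases h with
  | base j b c A B C => simp_all [lab, labels]
  | inl j m l l' r h => have := h.mem; simp_all [lab, labels]
  | inr j m l r r' h => have := h.mem; simp_all [lab, labels]

theorem Rot.normal {k : Fin n} {T T' : Tr n} (h : Rot k T T') :
    ∀ p q, T.valid p q → T.labels.Nodup →
    ∃ a b c d lA lB lC j0, p ≤ a ∧ a < b ∧ b < c ∧ c < d ∧ d ≤ q ∧ Dist k j0 lA lB lC ∧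
    ∃ rest : (Option (Fin n) → ℤ → ℤ → ℤ) → Fin n → ℤ,
      (∀ y, rest y k = 0) ∧ (∀ j, rest (yB k) j = 0) ∧
      ∀ y j, R y T p q j = rest y j + loc y k j0 lA lB lC a b c d j ∧
        R y T' p q j = rest y j + loc' y k j0 lA lB lC a b c d j := by
  induction h with
  | base j b c A B C =>
    intro p q hv hn
    simp only [Tr.valid] at hv
    simp only [labels, List.nodup_cons, List.nodup_append, List.mem_cons, List.mem_append,
      List.cons_append, not_or] at hn
    refine ⟨p, b, c, q, A.lab, B.lab, C.lab, j, le_rfl, by tauto, by tauto, by tauto, le_rfl, ?_,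
      fun y i => R y A p b i + R y B b c i + R y C c q i, ?_, ?_, ?_⟩
    · have := @lab_mem n A; have := @lab_mem n B; have := @lab_mem n C
      unfold Dist
      grind
    · intro y
      simp only
      rw [R_col_zero, R_col_zero, R_col_zero] <;> grind
    · intro i
      simp only
      rw [R_row_zero, R_row_zero, R_row_zero] <;> grind
    · intro y i
      simp only [R, loc, loc', lab, Option.some.injEq]
      constructor <;> split_ifs <;> ring
  | inl j m l l' r h ih =>
    intro p q hv hn
    simp only [Tr.valid] at hv
    simp only [labels, List.nodup_cons, List.nodup_append, List.mem_append, not_or] at hn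
    obtain ⟨a, b, c, d, lA, lB, lC, j0, h1, h2, h3, h4, h5, h6, rest, h7, h8, h9⟩ :=
      ih p m hv.2.2.1 hn.2.1
    have hk := h.mem
    have hkl := h.lab_ne hn.2.1
    have hkr : k ∉ r.labels := by grind
    have hkr' : r.lab ≠ some k := fun e => hkr (lab_mem e)
    have hkj : j ≠ k := by grind
    refine ⟨a, b, c, d, lA, lB, lC, j0, h1, h2, h3, h4, by omega, h6,
      fun y i => rest y i + (R y r m q i
      + (if j = i then y r.lab m q - y l.lab p m else 0)
      + (if l.lab = some i then y (some j) p q - y r.lab m q else 0)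
      + (if r.lab = some i then y l.lab p m - y (some j) p q else 0)), ?_, ?_, ?_⟩
    · intro y; simp [h7, R_col_zero y r m q hkr, hkl, hkr', hkj]
    · intro i; simp [h8, R_row_zero r m q i hkr, yB, hkl, hkr', hkj]
    · intro y i
      simp only [R, h9, h.lab_eq]
      constructor <;> ring
  | inr j m l r r' h ih =>
    intro p q hv hn
    simp only [Tr.valid] at hv
    simp only [labels, List.nodup_cons, List.nodup_append, List.mem_append, not_or] at hn
    obtain ⟨a, b, c, d, lA, lB, lC, j0, h1, h2, h3, h4, h5, h6, rest, h7, h8, h9⟩ :=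
      ih m q hv.2.2.2 hn.2.2.1
    have hk := h.mem
    have hkl := h.lab_ne hn.2.2.1
    have hkr : k ∉ l.labels := by grind
    have hkr' : l.lab ≠ some k := fun e => hkr (lab_mem e)
    have hkj : j ≠ k := by grind
    refine ⟨a, b, c, d, lA, lB, lC, j0, by omega, h2, h3, h4, h5, h6,
      fun y i => rest y i + (R y l p m i
      + (if j = i then y r.lab m q - y l.lab p m else 0)
      + (if l.lab = some i then y (some j) p q - y r.lab m q else 0)
      + (if r.lab = some i then y l.lab p m - y (some j) p q else 0)), ?_, ?_, ?_⟩
    · intro y; simp [h7, R_col_zero y l p m hkr, hkl, hkr', hkj]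
    · intro i; simp [h8, R_row_zero l p m i hkr, yB, hkl, hkr', hkj]
    · intro y i
      simp only [R, h9, h.lab_eq]
      constructor <;> ring

end Tr


/-! ## Mutation of a row -/

/-- `V'` is the mutation at `k` of the row `V`, given the `k`-th row `β`. -/
def RowMut {n : ℕ} (k : Fin n) (β V V' : Fin n → ℤ) : Prop :=
  V' k = -V k ∧ ∀ j, j ≠ k → V' j = V j + (V k).sign * max (V k * β j) 0

theorem sign_max_pos (x w : ℤ) (hw : 0 < w) : x.sign * max (x * w) 0 = w * max x 0 := by
  rcases lt_trichotomy x 0 with h | h | h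
  · rw [max_eq_right (by nlinarith), max_eq_right h.le]; simp
  · simp [h]
  · rw [max_eq_left (by positivity), max_eq_left h.le, Int.sign_eq_one_of_pos h]; ring

theorem sign_max_neg (x w : ℤ) (hw : 0 < w) : x.sign * max (x * (-w)) 0 = -(w * max (-x) 0) := by
  have := sign_max_pos (-x) w hw
  rw [Int.sign_neg] at this
  have e : -x * w = x * (-w) := by ring
  rw [e] at this
  linarith

theorem RowMut.symm {n : ℕ} {k : Fin n} {β β' V V' : Fin n → ℤ} (h : RowMut k β V V')
    (hb : ∀ j, β' j = -β j) : RowMut k β' V' V := by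
  refine ⟨by rw [h.1]; ring, fun j hj => ?_⟩
  rw [h.2 j hj, h.1, hb, Int.sign_neg]
  have : -V k * -β j = V k * β j := by ring
  rw [this]; ring

namespace Tr

variable {n : ℕ}

/-- Column weights: the root column is doubled. -/
def w (T : Tr n) (j : Fin n) : ℤ := if T.lab = some j then 2 else 1

theorem w_pos (T : Tr n) (j : Fin n) : 0 < T.w j := by unfold w; split_ifs <;> norm_num

/-- Weighted row attached to row data. -/
def row (y : Option (Fin n) → ℤ → ℤ → ℤ) (T : Tr n) (p q : ℤ) (j : Fin n) : ℤ :=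
  T.w j * R y T p q j

theorem loc_row {k j0 : Fin n} {lA lB lC : Option (Fin n)} (hD : Dist k j0 lA lB lC)
    (a b c d : ℤ) (y : Option (Fin n) → ℤ → ℤ → ℤ)
    (hy : y (some k) a c + y (some k) b d =
      min (y lA a b + y lC c d) (y lB b c + y (some j0) a d))
    (w : Fin n → ℤ) (hw : ∀ j, 0 < w j) (hk : w k = 1) (rest restk : Fin n → ℤ)
    (h0 : rest k = 0) (h1 : ∀ j, restk j = 0) :
    RowMut k (fun j => w j * (restk j + loc (yB k) k j0 lA lB lC a b c d j))
      (fun j => w j * (rest j + loc y k j0 lA lB lC a b c d j))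
      (fun j => w j * (rest j + loc' y k j0 lA lB lC a b c d j)) := by
  obtain ⟨d1, d2, d3, d4, d5, d6, d7, d8, d9, d10⟩ := hD
  set P := y lA a b
  set Q := y lB b c
  set U := y lC c d
  set W := y (some j0) a d
  have hVk : w k * (rest k + loc y k j0 lA lB lC a b c d k) = Q - P + W - U := by
    simp [loc, h0, hk, d2, d3, d4, Ne.symm d1]
    ring
  refine ⟨?_, ?_⟩
  · simp only
    rw [hVk]
    simp [loc', h0, hk, d2, d3, d4, Ne.symm d1]
    ring
  · intro j hj
    simp only
    rw [hVk]
    have hj' : k ≠ j := hj.symm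
    have hkj0 : some j0 ≠ some k := by simpa using d1.symm
    by_cases eA : lA = some j
    · have eB := d8 j eA
      have eC := d9 j eA
      have e0 : j0 ≠ j := by rintro rfl; exact d5 eA
      have : w j * (restk j + loc (yB k) k j0 lA lB lC a b c d j) = w j := by
        simp [loc, yB, h1, d3, hj', eA, eB, eC, e0]
      rw [this, sign_max_pos _ _ (hw j)]
      simp only [loc, loc', hj', eA, eB, eC, e0, if_true, if_false, ↓reduceIte]
      rw [← sub_eq_zero]
      have : max (Q - P + W - U) 0 = W + Q - (y (some k) a c + y (some k) b d) := by
        rw [hy]; omega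
      rw [this]; ring
    by_cases eB : lB = some j
    · have eC := d10 j eB
      have e0 : j0 ≠ j := by rintro rfl; exact d6 eB
      have : w j * (restk j + loc (yB k) k j0 lA lB lC a b c d j) = - w j := by
        simp [loc, yB, h1, d2, hj', eA, eB, eC, e0]
      rw [this, sign_max_neg _ _ (hw j)]
      simp only [loc, loc', hj', eA, eB, eC, e0, if_true, if_false, ↓reduceIte]
      rw [← sub_eq_zero]
      have : max (-(Q - P + W - U)) 0 = P + U - (y (some k) a c + y (some k) b d) := by
        rw [hy]; omega
      rw [this]; ring
    by_cases eC : lC = some j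
    · have e0 : j0 ≠ j := by rintro rfl; exact d7 eC
      have : w j * (restk j + loc (yB k) k j0 lA lB lC a b c d j) = w j := by
        simp [loc, yB, h1, d1.symm, hj', eA, eB, eC, e0]
      rw [this, sign_max_pos _ _ (hw j)]
      simp only [loc, loc', hj', eA, eB, eC, e0, if_true, if_false, ↓reduceIte]
      rw [← sub_eq_zero]
      have : max (Q - P + W - U) 0 = W + Q - (y (some k) a c + y (some k) b d) := by
        rw [hy]; omega
      rw [this]; ring
    by_cases e0 : j0 = j
    · have : w j * (restk j + loc (yB k) k j0 lA lB lC a b c d j) = - w j := by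
        simp [loc, yB, h1, d4, hj', eA, eB, eC, e0]
      rw [this, sign_max_neg _ _ (hw j)]
      simp only [loc, loc', hj', eA, eB, eC, e0, if_true, if_false, ↓reduceIte]
      rw [← sub_eq_zero]
      have : max (-(Q - P + W - U)) 0 = P + U - (y (some k) a c + y (some k) b d) := by
        rw [hy]; omega
      rw [this]; ring
    · have : w j * (restk j + loc (yB k) k j0 lA lB lC a b c d j) = 0 := by
        simp [loc, h1, hj', eA, eB, eC, e0]
      rw [this]
      simp [loc, loc', hj', eA, eB, eC, e0]

/-- Antiperiodic functions satisfying the tropical Ptolemy relations. -/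
structure GoodS (N : ℤ) (s : ℤ → ℤ) : Prop where
  anti : ∀ a, s (a + N) = -s a
  pt : ∀ a b c d, a < b → b < c → c < d → d ≤ a + N →
    |s a - s c| + |s b - s d| = max (|s a - s b| + |s c - s d|) (|s b - s c| + |s a - s d|)
  rt : ∀ a b, a < b → b < a + N →
    |s a - s (a + N)| + |s b - s (b + N)| = max (2 * |s a - s b|) (2 * |s b - s (a + N)|)

/-- A tree triangulating the symmetric polygon, with all labels. -/
structure Ok (N : ℤ) (T : Tr n) (z : ℤ) : Prop where
  valid : T.valid z (z + N)
  nodup : T.labels.Nodup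
  all : ∀ k, k ∈ T.labels

/-- `T'` is obtained from `T` by the flip of the edge `k`. -/
structure Step (N : ℤ) (k : Fin n) (T : Tr n) (z : ℤ) (T' : Tr n) (z' : ℤ) : Prop where
  ok : Ok N T' z'
  rowk : ∀ j, row (yB k) T' z' (z' + N) j = - row (yB k) T z (z + N) j
  rowB : ∀ i, i ≠ k → RowMut k (row (yB k) T z (z + N))
    (row (yB i) T z (z + N)) (row (yB i) T' z' (z' + N))
  rowC : ∀ s, GoodS N s → RowMut k (row (yB k) T z (z + N))
    (row (yC s) T z (z + N)) (row (yC s) T' z' (z' + N))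

theorem Step.symm {N : ℤ} {k : Fin n} {T T' : Tr n} {z z' : ℤ} (h0 : Ok N T z)
    (h : Step N k T z T' z') : Step N k T' z' T z where
  ok := h0
  rowk j := by rw [h.rowk]; ring
  rowB i hi := (h.rowB i hi).symm h.rowk
  rowC s hs := (h.rowC s hs).symm h.rowk

theorem Rot.step {N : ℤ} {k : Fin n} {T T' : Tr n} {z : ℤ} (h0 : Ok N T z) (h : Rot k T T') :
    Step N k T z T' z := by
  have hlab := h.lab_eq
  have hk := h.lab_ne h0.nodup
  have hw : ∀ j, T'.w j = T.w j := by intro j; simp [w, hlab]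
  have hwk : T.w k = 1 := by simp [w, hk]
  obtain ⟨a, b, c, d, lA, lB, lC, j0, h1, h2, h3, h4, h5, h6, rest, h7, h8, h9⟩ :=
    h.normal z (z + N) h0.valid h0.nodup
  have e1 : ∀ y, row y T z (z + N) = fun j => T.w j * (rest y j + loc y k j0 lA lB lC a b c d j) := by
    intro y; funext j; simp only [row, (h9 y j).1]
  have e2 : ∀ y, row y T' z (z + N) = fun j => T.w j * (rest y j + loc' y k j0 lA lB lC a b c d j) := by
    intro y; funext j; simp only [row, (h9 y j).2, hw]
  have main : ∀ y : Option (Fin n) → ℤ → ℤ → ℤ, y (some k) a c + y (some k) b d =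
      min (y lA a b + y lC c d) (y lB b c + y (some j0) a d) →
      RowMut k (row (yB k) T z (z + N)) (row y T z (z + N)) (row y T' z (z + N)) := by
    intro y hy
    rw [e1, e1, e2]
    exact loc_row h6 a b c d y hy _ T.w_pos hwk _ _ (h7 y) h8
  refine ⟨⟨(h.valid _ _).1 h0.valid, h.perm.nodup_iff.2 h0.nodup,
    fun i => h.perm.mem_iff.2 (h0.all i)⟩, ?_, ?_, ?_⟩
  · intro j
    rw [e1, e2]
    obtain ⟨d1, d2, d3, d4, d5, d6, d7, d8, d9, d10⟩ := h6
    have : j0 ≠ k := d1.symm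
    simp only [h8, loc, loc', yB, d2, d3, d4, this, Option.some.injEq, ↓reduceIte]
    split_ifs <;> ring
  · intro i hi
    apply main
    obtain ⟨d1, d2, d3, d4, d5, d6, d7, d8, d9, d10⟩ := h6
    have : k ≠ i := hi.symm
    simp only [yB, this, Option.some.injEq, ↓reduceIte]
    by_cases eA : lA = some i
    · have : j0 ≠ i := by rintro rfl; exact d5 eA
      simp [eA, d8 i eA, d9 i eA, this]
    by_cases eC : lC = some i
    · have : j0 ≠ i := by rintro rfl; exact d7 eC
      have : lB ≠ some i := fun e => d10 i e eC
      simp [*]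
    simp only [eA, eC, ↓reduceIte]
    split_ifs <;> simp
  · intro s hs
    apply main
    have := hs.pt a b c d h2 h3 h4 (by omega)
    simp only [yC]
    omega

theorem lab_node (k : Fin n) (m : ℤ) (l r : Tr n) : (node k m l r).lab = some k := rfl

/-- The flip of the root. -/
theorem swap_step {N : ℤ} {k : Fin n} {m z : ℤ} {l r : Tr n} (h0 : Ok N (node k m l r) z) :
    Step N k (node k m l r) z (node k (z + N) r (l.sh N)) m := by
  obtain ⟨hv, hn, ha⟩ := h0
  simp only [Tr.valid] at hv
  simp only [labels, List.nodup_cons, List.nodup_append, List.mem_append, not_or] at hn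
  have hkl : k ∉ l.labels := hn.1.1
  have hkr : k ∉ r.labels := hn.1.2
  have hkl' : l.lab ≠ some k := fun e => hkl (lab_mem e)
  have hkr' : r.lab ≠ some k := fun e => hkr (lab_mem e)
  have hlr : ∀ i, l.lab = some i → r.lab ≠ some i := fun i e e' =>
    hn.2.2.2 i (lab_mem e) i (lab_mem e') rfl
  have e2 : ∀ y : Option (Fin n) → ℤ → ℤ → ℤ, (∀ o a b, y o (a + N) (b + N) = y o a b) → ∀ j,
      row y (node k (z + N) r (l.sh N)) m (m + N) j =
      (if k = j then 2 else 1) * (R y r m (z + N) j + R y l z m j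
      + (if k = j then y l.lab z m - y r.lab m (z + N) else 0)
      + (if r.lab = some j then y (some k) m (m + N) - y l.lab z m else 0)
      + (if l.lab = some j then y r.lab m (z + N) - y (some k) m (m + N) else 0)) := by
    intro y hy j
    simp only [row, w, R, lab_node, sh_lab, Option.some.injEq, hy, sh_R N y hy]
  have main : ∀ y : Option (Fin n) → ℤ → ℤ → ℤ, (∀ o a b, y o (a + N) (b + N) = y o a b) →
      y (some k) z (z + N) + y (some k) m (m + N) =
      min (2 * y l.lab z m) (2 * y r.lab m (z + N)) →
      RowMut k (row (yB k) (node k m l r) z (z + N)) (row y (node k m l r) z (z + N))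
       (row y (node k (z + N) r (l.sh N)) m (m + N)) := by
    intro y hy hpt
    set P := y l.lab z m
    set Q := y r.lab m (z + N)
    have hVk : row y (node k m l r) z (z + N) k = 2 * Q - 2 * P := by
      simp [row, w, R, lab_node, R_col_zero y l _ _ hkl, R_col_zero y r _ _ hkr, hkl', hkr']
      ring
    constructor
    · rw [hVk, e2 y hy]
      simp [R_col_zero y l _ _ hkl, R_col_zero y r _ _ hkr, hkl', hkr']
      ring
    · intro j hj
      have hj' : k ≠ j := hj.symm
      rw [hVk, e2 y hy]
      by_cases el : l.lab = some j
      · have er := hlr j el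
        have : row (yB k) (node k m l r) z (z + N) j = 1 := by
          simp [row, w, R, lab_node, R_row_zero l _ _ _ hkl, R_row_zero r _ _ _ hkr, hkr', hj', el,
            er, yB]
        rw [this, sign_max_pos _ _ one_pos]
        simp only [row, w, R, lab_node, hj', el, er, Option.some.injEq, ↓reduceIte]
        omega
      by_cases er : r.lab = some j
      · have : row (yB k) (node k m l r) z (z + N) j = -1 := by
          simp [row, w, R, lab_node, R_row_zero l _ _ _ hkl, R_row_zero r _ _ _ hkr, hkl', hj', el,
            er, yB]
        rw [this, sign_max_neg _ _ one_pos]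
        simp only [row, w, R, lab_node, hj', el, er, Option.some.injEq, ↓reduceIte]
        omega
      · have : row (yB k) (node k m l r) z (z + N) j = 0 := by
          simp [row, w, R, lab_node, R_row_zero l _ _ _ hkl, R_row_zero r _ _ _ hkr, hj', el,
            er]
        rw [this]
        simp [row, w, R, lab_node, hj', el, er]
        ring
  refine ⟨⟨?_, ?_, ?_⟩, ?_, ?_, ?_⟩
  · simp only [Tr.valid]
    exact ⟨by omega, by omega, hv.2.2.2, sh_valid N l _ _ hv.2.2.1⟩
  · simp only [labels, sh_labels, List.nodup_cons, List.nodup_append, List.mem_append, not_or]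
    exact ⟨⟨hkr, hkl⟩, hn.2.2.1, hn.2.1, fun a h b h' e => hn.2.2.2 b h' a h e.symm⟩
  · intro i
    have := ha i
    simp only [labels, sh_labels, List.mem_cons, List.mem_append] at this ⊢
    tauto
  · intro j
    rw [e2 (yB k) (fun _ _ _ => rfl)]
    simp only [row, w, R, lab_node, R_row_zero l _ _ _ hkl, R_row_zero r _ _ _ hkr, hkr', hkl', yB,
      Option.some.injEq, ↓reduceIte]
    split_ifs <;> ring
  · intro i hi
    refine main (yB i) (fun _ _ _ => rfl) ?_
    have : k ≠ i := hi.symm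
    simp only [yB, this, Option.some.injEq, ↓reduceIte]
    by_cases el : l.lab = some i
    · simp [el, hlr i el]
    · simp only [el, ↓reduceIte]
      split_ifs <;> simp
  · intro s hs
    refine main (yC s) (fun _ a b => ?_) ?_
    · simp only [yC, hs.anti]
      rw [← abs_neg]; congr 2; ring
    · have := hs.rt z m (by omega) (by omega)
      simp only [yC]
      omega

theorem exists_rot {k : Fin n} : ∀ T : Tr n, k ∈ T.labels → T.lab ≠ some k →
    ∃ T', Rot k T T' ∨ Rot k T' T := by
  intro T
  induction T with
  | leaf => intro h; simp [labels] at h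
  | node j m l r ihl ihr =>
    intro h hne
    simp only [labels, List.mem_cons, List.mem_append] at h
    simp only [lab, ne_eq, Option.some.injEq] at hne
    rcases h with h | h | h
    · exact absurd h.symm hne
    · by_cases e : l.lab = some k
      · cases l with
        | leaf => simp [lab] at e
        | node k' b A B =>
          simp only [lab, Option.some.injEq] at e
          subst e
          exact ⟨_, Or.inl (Rot.base _ _ _ _ _ _)⟩
      · obtain ⟨T', h' | h'⟩ := ihl h e
        · exact ⟨_, Or.inl (Rot.inl _ _ _ _ _ h')⟩
        · exact ⟨_, Or.inr (Rot.inl _ _ _ _ _ h')⟩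
    · by_cases e : r.lab = some k
      · cases r with
        | leaf => simp [lab] at e
        | node k' b A B =>
          simp only [lab, Option.some.injEq] at e
          subst e
          exact ⟨_, Or.inr (Rot.base _ _ _ _ _ _)⟩
      · obtain ⟨T', h' | h'⟩ := ihr h e
        · exact ⟨_, Or.inl (Rot.inr _ _ _ _ _ h')⟩
        · exact ⟨_, Or.inr (Rot.inr _ _ _ _ _ h')⟩

theorem Ok.of_rot_symm {N : ℤ} {k : Fin n} {T T' : Tr n} {z : ℤ} (h0 : Ok N T z)
    (h : Rot k T' T) : Ok N T' z :=
  ⟨(h.valid _ _).2 h0.valid, h.perm.nodup_iff.1 h0.nodup, fun i => h.perm.mem_iff.1 (h0.all i)⟩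

theorem Rot.step_symm {N : ℤ} {k : Fin n} {T T' : Tr n} {z : ℤ} (h0 : Ok N T z) (h : Rot k T' T) :
    Step N k T z T' z :=
  (h.step (h0.of_rot_symm h)).symm (h0.of_rot_symm h)

theorem exists_step {N : ℤ} {T : Tr n} {z : ℤ} (h0 : Ok N T z) (k : Fin n) :
    ∃ T' z', Step N k T z T' z' := by
  by_cases e : T.lab = some k
  · cases T with
    | leaf => simp [lab] at e
    | node k' m l r =>
      simp only [lab, Option.some.injEq] at e
      subst e
      exact ⟨_, _, swap_step h0⟩
  · obtain ⟨T', h | h⟩ := exists_rot T (h0.all k) e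
    · exact ⟨T', z, h.step h0⟩
    · exact ⟨T', z, h.step_symm h0⟩

end Tr


/-! ## Realizations of matrices by trees -/

namespace Tr

variable {n : ℕ}

/-- The tree `T` realizes the exchange matrix `B`. -/
structure RepB (N : ℤ) (B : Matrix (Fin n) (Fin n) ℤ) (T : Tr n) (z : ℤ) : Prop where
  ok : Ok N T z
  top : ∀ i j, B i j = row (yB i) T z (z + N) j

/-- The tree `T` realizes the extended exchange matrix `b`. -/
structure Rep (N : ℤ) (S : Fin n → ℤ → ℤ) (b : Matrix (Fin n ⊕ Fin n) (Fin n) ℤ)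
    (T : Tr n) (z : ℤ) : Prop where
  ok : Ok N T z
  top : ∀ i j, b (Sum.inl i) j = row (yB i) T z (z + N) j
  bot : ∀ i j, 4 * b (Sum.inr i) j = row (yC (S i)) T z (z + N) j

theorem mutMat_apply (k : Fin n) (B : Matrix (Fin n) (Fin n) ℤ) (i j : Fin n) :
    mutMat k B i j = if i = k ∨ j = k then -B i j
      else B i j + (B i k).sign * max (B i k * B k j) 0 := rfl

theorem mutMatExt_apply (k : Fin n) (b : Matrix (Fin n ⊕ Fin n) (Fin n) ℤ) (i : Fin n ⊕ Fin n)
    (j : Fin n) : mutMatExt k b i j = if i = Sum.inl k ∨ j = k then -b i j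
      else b i j + (b i k).sign * max (b i k * b (Sum.inl k) j) 0 := rfl

theorem RepB.step {N : ℤ} {B : Matrix (Fin n) (Fin n) ℤ} {T T' : Tr n} {z z' : ℤ} {k : Fin n}
    (h : RepB N B T z) (hs : Step N k T z T' z') : RepB N (mutMat k B) T' z' := by
  refine ⟨hs.ok, fun i j => ?_⟩
  rw [mutMat_apply]
  by_cases hi : i = k
  · subst hi
    simp only [true_or, ↓reduceIte]
    rw [hs.rowk, h.top]
  · by_cases hj : j = k
    · subst hj
      simp only [or_true, ↓reduceIte]
      rw [(hs.rowB i hi).1, h.top]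
    · simp only [hi, hj, or_self, ↓reduceIte]
      rw [(hs.rowB i hi).2 j hj, h.top, h.top, h.top]

theorem Rep.step {N : ℤ} {S : Fin n → ℤ → ℤ} (hS : ∀ i, GoodS N (S i))
    {b : Matrix (Fin n ⊕ Fin n) (Fin n) ℤ} {T T' : Tr n} {z z' : ℤ} {k : Fin n}
    (h : Rep N S b T z) (hs : Step N k T z T' z') : Rep N S (mutMatExt k b) T' z' := by
  refine ⟨hs.ok, fun i j => ?_, fun i j => ?_⟩
  · rw [mutMatExt_apply]
    by_cases hi : i = k
    · subst hi
      simp only [true_or, ↓reduceIte]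
      rw [hs.rowk, h.top]
    · by_cases hj : j = k
      · subst hj
        simp only [or_true, ↓reduceIte]
        rw [(hs.rowB i hi).1, h.top]
      · simp only [hi, hj, Sum.inl.injEq, or_self, ↓reduceIte]
        rw [(hs.rowB i hi).2 j hj, h.top, h.top, h.top]
  · rw [mutMatExt_apply]
    by_cases hj : j = k
    · subst hj
      simp only [or_true, ↓reduceIte]
      rw [(hs.rowC _ (hS i)).1, ← h.bot]; ring
    · simp only [hj, reduceCtorEq, or_self, ↓reduceIte]
      rw [(hs.rowC _ (hS i)).2 j hj, ← h.bot, ← h.bot, ← h.top]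
      generalize b (Sum.inr i) k = x
      generalize b (Sum.inr i) j = u
      generalize b (Sum.inl k) j = v
      have e1 : (4 * x).sign = x.sign := by
        rw [Int.sign_mul, show (4 : ℤ).sign = 1 from rfl, one_mul]
      have e2 : max (4 * x * v) 0 = 4 * max (x * v) 0 := by
        rw [mul_assoc]; omega
      rw [e1, e2]; ring

theorem mutMat_invol (k : Fin n) (B : Matrix (Fin n) (Fin n) ℤ) : mutMat k (mutMat k B) = B := by
  funext i j
  simp only [mutMat_apply]
  by_cases hi : i = k
  · simp [hi]
  · by_cases hj : j = k
    · simp [hj]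
    · simp [hi, hj, Int.sign_neg]

/-- Entrywise form of skew-symmetrizability. -/
def Skew (d : Fin n → ℤ) (B : Matrix (Fin n) (Fin n) ℤ) : Prop :=
  ∀ i j, d i * B i j = -(d j * B j i)

theorem skew_sign {x y dx dy : ℤ} (hx : 0 < dx) (hy : 0 < dy) (h : dx * x = -(dy * y)) :
    x.sign = - y.sign := by
  have : (dx * x).sign = (-(dy * y)).sign := by rw [h]
  rw [Int.sign_neg, Int.sign_mul, Int.sign_mul, Int.sign_eq_one_of_pos hx,
    Int.sign_eq_one_of_pos hy] at this
  simpa using this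

theorem Skew.mut {d : Fin n → ℤ} (hd : ∀ i, 0 < d i) {B : Matrix (Fin n) (Fin n) ℤ}
    (h : Skew d B) (k : Fin n) : Skew d (mutMat k B) := by
  intro i j
  rw [mutMat_apply, mutMat_apply]
  by_cases hij : i = k ∨ j = k
  · have hij' : j = k ∨ i = k := hij.symm
    simp only [hij, hij', ↓reduceIte]
    have := h i j
    linarith
  · have hij' : ¬ (j = k ∨ i = k) := fun e => hij e.symm
    simp only [hij, hij', ↓reduceIte]
    have h1 := h i j
    have h2 := h i k
    have h3 := h j k
    have s2 := skew_sign (hd i) (hd k) h2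
    have s3 := skew_sign (hd j) (hd k) h3
    suffices d i * ((B i k).sign * max (B i k * B k j) 0)
        = -(d j * ((B j k).sign * max (B j k * B k i) 0)) by linarith
    have key : d i * (B i k * B k j) = d j * (B j k * B k i) := by
      have : d i * (B i k * B k j) = (d i * B i k) * B k j := by ring
      rw [this, h2]
      have : d j * (B j k * B k i) = (d j * B j k) * B k i := by ring
      rw [this, h3]; ring
    have hdi := hd i
    have hdj := hd j
    rw [s2, s3]
    by_cases hpos : 0 < B i k * B k j
    · have hpos' : 0 < B j k * B k i := by
        have : 0 < d i * (B i k * B k j) := by positivity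
        rw [key] at this
        exact (pos_iff_pos_of_mul_pos this).1 hdj
      rw [max_eq_left hpos.le, max_eq_left hpos'.le]
      have ss : (B i k * B k j).sign = 1 := Int.sign_eq_one_of_pos hpos
      rw [Int.sign_mul, s2] at ss
      have : (B k j).sign = -(B k i).sign := by
        rcases Int.sign_trichotomy (B k i) with e | e | e <;> rw [e] at ss ⊢ <;> omega
      rw [this]
      linear_combination (-(B k i).sign) * key
    · have hpos' : ¬ 0 < B j k * B k i := by
        intro h'
        have : 0 < d j * (B j k * B k i) := by positivity
        rw [← key] at this
        exact hpos ((pos_iff_pos_of_mul_pos this).1 hdi)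
      rw [max_eq_right (by omega), max_eq_right (by omega)]
      simp

/-- Chain-shaped trees. -/
def chain (σ : ℕ → Fin n) (e : ℕ → Prop) : ℕ → Tr n
  | 0 => node (σ 0) 1 leaf leaf
  | j + 1 =>
    open Classical in
    if e j then node (σ (j + 1)) (j + 2) (chain σ e j) leaf
    else node (σ (j + 1)) 1 leaf ((chain σ e j).sh 1)

variable (σ : ℕ → Fin n) (e : ℕ → Prop)

open Classical in
theorem chain_succ (j : ℕ) : chain σ e (j + 1) =
    if e j then node (σ (j + 1)) (j + 2) (chain σ e j) leaf
    else node (σ (j + 1)) 1 leaf ((chain σ e j).sh 1) := rfl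

theorem chain_lab (j : ℕ) : (chain σ e j).lab = some (σ j) := by
  cases j with
  | zero => rfl
  | succ j => rw [chain_succ]; split_ifs <;> rfl

theorem chain_labels (j : ℕ) : (chain σ e j).labels = ((List.range (j + 1)).map σ).reverse := by
  induction j with
  | zero => simp [chain, labels]
  | succ j ih =>
    rw [List.range_succ, List.map_append, List.reverse_append, ← ih]
    rw [chain_succ]; split_ifs <;> simp [labels, sh_labels]

theorem chain_valid (j : ℕ) : (chain σ e j).valid 0 (j + 2) := by
  induction j with
  | zero => simp [chain, valid]
  | succ j ih =>
    rw [chain_succ]; split_ifs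
    · simp only [valid]; push_cast; exact ⟨by omega, by omega, ih, by omega⟩
    · simp only [valid]; refine ⟨by omega, by push_cast; omega, by omega, ?_⟩
      push_cast
      have h1 := sh_valid 1 _ _ _ ih
      have h2 : (j : ℤ) + 1 + 2 = j + 2 + 1 := by ring
      rw [h2]; simpa using h1

open Classical in
theorem chain_R_succ (i : Fin n) (j : ℕ) (c : Fin n) :
    R (yB i) (chain σ e (j + 1)) 0 ((j + 1 : ℕ) + 2) c = R (yB i) (chain σ e j) 0 (j + 2) c +
      (if e j then 1 else -1) * ((if i = σ (j + 1) ∧ c = σ j then 1 else 0)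
        - (if i = σ j ∧ c = σ (j + 1) then 1 else 0)) := by
  rw [chain_succ]
  have h1 : ∀ x, (σ x = i) = (i = σ x) := fun x => propext eq_comm
  have h2 : ∀ x, (σ x = c) = (c = σ x) := fun x => propext eq_comm
  have hh : (leaf : Tr n).lab = none := rfl
  have hR : ∀ y p q, R y (leaf : Tr n) p q c = 0 := fun _ _ _ => rfl
  have e1 : ((j + 1 : ℕ) : ℤ) + 2 = j + 2 + 1 := by push_cast; ring
  by_cases h : e j
  · rw [if_pos h, if_pos h, R]
    simp only [chain_lab, hh, hR, yB, Option.some.injEq, h1, h2, reduceCtorEq, ↓reduceIte]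
    split_ifs <;> omega
  · have hs := sh_R 1 (yB i) (fun _ _ _ => rfl) (chain σ e j) 0 (j + 2) c
    rw [if_neg h, if_neg h, R, e1]
    simp only [zero_add] at hs
    simp only [hs, sh_lab, chain_lab, hh, hR, yB, Option.some.injEq, h1, h2, reduceCtorEq, ↓reduceIte]
    split_ifs <;> omega

open Classical in
theorem chain_R (M : ℕ) (hσ : ∀ s t, s ≤ M → t ≤ M → σ s = σ t → s = t) (j : ℕ) :
    j ≤ M → ∀ s t, s ≤ j → t ≤ j →
    R (yB (σ s)) (chain σ e j) 0 (j + 2) (σ t) =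
      if s = t + 1 then (if e t then 1 else -1) else
      if t = s + 1 then -(if e s then 1 else -1) else 0 := by
  induction j with
  | zero =>
    intro _ s t hs ht
    obtain rfl : s = 0 := by omega
    obtain rfl : t = 0 := by omega
    simp [chain, R, yB, lab]
  | succ j ih =>
    intro hj s t hs ht
    rw [chain_R_succ]
    have hh : ∀ a b, a ≤ j + 1 → b ≤ j + 1 → ((σ a = σ b) = (a = b)) := by
      intro a b ha hb
      exact propext ⟨fun h => hσ a b (by omega) (by omega) h, fun h => h ▸ rfl⟩
    simp only [hh s _ hs le_rfl, hh s j hs (by omega), hh t _ ht le_rfl, hh t j ht (by omega)]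
    have hnm : σ (j + 1) ∉ (chain σ e j).labels := by
      rw [chain_labels]
      simp only [List.mem_reverse, List.mem_map, List.mem_range, not_exists, not_and]
      intro x hx hxe
      have := hσ x (j + 1) (by omega) (by omega) hxe
      omega
    by_cases hs1 : s = j + 1
    · subst hs1
      rw [R_row_zero _ _ _ _ hnm]
      by_cases ht' : t = j
      · subst ht'; simp
      · have : ¬ (j + 1 = t + 1) := by omega
        have : ¬ (t = j + 1 + 1) := by omega
        simp [*]
        omega
    · by_cases ht1 : t = j + 1
      · subst ht1
        rw [R_col_zero _ _ _ _ hnm]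
        by_cases ht' : s = j
        · subst ht'; simp
          omega
        · have : ¬ (s = j + 1 + 1) := by omega
          have : ¬ (j = s) := by omega
          simp [*]
      · rw [ih (by omega) s t (by omega) (by omega)]
        simp [hs1, ht1]

theorem exists_repB_chain (hn : 2 ≤ n) {B : Matrix (Fin n) (Fin n) ℤ} {d : Fin n → ℤ}
    (hd : ∀ i, 0 < d i) (hB : Skew d B) (σ : Equiv.Perm (Fin n))
    (hC : ∀ i j, cartanCounterpart B (σ i) (σ j) = cartanC n i j) :
    ∃ T, RepB (n + 1) B T 0 := by
  classical
  obtain ⟨M, rfl⟩ : ∃ M, n = M + 1 := ⟨n - 1, by omega⟩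
  let f : ℕ → Fin (M + 1) := fun t => if h : t < M + 1 then σ ⟨t, h⟩ else σ 0
  have hf : ∀ t (h : t < M + 1), f t = σ ⟨t, h⟩ := fun t h => by simp only [f]; rw [dif_pos h]
  have hinj : ∀ s t, s ≤ M → t ≤ M → f s = f t → s = t := by
    intro s t hs ht h
    rw [hf s (by omega), hf t (by omega)] at h
    simpa using σ.injective h
  obtain ⟨e, he⟩ : ∃ e : ℕ → Prop, ∀ t, e t ↔ 0 < B (f (t + 1)) (f t) := ⟨_, fun _ => Iff.rfl⟩
  refine ⟨chain f e M, ⟨?_, ?_, ?_⟩, ?_⟩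
  · convert chain_valid f e M using 1; push_cast; ring
  · rw [chain_labels, List.nodup_reverse]
    refine List.Nodup.map_on ?_ List.nodup_range
    intro x hx y hy h
    simp only [List.mem_range] at hx hy
    exact hinj x y (by omega) (by omega) h
  · intro k
    rw [chain_labels]
    simp only [List.mem_reverse, List.mem_map, List.mem_range]
    refine ⟨(σ.symm k).val, (σ.symm k).isLt, ?_⟩
    rw [hf _ (σ.symm k).isLt]; simp
  · intro i j
    obtain ⟨s, rfl⟩ := σ.surjective i
    obtain ⟨t, rfl⟩ := σ.surjective j
    obtain ⟨s, hs⟩ := s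
    obtain ⟨t, ht⟩ := t
    have hc := hC ⟨s, hs⟩ ⟨t, ht⟩
    have hsk := hB (σ ⟨s, hs⟩) (σ ⟨t, ht⟩)
    have hsg := skew_sign (hd _) (hd _) hsk
    rw [← hf s hs, ← hf t ht] at hc hsk hsg ⊢
    have hR := chain_R f e M hinj M le_rfl s t (by omega) (by omega)
    have hw : (chain f e M).w (f t) = if t = M then 2 else 1 := by
      unfold w
      rw [chain_lab]
      by_cases h : t = M
      · simp [h]
      · have : ¬ f M = f t := fun h' => h (hinj M t le_rfl (by omega) h').symm
        simp [h, this]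
    have hz : (0 : ℤ) + ((M + 1 : ℕ) + 1) = M + 2 := by push_cast; ring
    rw [row, hz, hR, hw]
    unfold cartanCounterpart cartanC at hc
    by_cases hst : s = t
    · subst hst
      have : d (f s) * B (f s) (f s) = 0 := by linarith
      have := (mul_eq_zero.1 this).resolve_left (hd _).ne'
      simp [this]
    · have hne : f s ≠ f t := fun h => hst (hinj s t (by omega) (by omega) h)
      simp only [hne, Fin.mk.injEq, hst, ↓reduceIte] at hc
      by_cases h1 : s = t + 1
      · subst h1
        have h2 : ¬ (t + 1 + 2 = M + 1 ∧ t + 1 = M + 1) := by omega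
        have h3 : t ≠ M := by omega
        simp only [h2, h3, or_true, ↓reduceIte] at hc ⊢
        simp only [he]
        split_ifs with h4
        · rw [abs_of_pos h4] at hc; omega
        · rw [abs_of_nonpos (by omega)] at hc; omega
      · by_cases h2 : t = s + 1
        · subst h2
          simp only [h1, ↓reduceIte, true_or]
          have hpos : (if e s then (1 : ℤ) else -1) = - (B (f s) (f (s + 1))).sign := by
            rw [hsg]
            have hn0 : B (f s) (f (s + 1)) ≠ 0 := by
              intro h0
              rw [h0] at hc
              simp only [abs_zero, true_or, ↓reduceIte] at hc
              split_ifs at hc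
            have hn1 : B (f (s + 1)) (f s) ≠ 0 := by
              intro h0; rw [h0] at hsg; simp at hsg; exact hn0 hsg
            simp only [he]
            split_ifs with h4
            · rw [Int.sign_eq_one_of_pos h4]; ring
            · rw [Int.sign_eq_neg_one_of_neg (by omega)]; ring
          rw [hpos]
          have hab := Int.sign_mul_abs (B (f s) (f (s + 1)))
          simp only [true_or, ↓reduceIte] at hc
          by_cases h5 : s + 1 = M
          · have : s + 2 = M + 1 ∧ s + 1 + 1 = M + 1 := by omega
            simp only [this, and_self, ↓reduceIte] at hc
            have : |B (f s) (f (s + 1))| = 2 := by omega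
            rw [this] at hab
            simp only [h5, ↓reduceIte] at hab ⊢
            linarith
          · have : ¬ (s + 2 = M + 1 ∧ s + 1 + 1 = M + 1) := by omega
            simp only [this, ↓reduceIte] at hc
            have : |B (f s) (f (s + 1))| = 1 := by omega
            rw [this] at hab
            simp only [h5, ↓reduceIte] at hab ⊢
            linarith
        · have h3 : ¬ (s + 2 = M + 1 ∧ t + 1 = M + 1) := by omega
          have h4 : ¬ (s + 1 = t ∨ t + 1 = s) := by omega
          simp only [h3, h4, ↓reduceIte] at hc
          have : B (f s) (f t) = 0 := by simpa using hc
          simp [this, h1, h2]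

theorem RepB.shift {N : ℤ} {B : Matrix (Fin n) (Fin n) ℤ} {T : Tr n} {z : ℤ}
    (h : RepB N B T z) : RepB N B (T.sh (-z)) 0 := by
  have e1 : (0 : ℤ) = z + -z := by ring
  have e2 : (0 : ℤ) + N = z + N + -z := by ring
  refine ⟨⟨?_, ?_, ?_⟩, fun i j => ?_⟩
  · have := sh_valid (-z) T _ _ h.ok.valid
    rw [← e1, ← e2] at this; exact this
  · rw [sh_labels]; exact h.ok.nodup
  · rw [sh_labels]; exact h.ok.all
  · have := sh_R (-z) (yB i) (fun _ _ _ => rfl) T z (z + N) j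
    rw [← e1, ← e2] at this
    rw [h.top, row, row, this]
    simp [w, sh_lab]

theorem exists_repB (hn : 2 ≤ n) (B : Matrix (Fin n) (Fin n) ℤ) (hB : SkewSymmetrizable B)
    (htype : MatrixOfTypeC B) : ∃ T, RepB (n + 1) B T 0 := by
  obtain ⟨d, hd, hsk⟩ := hB
  have hsk : Skew d B := by
    intro i j
    have := congrFun (congrFun hsk j) i
    simpa using this
  obtain ⟨B', hBB', σ, hσ⟩ := htype
  have hsk' : Skew d B' := by
    clear hσ
    induction hBB' with
    | refl => exact hsk
    | tail _ h ih => obtain ⟨k, rfl⟩ := h; exact ih.mut hd k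
  obtain ⟨T, hT⟩ := exists_repB_chain hn hd hsk' σ hσ
  have key : ∀ C, Relation.ReflTransGen (fun a c => ∃ k, c = mutMat k a) B C →
      (∃ T z, RepB (n + 1) C T z) → ∃ T z, RepB (n + 1) B T z := by
    intro C hC
    induction hC with
    | refl => exact id
    | @tail C1 C2 _ h ih =>
      rintro ⟨T, z, h2⟩
      obtain ⟨k, rfl⟩ := h
      apply ih
      obtain ⟨T', z', hs⟩ := exists_step h2.ok k
      have := h2.step hs
      rw [mutMat_invol] at this
      exact ⟨T', z', this⟩
  obtain ⟨T, z, h⟩ := key B' hBB' ⟨T, 0, hT⟩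
  exact ⟨_, h.shift⟩

end Tr

/-! ## The initial tree -/

namespace Tr

variable {n : ℕ}

/-- Antiperiodic extension of `v` times the indicator function of the interval from `p`
(excluded) to `q` (included). -/
def Sf (N p q v : ℤ) (a : ℤ) : ℤ :=
  (if ((a - 1) / N) % 2 = 0 then 1 else -1) *
    (if p < (a - 1) % N + 1 ∧ (a - 1) % N + 1 ≤ q then v else 0)

theorem Sf_eq {N : ℤ} (p q v : ℤ) {a : ℤ} (h1 : 0 < a) (h2 : a ≤ N) :
    Sf N p q v a = if p < a ∧ a ≤ q then v else 0 := by
  unfold Sf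
  rw [Int.ediv_eq_zero_of_lt (by omega) (by omega), Int.emod_eq_of_lt (a := a - 1) (b := N) (by omega) (by omega)]
  simp [sub_add_cancel]

theorem Sf_anti {N : ℤ} (hN : 0 < N) (p q v a : ℤ) : Sf N p q v (a + N) = - Sf N p q v a := by
  unfold Sf
  have e1 : a + N - 1 = (a - 1) + N * 1 := by ring
  rw [e1, Int.add_mul_ediv_left _ _ hN.ne', Int.add_mul_emod_self_left]
  generalize (a - 1) / N = t
  generalize (if p < (a - 1) % N + 1 ∧ (a - 1) % N + 1 ≤ q then v else 0) = x
  have : (if (t + 1) % 2 = 0 then (1 : ℤ) else -1) = -(if t % 2 = 0 then 1 else -1) := by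
    split_ifs <;> omega
  rw [this]; ring

theorem anti_shift {N : ℤ} {s : ℤ → ℤ} (h : ∀ a, s (a + N) = -s a) (t : ℤ) :
    (∀ x, s (x + t * N) = s x) ∨ (∀ x, s (x + t * N) = - s x) := by
  induction t using Int.induction_on with
  | zero => left; intro x; simp
  | succ i ih =>
    have e : ∀ x, x + ((i : ℤ) + 1) * N = x + i * N + N := fun x => by ring
    rcases ih with ih | ih
    · right; intro x; rw [e, h, ih]
    · left; intro x; rw [e, h, ih]; ring
  | pred i ih =>
    have e : ∀ x, s (x + (-(i : ℤ) - 1) * N) = - s (x + (-(i : ℤ)) * N) := fun x => by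
      have := h (x + (-(i : ℤ) - 1) * N)
      have e2 : x + (-(i : ℤ) - 1) * N + N = x + (-(i : ℤ)) * N := by ring
      rw [e2] at this; linarith
    rcases ih with ih | ih
    · right; intro x; rw [e, ih]
    · left; intro x; rw [e, ih]; ring

theorem abs_shift {N : ℤ} {s : ℤ → ℤ} (h : ∀ a, s (a + N) = -s a) (t x y : ℤ) :
    |s (x + t * N) - s (y + t * N)| = |s x - s y| := by
  rcases anti_shift h t with h | h
  · rw [h, h]
  · rw [h, h, ← abs_neg]; congr 1; ring

theorem exists_shift {N : ℤ} (hN : 0 < N) (a : ℤ) : ∃ t a', a = a' + t * N ∧ 0 < a' ∧ a' ≤ N := by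
  refine ⟨(a - 1) / N, (a - 1) % N + 1, ?_, ?_, ?_⟩
  · have := Int.emod_add_mul_ediv (a - 1) N
    linarith
  · have := Int.emod_nonneg (a - 1) hN.ne'
    omega
  · have := Int.emod_lt_of_pos (a - 1) hN
    omega

/-- Values of `Sf` on two periods. -/
theorem Sf_cases {N p q v : ℤ} (hp : 0 ≤ p) (hpq : p < q) (hq : q ≤ N) {x : ℤ} (h1 : 0 < x)
    (h2 : x ≤ 2 * N) :
    (Sf N p q v x = 0 ∧ x ≤ p) ∨ (Sf N p q v x = v ∧ p < x ∧ x ≤ q) ∨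
    (Sf N p q v x = 0 ∧ q < x ∧ x ≤ p + N) ∨ (Sf N p q v x = -v ∧ p + N < x ∧ x ≤ q + N) ∨
    (Sf N p q v x = 0 ∧ q + N < x) := by
  by_cases h : x ≤ N
  · rw [Sf_eq p q v h1 h]; split_ifs <;> omega
  · have := Sf_anti (by omega : 0 < N) p q v (x - N)
    rw [sub_add_cancel, Sf_eq p q v (a := x - N) (by omega) (by omega)] at this
    rw [this]; split_ifs <;> omega

theorem Sf_good {N p q v : ℤ} (hp : 0 ≤ p) (hpq : p < q) (hq : q ≤ N) (hv : 0 ≤ v) :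
    GoodS N (Sf N p q v) := by
  have hN : 0 < N := by omega
  have anti := Sf_anti hN p q v
  have a1 : |v| = v := abs_of_nonneg hv
  have a2 : |v + v| = 2 * v := by rw [abs_of_nonneg (by omega)]; ring
  have a4 : |-v + -v| = 2 * v := by rw [abs_of_nonpos (by omega)]; ring
  have a3 : |-v - v| = 2 * v := by rw [abs_of_nonpos (by omega)]; ring
  refine ⟨anti, ?_, ?_⟩
  · intro a b c d hab hbc hcd hda
    obtain ⟨t, a', rfl, ha1, ha2⟩ := exists_shift hN a
    obtain ⟨b', rfl⟩ : ∃ b', b = b' + t * N := ⟨b - t * N, by ring⟩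
    obtain ⟨c', rfl⟩ : ∃ c', c = c' + t * N := ⟨c - t * N, by ring⟩
    obtain ⟨d', rfl⟩ : ∃ d', d = d' + t * N := ⟨d - t * N, by ring⟩
    simp only [abs_shift anti]
    have h1 := @Sf_cases N p q v hp hpq hq a' (by omega) (by omega)
    have h2 := @Sf_cases N p q v hp hpq hq b' (by omega) (by omega)
    have h3 := @Sf_cases N p q v hp hpq hq c' (by omega) (by omega)
    have h4 := @Sf_cases N p q v hp hpq hq d' (by omega) (by omega)
    rcases h1 with h1 | h1 | h1 | h1 | h1 <;> rcases h2 with h2 | h2 | h2 | h2 | h2 <;>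
      first
      | omega
      | (rcases h3 with h3 | h3 | h3 | h3 | h3 <;>
          first
          | omega
          | (rcases h4 with h4 | h4 | h4 | h4 | h4 <;>
              first
              | omega
              | (simp only [h1.1, h2.1, h3.1, h4.1, sub_zero, zero_sub, abs_neg, sub_self, abs_zero,
                  sub_neg_eq_add, neg_zero, add_zero, zero_add, neg_add_cancel, a1, a2, a3, a4]; done)
              | (simp only [h1.1, h2.1, h3.1, h4.1, sub_zero, zero_sub, abs_neg, sub_self, abs_zero,
                  sub_neg_eq_add, neg_zero, add_zero, zero_add, neg_add_cancel, a1, a2, a3, a4]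
                 omega)))
  · intro a b hab hb
    obtain ⟨t, a', rfl, ha1, ha2⟩ := exists_shift hN a
    obtain ⟨b', rfl⟩ : ∃ b', b = b' + t * N := ⟨b - t * N, by ring⟩
    simp only [anti]
    have e1 := abs_shift anti t a' (a' + N)
    have e2 := abs_shift anti t b' (b' + N)
    have e3 := abs_shift anti t a' b'
    have e4 := abs_shift anti t b' (a' + N)
    have f : ∀ x, x + N + t * N = x + t * N + N := fun x => by ring
    rw [f, anti, anti] at e1 e2 e4
    rw [e1, e2, e3, e4]
    have h1 := @Sf_cases N p q v hp hpq hq a' (by omega) (by omega)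
    have h2 := @Sf_cases N p q v hp hpq hq b' (by omega) (by omega)
    rcases h1 with h1 | h1 | h1 | h1 | h1 <;> rcases h2 with h2 | h2 | h2 | h2 | h2 <;>
      first
      | omega
      | (simp only [h1.1, h2.1, sub_zero, zero_sub, abs_neg, sub_self, abs_zero,
          sub_neg_eq_add, neg_zero, add_zero, zero_add, neg_add_cancel, a1, a2, a3, a4]; done)
      | (simp only [h1.1, h2.1, sub_zero, zero_sub, abs_neg, sub_self, abs_zero,
          sub_neg_eq_add, neg_zero, add_zero, zero_add, neg_add_cancel, a1, a2, a3, a4]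
         omega)

theorem Mem.bd {k : Fin n} {a b c : ℤ} : ∀ {T : Tr n} {p q : ℤ}, T.valid p q → Mem k a b c T p q →
    p ≤ a ∧ a < b ∧ b < c ∧ c ≤ q := by
  intro T
  induction T with
  | leaf => intro p q _ h; exact h.elim
  | node j m l r ihl ihr =>
    intro p q hv h
    simp only [valid] at hv
    rcases h with h | h | h
    · omega
    · have := ihl hv.2.2.1 h; omega
    · have := ihr hv.2.2.2 h; omega

theorem Mem.label {k : Fin n} {a b c : ℤ} : ∀ {T : Tr n} {p q : ℤ}, Mem k a b c T p q →
    k ∈ T.labels := by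
  intro T
  induction T with
  | leaf => intro p q h; exact h.elim
  | node j m l r ihl ihr =>
    intro p q h
    simp only [labels, List.mem_cons, List.mem_append]
    rcases h with h | h | h
    · exact Or.inl h.1
    · exact Or.inr (Or.inl (ihl h))
    · exact Or.inr (Or.inr (ihr h))

theorem exists_mem {k : Fin n} : ∀ {T : Tr n} (p q : ℤ), k ∈ T.labels →
    ∃ a b c, Mem k a b c T p q := by
  intro T
  induction T with
  | leaf => intro p q h; simp [labels] at h
  | node j m l r ihl ihr =>
    intro p q h
    simp only [labels, List.mem_cons, List.mem_append] at h
    rcases h with h | h | h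
    · exact ⟨p, m, q, Or.inl ⟨h, rfl, rfl, rfl⟩⟩
    · obtain ⟨a, b, c, h⟩ := ihl p m h
      exact ⟨a, b, c, Or.inr (Or.inl h)⟩
    · obtain ⟨a, b, c, h⟩ := ihr m q h
      exact ⟨a, b, c, Or.inr (Or.inr h)⟩

theorem Mem.uniq {k : Fin n} {a b c a' b' c' : ℤ} : ∀ {T : Tr n} {p q : ℤ}, T.labels.Nodup →
    Mem k a b c T p q → Mem k a' b' c' T p q → a = a' ∧ b = b' ∧ c = c' := by
  intro T
  induction T with
  | leaf => intro p q _ h; exact h.elim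
  | node j m l r ihl ihr =>
    intro p q hn h h'
    simp only [labels, List.nodup_cons, List.nodup_append, List.mem_append, not_or] at hn
    rcases h with h | h | h <;> rcases h' with h' | h' | h'
    · omega
    · exact absurd (h.1 ▸ h'.label) hn.1.1
    · exact absurd (h.1 ▸ h'.label) hn.1.2
    · exact absurd (h'.1 ▸ h.label) hn.1.1
    · exact ihl hn.2.1 h h'
    · exact absurd rfl (hn.2.2.2 k h.label k h'.label)
    · exact absurd (h'.1 ▸ h.label) hn.1.2
    · exact absurd rfl (hn.2.2.2 k h'.label k h.label)
    · exact ihr hn.2.2.1 h h'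

theorem Mem.lam {i j : Fin n} {a b c a' b' c' : ℤ} (hij : i ≠ j) : ∀ {T : Tr n} {p q : ℤ},
    T.valid p q → Mem i a b c T p q → Mem j a' b' c' T p q →
    (a ≤ a' ∧ c' ≤ b) ∨ (b ≤ a' ∧ c' ≤ c) ∨ (a' ≤ a ∧ c ≤ b') ∨ (b' ≤ a ∧ c ≤ c') ∨
      c ≤ a' ∨ c' ≤ a := by
  intro T
  induction T with
  | leaf => intro p q _ h; exact h.elim
  | node k m l r ihl ihr =>
    intro p q hv h h'
    simp only [valid] at hv
    rcases h with h | h | h <;> rcases h' with h' | h' | h'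
    · exact absurd (h.1.trans h'.1.symm) hij
    · have := h'.bd hv.2.2.1; omega
    · have := h'.bd hv.2.2.2; omega
    · have := h.bd hv.2.2.1; omega
    · exact ihl hv.2.2.1 h h'
    · have := h.bd hv.2.2.1; have := h'.bd hv.2.2.2; omega
    · have := h.bd hv.2.2.2; omega
    · have := h'.bd hv.2.2.1; have := h.bd hv.2.2.2; omega
    · exact ihr hv.2.2.2 h h'

theorem mem_lca {a b : ℤ} (hab : a < b) : ∀ {T : Tr n} {p q : ℤ},
    T.valid p q → p < a → b ≤ q → ∃ k x y z, Mem k x y z T p q ∧ x < a ∧ a ≤ y ∧ y < b ∧ b ≤ z := by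
  intro T
  induction T with
  | leaf => intro p q h h1 h2; simp only [valid] at h; omega
  | node k m l r ihl ihr =>
    intro p q h h1 h2
    simp only [valid] at h
    by_cases e1 : b ≤ m
    · obtain ⟨k, x, y, z, hm, h'⟩ := ihl h.2.2.1 h1 e1
      exact ⟨k, x, y, z, Or.inr (Or.inl hm), h'⟩
    · by_cases e2 : m < a
      · obtain ⟨k, x, y, z, hm, h'⟩ := ihr h.2.2.2 e2 h2
        exact ⟨k, x, y, z, Or.inr (Or.inr hm), h'⟩
      · exact ⟨k, p, m, q, Or.inl ⟨rfl, rfl, rfl, rfl⟩, by omega⟩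

/-- Nested intervals with split points coming from a labelled tree. -/
structure Geo (N : ℤ) (p m q : Fin n → ℤ) (r : Fin n) : Prop where
  bd : ∀ i, 0 ≤ p i ∧ p i < m i ∧ m i < q i ∧ q i ≤ N
  lam : ∀ i j, i ≠ j → (p i ≤ p j ∧ q j ≤ m i) ∨ (m i ≤ p j ∧ q j ≤ q i) ∨
    (p j ≤ p i ∧ q i ≤ m j) ∨ (m j ≤ p i ∧ q i ≤ q j) ∨ q i ≤ p j ∨ q j ≤ p i
  lca : ∀ a b, 0 < a → a < b → b ≤ N → ∃ w, p w < a ∧ a ≤ m w ∧ m w < b ∧ b ≤ q w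
  root : p r = 0 ∧ q r = N

theorem R_const {s : ℤ → ℤ} {u v : ℤ} (j : Fin n) : ∀ {T : Tr n} {p q : ℤ}, T.valid p q →
    s p = u → (∀ a, p < a → a ≤ q → s a = v) →
    R (yC s) T p q j = if T.lab = some j then |u - v| else 0 := by
  intro T
  induction T generalizing u with
  | leaf => intros; simp [R, lab]
  | node k m l r ihl ihr =>
    intro p q h hu hv
    simp only [valid] at h
    have hm := hv m h.1 h.2.1.le
    have hq := hv q (by omega) le_rfl
    rw [R, ihl h.2.2.1 hu (fun a h1 h2 => hv a h1 (by omega)),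
      ihr h.2.2.2 hm (fun a h1 h2 => hv a (by omega) h2)]
    simp only [yC, hu, hm, hq, lab_node, Option.some.injEq, sub_self, abs_zero]
    split_ifs <;> ring

theorem R_ind {s : ℤ → ℤ} {i : Fin n} {pi mi qi : ℤ} (j : Fin n) : ∀ {T : Tr n} {p q : ℤ},
    T.valid p q → T.labels.Nodup → Mem i pi mi qi T p q → s p = 0 →
    (∀ a, p < a → a ≤ q → s a = if pi < a ∧ a ≤ qi then 2 else 0) →
    R (yC s) T p q j = (if i = j then 4 else 0) - (if qi = q ∧ T.lab = some j then 2 else 0) := by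
  intro T
  induction T with
  | leaf => intro p q _ _ h; exact h.elim
  | node k m l r ihl ihr =>
    intro p q hv hn hM h0 hs
    have hv0 := hv
    simp only [valid] at hv
    simp only [labels, List.nodup_cons, List.nodup_append, List.mem_append, not_or] at hn
    have hsm := hs m hv.1 hv.2.1.le
    have hsq := hs q (by omega) le_rfl
    rcases hM with ⟨rfl, rfl, rfl, rfl⟩ | hM | hM
    · rw [R_const j hv0 h0 (v := 2) (fun a h1 h2 => by rw [hs a h1 h2, if_pos ⟨h1, h2⟩])]
      simp only [lab_node, Option.some.injEq, true_and]
      split_ifs <;> simp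
    · have hb := hM.bd hv.2.2.1
      have hq1 : ¬ (pi < q ∧ q ≤ qi) := by omega
      rw [if_neg hq1] at hsq
      have hq2 : ¬ (qi = q) := by omega
      rw [R, ihl hv.2.2.1 hn.2.1 hM h0 (fun a h1 h2 => hs a h1 (by omega)),
        R_const (v := 0) j hv.2.2.2 hsm (fun a h1 h2 => by
          rw [hs a (by omega) h2, if_neg (by omega)])]
      by_cases e : qi = m
      · have e' : pi < m ∧ m ≤ qi := by omega
        rw [if_pos e'] at hsm ⊢
        have e3 : ¬ m = q := by omega
        simp only [yC, h0, hsm, hsq, lab_node, Option.some.injEq, e, e3, and_self, ↓reduceIte, true_and, false_and, sub_zero, zero_sub, abs_neg, neg_zero,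
          abs_zero]
        split_ifs <;> norm_num
      · have e' : ¬ (pi < m ∧ m ≤ qi) := by omega
        rw [if_neg e'] at hsm ⊢
        simp only [yC, h0, hsm, hsq, lab_node, Option.some.injEq, e, hq2, false_and, ↓reduceIte]
        simp
    · have hb := hM.bd hv.2.2.2
      have hm1 : ¬ (pi < m ∧ m ≤ qi) := by omega
      rw [if_neg hm1] at hsm
      rw [R, ihr hv.2.2.2 hn.2.2.1 hM hsm (fun a h1 h2 => hs a (by omega) h2),
        R_const (v := 0) j hv.2.2.1 h0 (fun a h1 h2 => by
          rw [hs a (by omega) (by omega), if_neg (by omega)])]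
      by_cases e : qi = q
      · have e' : pi < q ∧ q ≤ qi := by omega
        rw [if_pos e'] at hsq
        have e3 : ¬ m = q := by omega
        simp only [yC, h0, hsm, hsq, lab_node, Option.some.injEq, e, e3, and_self, ↓reduceIte, true_and, false_and, sub_zero, zero_sub, abs_neg, neg_zero,
          abs_zero]
        split_ifs <;> norm_num
      · have e' : ¬ (pi < q ∧ q ≤ qi) := by omega
        rw [if_neg e'] at hsq
        simp only [yC, h0, hsm, hsq, lab_node, Option.some.injEq, e, false_and, ↓reduceIte]
        simp

theorem exists_geo (hn : 2 ≤ n) {B : Matrix (Fin n) (Fin n) ℤ} {T : Tr n}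
    (hT : RepB (n + 1) B T 0) : ∃ p m q r, Geo (n + 1) p m q r ∧
      Rep (n + 1) (fun i => Sf (n + 1) (p i) (q i) (if i = r then 1 else 2)) (extMat B) T 0 := by
  obtain ⟨N, hN⟩ : ∃ N : ℤ, (n : ℤ) + 1 = N := ⟨_, rfl⟩
  rw [hN] at hT ⊢
  obtain ⟨⟨hv, hnd, hall⟩, htop⟩ := hT
  choose p m q hM using fun i => exists_mem 0 (0 + N) (hall i)
  have hok : Ok N T 0 := ⟨hv, hnd, hall⟩
  cases T with
  | leaf => exact absurd (hall ⟨0, by omega⟩) (by simp [labels])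
  | node r m0 l rr =>
  have hr : p r = 0 ∧ m r = m0 ∧ q r = 0 + N :=
    (hM r).uniq hnd (Or.inl ⟨rfl, rfl, rfl, rfl⟩)
  have hNpos : 0 < N := by omega
  refine ⟨p, m, q, r, ⟨?_, ?_, ?_, ?_⟩, hok, ?_, ?_⟩
  · intro i
    have := (hM i).bd hv
    omega
  · intro i j hij
    exact (hM i).lam hij hv (hM j)
  · intro a b h1 h2 h3
    obtain ⟨k, x, y, z, hm, h'⟩ := mem_lca h2 hv h1 (by omega)
    obtain ⟨rfl, rfl, rfl⟩ := hm.uniq hnd (hM k)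
    exact ⟨k, h'⟩
  · omega
  · intro i j
    exact htop i j
  · intro i j
    have hlhs : 4 * extMat B (Sum.inr i) j = if i = j then 4 else 0 := by
      show 4 * (if i = j then (1 : ℤ) else 0) = _
      split_ifs <;> simp
    rw [hlhs]
    have hi := (hM i).bd hv
    simp only [valid] at hv
    set s := Sf N (p i) (q i) (if i = r then 1 else 2) with hs
    have hs0 : s 0 = - s N := by
      have := Sf_anti hNpos (p i) (q i) (if i = r then 1 else 2) 0
      rw [zero_add] at this
      rw [hs, this]; ring
    have hsv : ∀ a, 0 < a → a ≤ 0 + N → s a = if p i < a ∧ a ≤ q i then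
        (if i = r then 1 else 2) else 0 :=
      fun a h1 h2 => Sf_eq _ _ _ h1 (by omega)
    have hlabn : (node r m0 l rr).lab = some r := rfl
    by_cases hir : i = r
    · subst hir
      simp only [↓reduceIte] at hsv
      have h1 : ∀ a, 0 < a → a ≤ 0 + N → s a = 1 := fun a h1 h2 => by
        rw [hsv a h1 h2, if_pos (by omega)]
      rw [row, R_const j hok.valid (hs0.trans (by rw [h1 N hNpos (by omega)])) h1]
      simp only [w, hlabn, Option.some.injEq]
      split_ifs <;> rfl
    · simp only [hir, ↓reduceIte] at hsv
      have hw : (node r m0 l rr).w j = if r = j then 2 else 1 := by simp [w, hlabn]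
      by_cases hq : q i = N
      · have hsN : s N = 2 := by rw [hsv N hNpos (by omega), if_pos (by omega)]
        rw [hsN] at hs0
        rcases hM i with h | h | h
        · exact absurd h.1 hir
        · have := h.bd hv.2.2.1
          omega
        · have hb := h.bd hv.2.2.2
          have hsm : s m0 = 0 := by rw [hsv m0 hv.1 (by omega), if_neg (by omega)]
          have hnd' := hnd
          simp only [labels, List.nodup_cons, List.nodup_append, List.mem_append, not_or] at hnd'
          rw [row, R, hw, R_const (v := 0) j hv.2.2.1 hs0 (fun a h1 h2 => by
              rw [hsv a (by omega) (by omega), if_neg (by omega)]),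
            R_ind j hv.2.2.2 hnd'.2.2.1 h hsm (fun a h1 h2 => hsv a (by omega) h2)]
          have hq' : q i = 0 + N := by omega
          simp only [yC, hs0, hsm, zero_add, hsN, hq, true_and]
          norm_num
          by_cases e1 : r = j
          · subst e1
            have f1 : rr.lab ≠ some r := fun e => hnd'.1.2 (lab_mem e)
            have f2 : l.lab ≠ some r := fun e => hnd'.1.1 (lab_mem e)
            simp [hir, f1, f2]
          · simp only [e1, ↓reduceIte]
            split_ifs <;> simp
      · have hsN : s N = 0 := by rw [hsv N hNpos (by omega), if_neg (by omega)]
        rw [row, R_ind j hok.valid hnd (hM i) (by rw [hs0, hsN]; rfl) hsv, hw]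
        have hq' : ¬ (q i = 0 + N) := by omega
        simp only [hq', false_and, ↓reduceIte]
        by_cases e1 : r = j
        · subst e1; simp [hir]
        · simp [e1]

end Tr

/-! ## Columns of coefficient matrices -/

namespace Tr

variable {n : ℕ}

/-- Ancestor indicator. -/
def An (p m q : Fin n → ℤ) (i u : Fin n) : ℤ := if p i < m u ∧ m u < q i then 1 else 0

/-- First family of positive vectors. -/
def G1 (p m q : Fin n → ℤ) (u v : Fin n) (i : Fin n) : ℤ := |An p m q i u - An p m q i v|

/-- Second family of positive vectors. -/
def G2 (p m q : Fin n → ℤ) (r u v : Fin n) (i : Fin n) : ℤ :=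
  if i = r then 1 else An p m q i u + An p m q i v

/-- Weights. -/
def hh (p m q : Fin n → ℤ) (r i w : Fin n) : ℤ := if i = r then 2 else 4 * An p m q i w

/-- The coefficient functions. -/
def SS (N : ℤ) (p q : Fin n → ℤ) (r i : Fin n) : ℤ → ℤ := Sf N (p i) (q i) (if i = r then 1 else 2)

/-- The alternating sum of lengths. -/
def QQ (s : ℤ → ℤ) (a b c d : ℤ) : ℤ := |s a - s b| + |s c - s d| - |s b - s c| - |s a - s d|

section

variable {N : ℤ} {p m q : Fin n → ℤ} {r : Fin n}

theorem Geo.An_eq (g : Geo N p m q r) {w : Fin n} {x y : ℤ} (h1 : p w < x) (h2 : x ≤ m w)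
    (h3 : m w < y) (h4 : y ≤ q w) (i : Fin n) :
    An p m q i w = if p i < x ∧ y ≤ q i then 1 else 0 := by
  unfold An
  by_cases e : i = w
  · subst e
    rw [if_pos (by omega), if_pos (by omega)]
  · have := g.lam i w e
    have := g.bd i
    have := g.bd w
    split_ifs <;> omega

theorem Geo.Npos (g : Geo N p m q r) : 0 < N := by
  have := g.bd r
  omega

theorem Geo.An_root (g : Geo N p m q r) (u : Fin n) : An p m q r u = 1 := by
  unfold An
  have := g.bd u
  have := g.root
  rw [if_pos (by omega)]

theorem Geo.same (g : Geo N p m q r) {w : Fin n} {x y : ℤ} (h1 : p w < x) (h2 : x ≤ m w)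
    (h3 : m w < y) (h4 : y ≤ q w) (i : Fin n) :
    |SS N p q r i x - SS N p q r i y| = |SS N p q r i x| + |SS N p q r i y| - hh p m q r i w := by
  have hw := g.bd w
  have hi := g.bd i
  unfold SS hh
  rw [Sf_eq _ _ _ (by omega : 0 < x) (by omega), Sf_eq _ _ _ (by omega : 0 < y) (by omega),
    g.An_eq h1 h2 h3 h4]
  have hr := g.root
  by_cases e : i = r
  · subst e
    have hx : p i < x ∧ x ≤ q i := by omega
    have hy : p i < y ∧ y ≤ q i := by omega
    simp [hx, hy]
  · simp only [e, ↓reduceIte]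
    split_ifs <;> first | omega | simp

theorem Geo.anti (g : Geo N p m q r) (i : Fin n) (x : ℤ) :
    SS N p q r i (x + N) = - SS N p q r i x := Sf_anti g.Npos _ _ _ _

theorem Geo.good (g : Geo N p m q r) (i : Fin n) : GoodS N (SS N p q r i) := by
  have := g.bd i
  unfold SS
  apply Sf_good <;> omega

theorem Geo.same' (g : Geo N p m q r) {w : Fin n} {x y : ℤ} (h1 : p w < x - N) (h2 : x - N ≤ m w)
    (h3 : m w < y - N) (h4 : y - N ≤ q w) (i : Fin n) :
    |SS N p q r i x - SS N p q r i y| = |SS N p q r i x| + |SS N p q r i y| - hh p m q r i w := by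
  have := g.same h1 h2 h3 h4 i
  have e1 := g.anti i (x - N)
  have e2 := g.anti i (y - N)
  rw [sub_add_cancel] at e1 e2
  rw [e1, e2, abs_neg, abs_neg, ← this, ← abs_neg]
  congr 1; ring

theorem Geo.cross (g : Geo N p m q r) {x y : ℤ} (h1 : 0 < x) (h2 : x ≤ N)
    (h3 : N < y) (h4 : y ≤ 2 * N) (i : Fin n) :
    |SS N p q r i x - SS N p q r i y| = |SS N p q r i x| + |SS N p q r i y| := by
  have e2 := g.anti i (y - N)
  rw [sub_add_cancel] at e2
  have n1 : 0 ≤ SS N p q r i x := by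
    unfold SS; rw [Sf_eq _ _ _ h1 h2]; split_ifs <;> norm_num
  have n2 : 0 ≤ SS N p q r i (y - N) := by
    unfold SS; rw [Sf_eq _ _ _ (by omega) (by omega)]; split_ifs <;> norm_num
  rw [e2, abs_neg, abs_of_nonneg n1, abs_of_nonneg n2, abs_of_nonneg (by omega)]
  ring

/-- Two families of vectors, up to sign. -/
def InX (p m q : Fin n → ℤ) (r : Fin n) (Q : Fin n → ℤ) : Prop :=
  ∃ u v : Fin n, (∀ i, Q i = 4 * G2 p m q r u v i) ∨ (∀ i, Q i = -(4 * G2 p m q r u v i)) ∨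
    (u ≠ v ∧ ∀ i, Q i = 4 * G1 p m q u v i) ∨ (u ≠ v ∧ ∀ i, Q i = -(4 * G1 p m q u v i))

theorem InX.neg {Q Q' : Fin n → ℤ} (h : InX p m q r Q) (hQ : ∀ i, Q' i = - Q i) :
    InX p m q r Q' := by
  obtain ⟨u, v, h | h | ⟨h0, h⟩ | ⟨h0, h⟩⟩ := h
  · exact ⟨u, v, Or.inr (Or.inl fun i => by rw [hQ, h])⟩
  · exact ⟨u, v, Or.inl fun i => by rw [hQ, h]; ring⟩
  · exact ⟨u, v, Or.inr (Or.inr (Or.inr ⟨h0, fun i => by rw [hQ, h]⟩))⟩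
  · exact ⟨u, v, Or.inr (Or.inr (Or.inl ⟨h0, fun i => by rw [hQ, h]; ring⟩))⟩

/-- `h_v - h_u` when `u` and `v` are consecutive splits. -/
theorem Geo.inX_sub (g : Geo N p m q r) {u v : Fin n} {a b c : ℤ}
    (hu : p u < a ∧ a ≤ m u ∧ m u < b ∧ b ≤ q u) (hv : p v < b ∧ b ≤ m v ∧ m v < c ∧ c ≤ q v)
    (Q : Fin n → ℤ) (hQ : ∀ i, Q i = hh p m q r i v - hh p m q r i u) :
    InX p m q r Q := by
  have bu := g.bd u
  have bv := g.bd v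
  have huv : u ≠ v := by rintro rfl; omega
  obtain ⟨w, hw1, hw2, hw3, hw4⟩ := g.lca a c (by omega) (by omega) (by omega)
  have e1 := g.An_eq hu.1 hu.2.1 hu.2.2.1 hu.2.2.2
  have e2 := g.An_eq hv.1 hv.2.1 hv.2.2.1 hv.2.2.2
  refine ⟨u, v, ?_⟩
  by_cases hb : m w < b
  · have e3 := g.An_eq hw1 hw2 hw3 hw4
    have e4 := g.An_eq hw1 hw2 hb (by omega)
    have key : ∀ i, An p m q i u ≤ An p m q i v := by
      intro i
      rw [e1, ← e4, e3, e2]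
      split_ifs <;> omega
    refine Or.inr (Or.inr (Or.inl ⟨huv, fun i => ?_⟩))
    rw [hQ, G1, abs_of_nonpos (by have := key i; omega), hh, hh]
    by_cases hi : i = r
    · subst hi; simp [g.An_root]
    · simp only [hi, ↓reduceIte]; ring
  · have e3 := g.An_eq hw1 hw2 hw3 hw4
    have e4 := g.An_eq (by omega) (by omega : b ≤ m w) hw3 hw4
    have key : ∀ i, An p m q i v ≤ An p m q i u := by
      intro i
      rw [e2, ← e4, e3, e1]
      split_ifs <;> omega
    refine Or.inr (Or.inr (Or.inr ⟨huv, fun i => ?_⟩))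
    rw [hQ, G1, abs_of_nonneg (by have := key i; omega), hh, hh]
    by_cases hi : i = r
    · subst hi; simp [g.An_root]
    · simp only [hi, ↓reduceIte]; ring

theorem Geo.inX_add (g : Geo N p m q r) (u v : Fin n) (Q : Fin n → ℤ)
    (hQ : ∀ i, Q i = -hh p m q r i u - hh p m q r i v) : InX p m q r Q := by
  refine ⟨u, v, Or.inr (Or.inl fun i => ?_)⟩
  rw [hQ, hh, hh, G2]
  split_ifs <;> ring

/-- `2 h_w - h_u - h_v` when `w` separates `u` from `v`. -/
theorem Geo.path_eq (g : Geo N p m q r) {u v w : Fin n} {a b c d : ℤ} (hbc : b ≤ c)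
    (hu : p u < a ∧ a ≤ m u ∧ m u < b ∧ b ≤ q u) (hv : p v < c ∧ c ≤ m v ∧ m v < d ∧ d ≤ q v)
    (hw : p w < a ∧ b ≤ m w ∧ m w < c ∧ d ≤ q w) (i : Fin n) :
    2 * hh p m q r i w - hh p m q r i u - hh p m q r i v = -(4 * G1 p m q u v i) := by
  have e1 := g.An_eq hu.1 hu.2.1 hu.2.2.1 hu.2.2.2 i
  have e2 := g.An_eq hv.1 hv.2.1 hv.2.2.1 hv.2.2.2 i
  have e3 := g.An_eq hw.1 (by omega) (by omega) hw.2.2.2 i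
  have e4 := g.An_eq (w := w) (x := b) (y := c) (by omega) hw.2.1 hw.2.2.1 (by omega) i
  rw [hh, hh, hh, G1]
  by_cases hi : i = r
  · subst hi; simp [g.An_root]
  · simp only [hi, ↓reduceIte]
    rw [e1, e2, e3]
    rw [e3] at e4
    split_ifs at e4 ⊢ <;> first | omega | norm_num

theorem Geo.inX_quad (g : Geo N p m q r) {a b c d : ℤ} (hab : a < b) (hbc : b < c) (hcd : c < d)
    (hda : d ≤ a + N) : InX p m q r (fun i => QQ (SS N p q r i) a b c d) := by
  have hN := g.Npos
  obtain ⟨t, a', rfl, ha1, ha2⟩ := exists_shift hN a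
  obtain ⟨b', rfl⟩ : ∃ b', b = b' + t * N := ⟨b - t * N, by ring⟩
  obtain ⟨c', rfl⟩ : ∃ c', c = c' + t * N := ⟨c - t * N, by ring⟩
  obtain ⟨d', rfl⟩ : ∃ d', d = d' + t * N := ⟨d - t * N, by ring⟩
  simp only [QQ, abs_shift (g.anti _)]
  by_cases hd : d' ≤ N
  · obtain ⟨u1, h1⟩ := g.lca a' b' (by omega) (by omega) (by omega)
    obtain ⟨u2, h2⟩ := g.lca b' c' (by omega) (by omega) (by omega)
    obtain ⟨u3, h3⟩ := g.lca c' d' (by omega) (by omega) (by omega)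
    obtain ⟨w, h4⟩ := g.lca a' d' (by omega) (by omega) (by omega)
    have f1 := g.same h1.1 h1.2.1 h1.2.2.1 h1.2.2.2
    have f2 := g.same h2.1 h2.2.1 h2.2.2.1 h2.2.2.2
    have f3 := g.same h3.1 h3.2.1 h3.2.2.1 h3.2.2.2
    have f4 := g.same h4.1 h4.2.1 h4.2.2.1 h4.2.2.2
    by_cases c1 : m w < b'
    · have f5 : ∀ i, hh p m q r i w = hh p m q r i u1 := fun i => by
        have e1 := g.An_eq h1.1 h1.2.1 h1.2.2.1 h1.2.2.2 i
        have e2 := g.An_eq (w := w) h4.1 h4.2.1 c1 (by omega) i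
        rw [hh, hh, e1, e2]
      refine InX.neg (g.inX_sub h2 h3 (fun i => hh p m q r i u3 - hh p m q r i u2)
        (fun i => rfl)) (fun i => ?_)
      rw [f1, f2, f3, f4, f5]; ring
    · by_cases c2 : m w < c'
      · have f5 : ∀ i, hh p m q r i w = hh p m q r i u2 := fun i => by
          have e1 := g.An_eq h2.1 h2.2.1 h2.2.2.1 h2.2.2.2 i
          have e2 := g.An_eq (w := w) (x := b') (y := c') (by omega) (by omega) c2 (by omega) i
          rw [hh, hh, e1, e2]
        refine ⟨u1, u3, Or.inr (Or.inr (Or.inr ⟨by rintro rfl; omega, fun i => ?_⟩))⟩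
        dsimp only
        rw [← g.path_eq (w := w) (u := u1) (v := u3) (a := a') (b := b') (c := c') (d := d') (by omega) h1 h3 (by omega)]
        rw [f1, f2, f3, f4, ← f5]; ring
      · have f5 : ∀ i, hh p m q r i w = hh p m q r i u3 := fun i => by
          have e1 := g.An_eq h3.1 h3.2.1 h3.2.2.1 h3.2.2.2 i
          have e2 := g.An_eq (w := w) (x := c') (y := d') (by omega) (by omega) (by omega) (by omega) i
          rw [hh, hh, e1, e2]
        refine g.inX_sub h1 h2 _ (fun i => ?_)
        rw [f1, f2, f3, f4, f5]; ring
  by_cases hc : c' ≤ N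
  · obtain ⟨u1, h1⟩ := g.lca a' b' (by omega) (by omega) (by omega)
    obtain ⟨u2, h2⟩ := g.lca b' c' (by omega) (by omega) (by omega)
    have f1 := g.same h1.1 h1.2.1 h1.2.2.1 h1.2.2.2
    have f2 := g.same h2.1 h2.2.1 h2.2.2.1 h2.2.2.2
    have f3 := g.cross (x := c') (y := d') (by omega) (by omega) (by omega) (by omega)
    have f4 := g.cross (x := a') (y := d') (by omega) (by omega) (by omega) (by omega)
    refine g.inX_sub h1 h2 _ (fun i => ?_)
    rw [f1, f2, f3, f4]; ring
  by_cases hb : b' ≤ N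
  · obtain ⟨u1, h1⟩ := g.lca a' b' (by omega) (by omega) (by omega)
    obtain ⟨u3, h3⟩ := g.lca (c' - N) (d' - N) (by omega) (by omega) (by omega)
    have f1 := g.same h1.1 h1.2.1 h1.2.2.1 h1.2.2.2
    have f3 := g.same' h3.1 h3.2.1 h3.2.2.1 h3.2.2.2
    have f2 := g.cross (x := b') (y := c') (by omega) (by omega) (by omega) (by omega)
    have f4 := g.cross (x := a') (y := d') (by omega) (by omega) (by omega) (by omega)
    refine g.inX_add u1 u3 _ (fun i => ?_)
    rw [f1, f2, f3, f4]; ring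
  · obtain ⟨u2, h2⟩ := g.lca (b' - N) (c' - N) (by omega) (by omega) (by omega)
    obtain ⟨u3, h3⟩ := g.lca (c' - N) (d' - N) (by omega) (by omega) (by omega)
    have f2 := g.same' h2.1 h2.2.1 h2.2.2.1 h2.2.2.2
    have f3 := g.same' h3.1 h3.2.1 h3.2.2.1 h3.2.2.2
    have f1 := g.cross (x := a') (y := b') (by omega) (by omega) (by omega) (by omega)
    have f4 := g.cross (x := a') (y := d') (by omega) (by omega) (by omega) (by omega)
    refine InX.neg (g.inX_sub h2 h3 (fun i => hh p m q r i u3 - hh p m q r i u2)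
      (fun i => rfl)) (fun i => ?_)
    rw [f1, f2, f3, f4]; ring

theorem Geo.inX_root (g : Geo N p m q r) {z x : ℤ} (h1 : z < x) (h2 : x < z + N) :
    InX p m q r (fun i => 2 * (|SS N p q r i z - SS N p q r i x| -
      |SS N p q r i x - SS N p q r i (z + N)|)) := by
  have hN := g.Npos
  obtain ⟨t, a', rfl, ha1, ha2⟩ := exists_shift hN z
  obtain ⟨b', rfl⟩ : ∃ b', x = b' + t * N := ⟨x - t * N, by ring⟩
  have e : a' + t * N + N = (a' + N) + t * N := by ring
  simp only [e, abs_shift (g.anti _)]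
  by_cases hb : b' ≤ N
  · obtain ⟨u, h⟩ := g.lca a' b' (by omega) (by omega) (by omega)
    have f1 := g.same h.1 h.2.1 h.2.2.1 h.2.2.2
    have f2 := g.cross (x := b') (y := a' + N) (by omega) (by omega) (by omega) (by omega)
    refine g.inX_add u u _ (fun i => ?_)
    rw [f1, f2, g.anti, abs_neg]; ring
  · obtain ⟨u, h⟩ := g.lca (b' - N) (a' + N - N) (by omega) (by omega) (by omega)
    have f1 := g.same' h.1 h.2.1 h.2.2.1 h.2.2.2
    have f2 := g.cross (x := a') (y := b') (by omega) (by omega) (by omega) (by omega)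
    refine InX.neg (g.inX_add u u (fun i => -hh p m q r i u - hh p m q r i u) (fun i => rfl))
      (fun i => ?_)
    rw [f1, f2, g.anti, abs_neg]; ring

end

theorem Rot.col {N : ℤ} {k : Fin n} {T T' : Tr n} {z : ℤ} (h0 : Ok N T z) (h : Rot k T T') :
    ∃ a b c d, a < b ∧ b < c ∧ c < d ∧ d ≤ a + N ∧ ∀ s, row (yC s) T z (z + N) k = QQ s a b c d ∧
      row (yC s) T' z (z + N) k = - QQ s a b c d := by
  have hlab := h.lab_eq
  have hk := h.lab_ne h0.nodup
  have hwk : T.w k = 1 := by simp [w, hk]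
  have hwk' : T'.w k = 1 := by simp [w, hk, hlab]
  obtain ⟨a, b, c, d, lA, lB, lC, j0, h1, h2, h3, h4, h5, h6, rest, h7, h8, h9⟩ :=
    h.normal z (z + N) h0.valid h0.nodup
  obtain ⟨d1, d2, d3, d4, d5, d6, d7, d8, d9, d10⟩ := h6
  refine ⟨a, b, c, d, h2, h3, h4, by omega, fun s => ⟨?_, ?_⟩⟩
  · rw [row, (h9 _ _).1, h7, hwk]
    simp only [loc, d2, d3, d4, Ne.symm d1, yC, QQ, ↓reduceIte]
    ring
  · rw [row, (h9 _ _).2, h7, hwk']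
    simp only [loc', d2, d3, d4, Ne.symm d1, yC, QQ, ↓reduceIte]
    ring

theorem row_root (s : ℤ → ℤ) {k : Fin n} {x z z' : ℤ} {l r : Tr n}
    (hn : (node k x l r).labels.Nodup) :
    row (yC s) (node k x l r) z z' k = 2 * (|s z - s x| - |s x - s z'|) := by
  simp only [labels, List.nodup_cons, List.nodup_append, List.mem_append, not_or] at hn
  have hkl : k ∉ l.labels := hn.1.1
  have hkr : k ∉ r.labels := hn.1.2
  have hkl' : l.lab ≠ some k := fun e => hkl (lab_mem e)
  have hkr' : r.lab ≠ some k := fun e => hkr (lab_mem e)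
  rw [row, R, R_col_zero _ l _ _ hkl, R_col_zero _ r _ _ hkr]
  simp only [w, lab_node, hkl', hkr', yC, ↓reduceIte]
  ring

theorem Geo.inX_row {N : ℤ} {p m q : Fin n → ℤ} {r : Fin n} (g : Geo N p m q r) {T : Tr n} {z : ℤ}
    (h0 : Ok N T z) (k : Fin n) : InX p m q r (fun i => row (yC (SS N p q r i)) T z (z + N) k) := by
  by_cases e : T.lab = some k
  · cases T with
    | leaf => simp [lab] at e
    | node k' x l rr =>
      simp only [lab, Option.some.injEq] at e
      subst e
      have hv := h0.valid
      simp only [valid] at hv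
      simp only [row_root _ h0.nodup]
      exact g.inX_root hv.1 hv.2.1
  · obtain ⟨T', h | h⟩ := exists_rot T (h0.all k) e
    · obtain ⟨a, b, c, d, h1, h2, h3, h4, h5⟩ := h.col h0
      simp only [(h5 _).1]
      exact g.inX_quad h1 h2 h3 h4
    · obtain ⟨a, b, c, d, h1, h2, h3, h4, h5⟩ := h.col (h0.of_rot_symm h)
      exact (g.inX_quad h1 h2 h3 h4).neg (fun i => (h5 _).2)

end Tr

/-! ## Reaching prescribed triangles -/

namespace Tr

variable {n : ℕ}

/-- Some seed of the pattern is realized by the tree `T`. -/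
def Reach (B : Matrix (Fin n) (Fin n) ℤ) (N : ℤ) (S : Fin n → ℤ → ℤ) (T : Tr n) (z : ℤ) : Prop :=
  ∃ b, IsExtMat B b ∧ Rep N S b T z

/-- One rotation, in either direction. -/
def RS (T T' : Tr n) : Prop := ∃ k, Rot k T T' ∨ Rot k T' T

theorem RS.inl {j : Fin n} {m : ℤ} {r T T' : Tr n} (h : Relation.ReflTransGen RS T T') :
    Relation.ReflTransGen RS (node j m T r) (node j m T' r) := by
  induction h with
  | refl => exact .refl
  | tail _ h ih =>
    obtain ⟨k, h | h⟩ := h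
    · exact ih.tail ⟨k, Or.inl (Rot.inl _ _ _ _ _ h)⟩
    · exact ih.tail ⟨k, Or.inr (Rot.inl _ _ _ _ _ h)⟩

theorem RS.inr {j : Fin n} {m : ℤ} {l T T' : Tr n} (h : Relation.ReflTransGen RS T T') :
    Relation.ReflTransGen RS (node j m l T) (node j m l T') := by
  induction h with
  | refl => exact .refl
  | tail _ h ih =>
    obtain ⟨k, h | h⟩ := h
    · exact ih.tail ⟨k, Or.inl (Rot.inr _ _ _ _ _ h)⟩
    · exact ih.tail ⟨k, Or.inr (Rot.inr _ _ _ _ _ h)⟩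

theorem exists_split {x : ℤ} : ∀ (T : Tr n) (p q : ℤ), T.valid p q → p < x → x < q →
    ∃ k l r, Relation.ReflTransGen RS T (node k x l r) := by
  intro T
  induction T with
  | leaf => intro p q h h1 h2; simp only [valid] at h; omega
  | node j m l r ihl ihr =>
    intro p q h h1 h2
    simp only [valid] at h
    obtain ⟨_, _, hl, hr⟩ := h
    rcases lt_trichotomy x m with e | e | e
    · obtain ⟨k, A, C, hh⟩ := ihl p m hl h1 e
      exact ⟨_, _, _, (RS.inl hh).tail ⟨k, Or.inl (Rot.base _ _ _ _ _ _)⟩⟩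
    · subst e; exact ⟨_, _, _, .refl⟩
    · obtain ⟨k, A, C, hh⟩ := ihr m q hr e h2
      exact ⟨_, _, _, (RS.inr hh).tail ⟨k, Or.inr (Rot.base _ _ _ _ _ _)⟩⟩

section

variable {B : Matrix (Fin n) (Fin n) ℤ} {N : ℤ} {S : Fin n → ℤ → ℤ}

theorem Reach.step (hS : ∀ i, GoodS N (S i)) {T T' : Tr n} {z z' : ℤ} {k : Fin n}
    (h : Reach B N S T z) (hs : Step N k T z T' z') : Reach B N S T' z' := by
  obtain ⟨b, h1, h2⟩ := h
  exact ⟨_, h1.tail ⟨k, rfl⟩, h2.step hS hs⟩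

theorem Reach.rs (hS : ∀ i, GoodS N (S i)) {T T' : Tr n} {z : ℤ}
    (h : Reach B N S T z) (hs : Relation.ReflTransGen RS T T') : Reach B N S T' z := by
  induction hs with
  | refl => exact h
  | tail _ hr ih =>
    obtain ⟨b, h1, h2⟩ := ih
    obtain ⟨k, hr | hr⟩ := hr
    · exact Reach.step hS ⟨b, h1, h2⟩ (hr.step h2.ok)
    · exact Reach.step hS ⟨b, h1, h2⟩ (hr.step_symm h2.ok)

theorem Reach.split (hS : ∀ i, GoodS N (S i)) {T : Tr n} {z x : ℤ}
    (h : Reach B N S T z) (h1 : z < x) (h2 : x < z + N) :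
    ∃ k l r, Reach B N S (node k x l r) z := by
  obtain ⟨k, l, r, hh⟩ := exists_split T z (z + N) (by obtain ⟨b, _, h⟩ := h; exact h.ok.valid) h1 h2
  exact ⟨k, l, r, h.rs hS hh⟩

theorem Reach.all (hS : ∀ i, GoodS N (S i)) (hN : 2 ≤ N) {T : Tr n}
    (h : Reach B N S T 0) (z : ℕ) : ∃ T, Reach B N S T z := by
  induction z with
  | zero => exact ⟨T, h⟩
  | succ z ih =>
    obtain ⟨T, ih⟩ := ih
    obtain ⟨k, l, r, b, h1, h2⟩ := ih.split hS (x := z + 1) (by omega) (by omega)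
    push_cast
    exact ⟨_, Reach.step hS ⟨b, h1, h2⟩ (swap_step h2.ok)⟩

theorem R_quad (y : Option (Fin n) → ℤ → ℤ → ℤ) {j k : Fin n} {a b c d : ℤ} {A D C : Tr n}
    (hn : (node j c (node k b A D) C).labels.Nodup) :
    R y (node j c (node k b A D) C) a d k =
      y D.lab b c - y A.lab a b + y (some j) a d - y C.lab c d := by
  simp only [labels, List.nodup_cons, List.nodup_append, List.mem_append, List.mem_cons,
    not_or] at hn
  obtain ⟨⟨⟨hjk, _, _⟩, _⟩, ⟨⟨hA, hD⟩, _⟩, _, hC⟩ := hn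
  have hC : k ∉ C.labels := fun h => hC k (Or.inl rfl) k h rfl
  have hA' : A.lab ≠ some k := fun e => hA (lab_mem e)
  have hD' : D.lab ≠ some k := fun e => hD (lab_mem e)
  have hC' : C.lab ≠ some k := fun e => hC (lab_mem e)
  simp only [R, R_col_zero _ A _ _ hA, R_col_zero _ D _ _ hD, R_col_zero _ C _ _ hC, lab_node, hA',
    hD', hC', hjk, ↓reduceIte]
  ring

/-- Vectors realized as four times a column of some coefficient matrix. -/
def Col (B : Matrix (Fin n) (Fin n) ℤ) (Q : Fin n → ℤ) : Prop :=
  ∃ b, IsExtMat B b ∧ ∃ k, ∀ i, 4 * b (Sum.inr i) k = Q i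

theorem Reach.quad (hS : ∀ i, GoodS N (S i)) {T : Tr n} {a b c d : ℤ} (h : Reach B N S T a)
    (hab : a < b) (hbc : b < c) (hcd : c < d) (hda : d ≤ a + N) :
    Col B (fun i => QQ (S i) a b c d) := by
  rcases hda.eq_or_lt with e | e
  · obtain ⟨j, l, r, h⟩ := h.split hS (x := c) (by omega) (by omega)
    have hv : l.valid a c := by
      obtain ⟨b, _, h⟩ := h
      exact h.ok.valid.2.2.1
    obtain ⟨k, A, D, h1⟩ := exists_split l a c hv hab hbc
    obtain ⟨b', h2, h3⟩ := h.rs hS (RS.inl h1)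
    refine ⟨b', h2, k, fun i => ?_⟩
    have hn := h3.ok.nodup
    rw [h3.bot, row, R_quad _ hn, e]
    simp only [labels, List.nodup_cons, List.mem_append, List.mem_cons, not_or] at hn
    have hjk : j ≠ k := hn.1.1.1
    simp only [w, lab_node, Option.some.injEq, hjk, yC, QQ, ↓reduceIte]
    ring
  · obtain ⟨j0, l, r, h⟩ := h.split hS (x := d) (by omega) (by omega)
    have hv : l.valid a d := by
      obtain ⟨b, _, h⟩ := h
      exact h.ok.valid.2.2.1
    obtain ⟨j, l1, C, h1⟩ := exists_split (x := c) l a d hv (by omega) hcd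
    have h := h.rs hS (RS.inl h1)
    have hv : l1.valid a c := by
      obtain ⟨b, _, h⟩ := h
      exact h.ok.valid.2.2.1.2.2.1
    obtain ⟨k, A, D, h2⟩ := exists_split l1 a c hv hab hbc
    obtain ⟨b', h3, h4⟩ := h.rs hS (RS.inl (RS.inl h2))
    refine ⟨b', h3, k, fun i => ?_⟩
    have hn := h4.ok.nodup
    rw [labels, List.nodup_cons, List.nodup_append] at hn
    obtain ⟨hn0, hn1, hn2, hn3⟩ := hn
    have hk : k ∈ (node j c (node k b A D) C).labels := by simp [labels]
    have hr : k ∉ r.labels := fun h => hn3 k hk k h rfl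
    have hr' : r.lab ≠ some k := fun e => hr (lab_mem e)
    have hj0 : j0 ≠ k := by
      rintro rfl
      exact hn0 (List.mem_append_left _ hk)
    rw [h4.bot, row, R, R_quad _ hn1, R_col_zero _ r _ _ hr]
    simp only [labels, List.nodup_cons, List.mem_append, List.mem_cons, not_or] at hn1
    have hjk : j ≠ k := hn1.1.1.1
    simp only [w, lab_node, Option.some.injEq, hjk, hj0, hr', yC, QQ, ↓reduceIte]
    ring

theorem Reach.root (hS : ∀ i, GoodS N (S i)) {T : Tr n} {z x : ℤ} (h : Reach B N S T z)
    (h1 : z < x) (h2 : x < z + N) :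
    Col B (fun i => 2 * (|S i z - S i x| - |S i x - S i (z + N)|)) := by
  obtain ⟨k, l, r, b, h3, h4⟩ := h.split hS h1 h2
  refine ⟨b, h3, k, fun i => ?_⟩
  rw [h4.bot, row_root _ h4.ok.nodup]

theorem Col.neg {Q : Fin n → ℤ} (h : Col B Q) : Col B (fun i => - Q i) := by
  obtain ⟨b, h1, k, h2⟩ := h
  refine ⟨mutMatExt k b, h1.tail ⟨k, rfl⟩, k, fun i => ?_⟩
  rw [mutMatExt_apply, if_pos (Or.inr rfl)]
  dsimp only
  rw [← h2]
  ring

theorem Col.congr {Q Q' : Fin n → ℤ} (h : Col B Q) (hQ : ∀ i, Q i = Q' i) : Col B Q' := by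
  obtain ⟨b, h1, k, h2⟩ := h
  exact ⟨b, h1, k, fun i => by rw [h2, hQ]⟩

end

section

variable {B : Matrix (Fin n) (Fin n) ℤ} {N : ℤ} {p m q : Fin n → ℤ} {r : Fin n}

theorem Geo.m_inj (g : Geo N p m q r) {u v : Fin n} (h : u ≠ v) : m u ≠ m v := by
  have := g.lam u v h
  have := g.bd u
  have := g.bd v
  omega

theorem Geo.two_le (g : Geo N p m q r) : 2 ≤ N := by
  have := g.bd r
  omega

theorem Geo.reach (g : Geo N p m q r) {T : Tr n} (h : Reach B N (SS N p q r) T 0) {z : ℤ}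
    (hz : 0 ≤ z) : ∃ T, Reach B N (SS N p q r) T z := by
  lift z to ℕ using hz
  exact h.all g.good g.two_le z

theorem Geo.col_G2 (g : Geo N p m q r) {T : Tr n} (h : Reach B N (SS N p q r) T 0) (u v : Fin n)
    (huv : m u ≤ m v) : Col B (fun i => 4 * G2 p m q r u v i) := by
  have bu := g.bd u
  have bv := g.bd v
  obtain ⟨T, hT⟩ := g.reach h (z := m v) (by omega)
  by_cases e : u = v
  · subst e
    refine (hT.root g.good (x := m u + 1) (by omega) (by have := g.two_le; omega)).neg.congr
      (fun i => ?_)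
    have f1 := g.same (w := u) (x := m u) (y := m u + 1) (by omega) (by omega) (by omega) (by omega) i
    have f2 := g.cross (x := m u + 1) (y := m u + N) (by omega) (by omega) (by omega) (by omega) i
    rw [f1, f2, g.anti, abs_neg, hh, G2]
    split_ifs <;> ring
  · have := g.m_inj e
    refine (hT.quad g.good (b := m v + 1) (c := m u + N) (d := m u + N + 1) (by omega) (by omega)
      (by omega) (by omega)).neg.congr (fun i => ?_)
    have f1 := g.same (w := v) (x := m v) (y := m v + 1) (by omega) (by omega) (by omega) (by omega) i
    have f2 := g.same' (w := u) (x := m u + N) (y := m u + N + 1) (by omega) (by omega) (by omega)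
      (by omega) i
    have f3 := g.cross (x := m v + 1) (y := m u + N) (by omega) (by omega) (by omega) (by omega) i
    have f4 := g.cross (x := m v) (y := m u + N + 1) (by omega) (by omega) (by omega) (by omega) i
    rw [QQ, f1, f2, f3, f4, hh, hh, G2]
    split_ifs <;> ring

/-- The meet of two nodes. -/
theorem Geo.meet (g : Geo N p m q r) {u v : Fin n} (h : m u < m v) :
    ∃ w, p w < m u ∧ m u ≤ m w ∧ m w < m v + 1 ∧ m v + 1 ≤ q w := by
  have bu := g.bd u
  have bv := g.bd v
  exact g.lca _ _ (by omega) (by omega) (by omega)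

theorem Geo.meet_mul (g : Geo N p m q r) {u v w : Fin n} (h : m u < m v)
    (hw : p w < m u ∧ m u ≤ m w ∧ m w < m v + 1 ∧ m v + 1 ≤ q w) (i : Fin n) :
    An p m q i w = An p m q i u * An p m q i v := by
  rw [g.An_eq hw.1 hw.2.1 hw.2.2.1 hw.2.2.2, An, An]
  have := g.bd i
  split_ifs <;> omega

theorem Geo.G1_eq (g : Geo N p m q r) {u v w : Fin n} (h : m u < m v)
    (hw : p w < m u ∧ m u ≤ m w ∧ m w < m v + 1 ∧ m v + 1 ≤ q w) (i : Fin n) :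
    G1 p m q u v i = An p m q i u + An p m q i v - 2 * An p m q i w := by
  rw [g.meet_mul h hw, G1, An, An]
  split_ifs <;> norm_num

theorem Geo.col_G1 (g : Geo N p m q r) {T : Tr n} (h : Reach B N (SS N p q r) T 0) (u v : Fin n)
    (huv : m u < m v) : Col B (fun i => 4 * G1 p m q u v i) := by
  have bu := g.bd u
  have bv := g.bd v
  obtain ⟨T, hT⟩ := g.reach h (z := m u) (by omega)
  obtain ⟨w, hw⟩ := g.meet huv
  have hG := g.G1_eq huv hw
  have fu := g.same (w := u) (x := m u) (y := m u + 1) (by omega) (by omega) (by omega) (by omega)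
  have fv := g.same (w := v) (x := m v) (y := m v + 1) (by omega) (by omega) (by omega) (by omega)
  have fw := g.same hw.1 hw.2.1 hw.2.2.1 hw.2.2.2
  by_cases e1 : u = w
  · subst e1
    have f1 := g.same (w := u) (x := m u) (y := m v) (by omega) (by omega) (by omega) (by omega)
    have f2 := g.cross (x := m v + 1) (y := N + 1) (by omega) (by omega) (by omega) (by omega)
    have f3 := g.cross (x := m u) (y := N + 1) (by omega) (by omega) (by omega) (by omega)
    refine (hT.quad g.good (b := m v) (c := m v + 1) (d := N + 1) (by omega) (by omega)
      (by omega) (by omega)).congr (fun i => ?_)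
    rw [QQ, f1, f2, f3, fv, hG, hh, hh]
    by_cases hi : i = r
    · subst hi; simp only [g.An_root, ↓reduceIte]; ring
    · simp only [hi, ↓reduceIte]; ring
  by_cases e2 : v = w
  · subst e2
    have f1 := g.same (w := v) (x := m u + 1) (y := m v + 1) (by omega) (by omega) (by omega)
      (by omega)
    have f2 := g.cross (x := m v + 1) (y := N + 1) (by omega) (by omega) (by omega) (by omega)
    have f3 := g.cross (x := m u) (y := N + 1) (by omega) (by omega) (by omega) (by omega)
    refine (hT.quad g.good (b := m u + 1) (c := m v + 1) (d := N + 1) (by omega) (by omega)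
      (by omega) (by omega)).neg.congr (fun i => ?_)
    rw [QQ, f1, f2, f3, fu, hG, hh, hh]
    by_cases hi : i = r
    · subst hi; simp only [g.An_root, ↓reduceIte]; ring
    · simp only [hi, ↓reduceIte]; ring
  · have := g.m_inj e1
    have := g.m_inj e2
    have f1 := g.same (w := w) (x := m u + 1) (y := m v) (by omega) (by omega) (by omega)
      (by omega)
    refine (hT.quad g.good (b := m u + 1) (c := m v) (d := m v + 1) (by omega) (by omega)
      (by omega) (by omega)).neg.congr (fun i => ?_)
    rw [QQ, f1, fu, fv, fw, hG, hh, hh, hh]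
    by_cases hi : i = r
    · subst hi; simp only [g.An_root, ↓reduceIte]; ring
    · simp only [hi, ↓reduceIte]; ring

theorem G2_comm (u v i : Fin n) : G2 p m q r u v i = G2 p m q r v u i := by
  unfold G2; rw [add_comm]

theorem G1_comm (u v i : Fin n) : G1 p m q u v i = G1 p m q v u i := by
  unfold G1; rw [abs_sub_comm]

theorem Geo.col_iff (g : Geo N p m q r) {T : Tr n} (h : Rep N (SS N p q r) (extMat B) T 0)
    (Q : Fin n → ℤ) : Col B Q ↔ InX p m q r Q := by
  constructor
  · rintro ⟨b, h1, k, h2⟩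
    have : ∃ T z, Rep N (SS N p q r) b T z := by
      clear h2
      induction h1 with
      | refl => exact ⟨T, 0, h⟩
      | tail _ hr ih =>
        obtain ⟨T, z, ih⟩ := ih
        obtain ⟨k, rfl⟩ := hr
        obtain ⟨T', z', hs⟩ := exists_step ih.ok k
        exact ⟨T', z', ih.step g.good hs⟩
    obtain ⟨T, z, hT⟩ := this
    have e : Q = fun i => row (yC (SS N p q r i)) T z (z + N) k := by
      funext i
      rw [← h2, hT.bot]
    rw [e]
    exact g.inX_row hT.ok k
  · have hR : Reach B N (SS N p q r) T 0 := ⟨_, .refl, h⟩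
    have k2 : ∀ u v, Col B (fun i => 4 * G2 p m q r u v i) := fun u v => by
      rcases le_total (m u) (m v) with e | e
      · exact g.col_G2 hR u v e
      · exact (g.col_G2 hR v u e).congr (fun i => by rw [G2_comm])
    have k1 : ∀ u v, u ≠ v → Col B (fun i => 4 * G1 p m q u v i) := fun u v huv => by
      rcases lt_or_gt_of_ne (g.m_inj huv) with e | e
      · exact g.col_G1 hR u v e
      · exact (g.col_G1 hR v u e).congr (fun i => by rw [G1_comm])
    rintro ⟨u, v, h | h | ⟨h0, h⟩ | ⟨h0, h⟩⟩
    · exact (k2 u v).congr (fun i => (h i).symm)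
    · exact (k2 u v).neg.congr (fun i => (h i).symm)
    · exact (k1 u v h0).congr (fun i => (h i).symm)
    · exact (k1 u v h0).neg.congr (fun i => (h i).symm)

end

end Tr

/-! ## Counting -/

namespace Tr

variable {n : ℕ} {N : ℤ} {p m q : Fin n → ℤ} {r : Fin n}

theorem Geo.lin (g : Geo N p m q r) (f : Fin n → ℤ) (hf : ∀ i, ∑ u, f u * An p m q i u = 0) :
    ∀ i, f i = 0 := by
  have key : ∀ L : ℕ, ∀ i, q i - p i < L → f i = 0 := by
    intro L
    induction L with
    | zero => intro i hi; have := g.bd i; omega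
    | succ L ih =>
      intro i hi
      have h := hf i
      have bi := g.bd i
      rw [Finset.sum_eq_single i] at h
      · rw [An, if_pos (by omega)] at h
        omega
      · intro u _ hu
        rw [An]
        split_ifs with hc
        · rw [ih u, zero_mul]
          have := g.lam u i hu
          have := g.bd u
          omega
        · rw [mul_zero]
      · intro h; exact absurd (Finset.mem_univ i) h
  intro i
  exact key (q i - p i + 1).toNat i (by have := g.bd i; omega)

/-- Indicator of a point. -/
def dl (u x : Fin n) : ℤ := if x = u then 1 else 0

theorem dl_sum (f : Fin n → ℤ) (u : Fin n) : ∑ x, dl u x * f x = f u := by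
  simp [dl]

theorem Geo.G1_form (g : Geo N p m q r) {u v : Fin n} (h : u ≠ v) :
    ∃ w, ∀ i, G1 p m q u v i = An p m q i u + An p m q i v - 2 * An p m q i w := by
  rcases lt_or_gt_of_ne (g.m_inj h) with e | e
  · obtain ⟨w, hw⟩ := g.meet e
    exact ⟨w, g.G1_eq e hw⟩
  · obtain ⟨w, hw⟩ := g.meet e
    exact ⟨w, fun i => by rw [G1_comm, g.G1_eq e hw]; ring⟩

theorem Geo.G2_inj (g : Geo N p m q r) {u v u' v' : Fin n} (h : u ≤ v) (h' : u' ≤ v')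
    (e : ∀ i, G2 p m q r u v i = G2 p m q r u' v' i) : u = u' ∧ v = v' := by
  have hl := g.lin (fun x => dl u x + dl v x - dl u' x - dl v' x) (fun i => by
    simp only [add_mul, sub_mul, Finset.sum_add_distrib, Finset.sum_sub_distrib, dl_sum]
    by_cases hi : i = r
    · subst hi; simp only [g.An_root]; norm_num
    · have := e i
      simp only [G2, hi, ↓reduceIte] at this
      omega)
  have h1 := hl u
  have h2 := hl v
  have h3 := hl u'
  have h4 := hl v'
  have a1 : ∀ x : Fin n, dl x x = 1 := fun x => by simp [dl]
  have a2 : ∀ x y : Fin n, 0 ≤ dl x y := fun x y => by unfold dl; split_ifs <;> norm_num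
  have a3 : ∀ x y : Fin n, dl x y ≠ 0 → y.val = x.val := fun x y hxy => by
    by_contra hc
    exact hxy (by simp [dl, Fin.ext_iff, hc])
  rw [Fin.le_def] at h h'
  rw [Fin.ext_iff, Fin.ext_iff]
  have b1 : u.val = u'.val ∨ u.val = v'.val := by
    by_contra hc
    have := a3 u' u
    have := a3 v' u
    have := a1 u
    have := a2 v u
    omega
  have b2 : v.val = u'.val ∨ v.val = v'.val := by
    by_contra hc
    have := a3 u' v
    have := a3 v' v
    have := a1 v
    have := a2 u v
    omega
  have b3 : u'.val = u.val ∨ u'.val = v.val := by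
    by_contra hc
    have := a3 u u'
    have := a3 v u'
    have := a1 u'
    have := a2 v' u'
    omega
  have b4 : v'.val = u.val ∨ v'.val = v.val := by
    by_contra hc
    have := a3 u v'
    have := a3 v v'
    have := a1 v'
    have := a2 u' v'
    omega
  omega

theorem Geo.G1_inj (g : Geo N p m q r) {u v u' v' : Fin n} (h : v < u) (h' : v' < u')
    (e : ∀ i, G1 p m q u v i = G1 p m q u' v' i) : u = u' ∧ v = v' := by
  obtain ⟨w, hw⟩ := g.G1_form h.ne'
  obtain ⟨w', hw'⟩ := g.G1_form h'.ne'
  have hl := g.lin (fun x => dl u x + dl v x - 2 * dl w x - (dl u' x + dl v' x - 2 * dl w' x))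
    (fun i => by
      simp only [add_mul, sub_mul, mul_assoc, Finset.sum_add_distrib, Finset.sum_sub_distrib,
        ← Finset.mul_sum, dl_sum]
      have := e i
      rw [hw, hw'] at this
      omega)
  have h1 := hl u
  have h2 := hl v
  rw [Fin.lt_def] at h h'
  rw [Fin.ext_iff, Fin.ext_iff]
  have a1 : dl u u = 1 := by simp [dl]
  have a2 : dl v v = 1 := by simp [dl]
  have a3 : dl u v = 0 := by simp [dl, Fin.ext_iff]; omega
  have a4 : dl v u = 0 := by simp [dl, Fin.ext_iff]; omega
  rw [a1, a4] at h1
  rw [a2, a3] at h2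
  have b1 : u.val = u'.val ∨ u.val = v'.val := by
    by_contra hc
    have c1 : dl u' u = 0 := by simp [dl, Fin.ext_iff]; omega
    have c2 : dl v' u = 0 := by simp [dl, Fin.ext_iff]; omega
    omega
  have b2 : v.val = u'.val ∨ v.val = v'.val := by
    by_contra hc
    have c1 : dl u' v = 0 := by simp [dl, Fin.ext_iff]; omega
    have c2 : dl v' v = 0 := by simp [dl, Fin.ext_iff]; omega
    omega
  omega

/-- All positive vectors. -/
def FF (p m q : Fin n → ℤ) (r : Fin n) (x : Fin n × Fin n) : Fin n → ℤ :=
  if x.1 ≤ x.2 then G2 p m q r x.1 x.2 else G1 p m q x.1 x.2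

theorem G2_root (u v : Fin n) : G2 p m q r u v r = 1 := by simp [G2]

theorem Geo.G1_root (g : Geo N p m q r) (u v : Fin n) : G1 p m q u v r = 0 := by
  simp [G1, g.An_root]

theorem Geo.FF_inj (g : Geo N p m q r) : Function.Injective (FF p m q r) := by
  rintro ⟨u, v⟩ ⟨u', v'⟩ e
  simp only [FF] at e
  split_ifs at e with h1 h2 h2
  · obtain ⟨rfl, rfl⟩ := g.G2_inj h1 h2 (fun i => congrFun e i)
    rfl
  · have := congrFun e r
    rw [G2_root, g.G1_root] at this
    omega
  · have := congrFun e r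
    rw [G2_root, g.G1_root] at this
    omega
  · obtain ⟨rfl, rfl⟩ := g.G1_inj (not_le.1 h1) (not_le.1 h2) (fun i => congrFun e i)
    rfl

theorem FF_nonneg (x : Fin n × Fin n) (i : Fin n) : 0 ≤ FF p m q r x i := by
  unfold FF
  split_ifs
  · unfold G2 An
    split_ifs <;> norm_num
  · exact abs_nonneg _

theorem Geo.FF_ne (g : Geo N p m q r) (x : Fin n × Fin n) : ∃ i, FF p m q r x i ≠ 0 := by
  unfold FF
  split_ifs with h
  · exact ⟨r, by rw [G2_root]; norm_num⟩
  · by_contra hc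
    push Not at hc
    have hne : x.1 ≠ x.2 := fun e => h e.le
    have h1 := hc x.1
    have h2 := hc x.2
    have := g.lam _ _ hne
    have := g.bd x.1
    have := g.bd x.2
    simp only [G1, An, abs_eq_zero] at h1 h2
    split_ifs at h1 h2 <;> omega

theorem InX_iff (c : Fin n → ℤ) : InX p m q r (fun i => 4 * c i) ↔
    c ∈ Set.range (FF p m q r) ∪ Set.range (fun x => -FF p m q r x) := by
  have k2 : ∀ u v, ∃ x, ∀ i, FF p m q r x i = G2 p m q r u v i := fun u v => by
    rcases le_total u v with e | e
    · exact ⟨(u, v), fun i => by simp only [FF, if_pos e]⟩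
    · exact ⟨(v, u), fun i => by simp only [FF, if_pos e]; rw [G2_comm]⟩
  have k1 : ∀ u v, u ≠ v → ∃ x, ∀ i, FF p m q r x i = G1 p m q u v i := fun u v h => by
    rcases lt_or_gt_of_ne h with e | e
    · exact ⟨(v, u), fun i => by simp only [FF, if_neg (not_le.2 e)]; rw [G1_comm]⟩
    · exact ⟨(u, v), fun i => by simp only [FF, if_neg (not_le.2 e)]⟩
  constructor
  · rintro ⟨u, v, h | h | ⟨h0, h⟩ | ⟨h0, h⟩⟩
    · obtain ⟨x, hx⟩ := k2 u v
      exact Or.inl ⟨x, funext fun i => by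
        have h2 := h i
        have := hx i
        dsimp only at h2
        omega⟩
    · obtain ⟨x, hx⟩ := k2 u v
      exact Or.inr ⟨x, funext fun i => by
        have h2 := h i
        have := hx i
        dsimp only at h2
        simp only [Pi.neg_apply]
        omega⟩
    · obtain ⟨x, hx⟩ := k1 u v h0
      exact Or.inl ⟨x, funext fun i => by
        have h2 := h i
        have := hx i
        dsimp only at h2
        omega⟩
    · obtain ⟨x, hx⟩ := k1 u v h0
      exact Or.inr ⟨x, funext fun i => by
        have h2 := h i
        have := hx i
        dsimp only at h2
        simp only [Pi.neg_apply]
        omega⟩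
  · rintro (⟨x, rfl⟩ | ⟨x, rfl⟩)
    · refine ⟨x.1, x.2, ?_⟩
      by_cases e : x.1 ≤ x.2
      · exact Or.inl fun i => by simp only [FF, if_pos e]
      · exact Or.inr (Or.inr (Or.inl ⟨fun h => e h.le, fun i => by simp only [FF, if_neg e]⟩))
    · refine ⟨x.1, x.2, ?_⟩
      by_cases e : x.1 ≤ x.2
      · exact Or.inr (Or.inl fun i => by simp only [FF, if_pos e, Pi.neg_apply]; ring)
      · exact Or.inr (Or.inr (Or.inr ⟨fun h => e h.le, fun i => by
          simp only [FF, if_neg e, Pi.neg_apply]; ring⟩))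

theorem Geo.ncard (g : Geo N p m q r) :
    (Set.range (FF p m q r) ∪ Set.range (fun x => -FF p m q r x)).ncard = 2 * n ^ 2 := by
  rw [Set.ncard_union_eq]
  · rw [← Set.image_univ, ← Set.image_univ, Set.ncard_image_of_injective _ g.FF_inj,
      Set.ncard_image_of_injective _ (fun x y h => g.FF_inj (neg_injective h)), Set.ncard_univ]
    simp
    ring
  · rw [Set.disjoint_left]
    rintro _ ⟨x, rfl⟩ ⟨y, h⟩
    obtain ⟨i, hi⟩ := g.FF_ne x
    have h1 := congrFun h i
    simp only [Pi.neg_apply] at h1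
    have h2 := FF_nonneg (p := p) (m := m) (q := q) (r := r) x i
    have h3 := FF_nonneg (p := p) (m := m) (q := q) (r := r) y i
    omega

theorem isCVec_iff (B : Matrix (Fin n) (Fin n) ℤ) (c : Fin n → ℤ) :
    IsCVec B c ↔ Col B (fun i => 4 * c i) := by
  constructor
  · rintro ⟨b, h, j, rfl⟩
    exact ⟨b, h, j, fun i => rfl⟩
  · rintro ⟨b, h, j, hc⟩
    exact ⟨b, h, j, funext fun i => by have := hc i; dsimp only at this; omega⟩

theorem card_main (hn : 2 ≤ n) (B : Matrix (Fin n) (Fin n) ℤ) (hB : SkewSymmetrizable B)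
    (htype : MatrixOfTypeC B) : {c : Fin n → ℤ | IsCVec B c}.ncard = 2 * n ^ 2 := by
  obtain ⟨T, hT⟩ := exists_repB hn B hB htype
  obtain ⟨p, m, q, r, g, hR⟩ := exists_geo hn hT
  have e : {c : Fin n → ℤ | IsCVec B c} =
      Set.range (FF p m q r) ∪ Set.range (fun x => -FF p m q r x) := by
    ext c
    rw [Set.mem_ofPred_eq, isCVec_iff, g.col_iff hR, InX_iff]
  rw [e, g.ncard]

end Tr

/-- A cluster algebra with principal coefficients of type `C_n` (`n ≥ 2`) has
exactly `2n²` `c`-vectors. -/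
theorem card_c_vectors_type_C {n : ℕ} (hn : 2 ≤ n)
    (B : Matrix (Fin n) (Fin n) ℤ) (hB : SkewSymmetrizable B)
    (htype : MatrixOfTypeC B) :
    {c : Fin n → ℤ | IsCVec B c}.ncard = 2 * n ^ 2 := by
  exact Tr.card_main hn B hB htype
end
end
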